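/- Let m ≥ 2, let 1 < q⃗_k < ∞ for k = 1,…,m, let 1/q⃗ = 1/q⃗_1 + ⋯ + 1/q⃗_m (componentwise), and let φ, φ_1,…,φ_m : ℝ^n × (0,∞) → (0,∞) be Lebesgue measurable functions satisfying, for some constant C_0, all x ∈ ℝ^n, r > 0, and every index i ∈ {1,…,m}: (∫_r^∞ (1+ln(t/r)) φ_i(x,t)·t^{−1} dt) · Π_{k≠i} ∫_r^∞ φ_k(x,t)·t^{−1} dt ≤ C_0 · φ(x,r). If b⃗ = (b_1,…,b_m) with each b_k ∈ BMO(ℝ^n), then each M^{b⃗}_{m,i} (i = 1,…,m), and hence also M^{b⃗}_m, is bounded from M^{φ_1}_{q⃗_1}(ℝ^n)×⋯×M^{φ_m}_{q⃗_m}(ℝ^n) to M^{φ}_{q⃗}(ℝ^n): there is C > 0 such that ‖M^{b⃗}_{m,i}(f⃗)‖_{M^φ_{q⃗}} ≤ C Π_{k=1}^m ‖f_k‖_{M^{φ_k}_{q⃗_k}} for all f_k ∈ M^{φ_k}_{q⃗_k}(ℝ^n). -/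

import Mathlib

open MeasureTheory ENNReal Set

noncomputable section

/-- Euclidean distance on `Fin n → ℝ`. -/
def eudist (n : ℕ) (x y : Fin n → ℝ) : ℝ :=
  Real.sqrt (∑ i, (x i - y i) ^ 2)

/-- Open Euclidean ball in `Fin n → ℝ`. -/
def eball (n : ℕ) (x : Fin n → ℝ) (r : ℝ) : Set (Fin n → ℝ) :=
  {y | eudist n x y < r}

/-- Iterated mixed Lebesgue "norm" of an `ℝ≥0∞`-valued function: the innermost
integration is in the first coordinate with exponent `q 0`, the outermost in the
last coordinate with exponent `q (n-1)`. -/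
def mixedLnorm : (n : ℕ) → (Fin n → ℝ) → ((Fin n → ℝ) → ℝ≥0∞) → ℝ≥0∞
  | 0, _, g => g (fun i => i.elim0)
  | (n + 1), q, g =>
      (∫⁻ t : ℝ, (mixedLnorm n (fun i => q i.castSucc)
          (fun y => g (Fin.snoc y t))) ^ q (Fin.last n)) ^ (1 / q (Fin.last n))

/-- Mixed Lebesgue norm `‖f‖_{L^{q⃗}}` of a real-valued function on `ℝ^n`. -/
def mixedNorm (n : ℕ) (q : Fin n → ℝ) (f : (Fin n → ℝ) → ℝ) : ℝ≥0∞ :=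
  mixedLnorm n q (fun x => ENNReal.ofReal |f x|)

/-- Generalized mixed Morrey norm of an `ℝ≥0∞`-valued function. -/
def morreyLnorm (n : ℕ) (q : Fin n → ℝ) (φ : (Fin n → ℝ) → ℝ → ℝ)
    (g : (Fin n → ℝ) → ℝ≥0∞) : ℝ≥0∞ :=
  ⨆ (x : Fin n → ℝ) (r : ℝ) (_ : 0 < r),
    (ENNReal.ofReal (φ x r))⁻¹
      * (mixedNorm n q ((eball n x r).indicator fun _ => (1 : ℝ)))⁻¹
      * mixedLnorm n q ((eball n x r).indicator g)

/-- Generalized mixed Morrey norm `‖f‖_{M^φ_{q⃗}}` of a real-valued function. -/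
def morreyNorm (n : ℕ) (q : Fin n → ℝ) (φ : (Fin n → ℝ) → ℝ → ℝ)
    (f : (Fin n → ℝ) → ℝ) : ℝ≥0∞ :=
  morreyLnorm n q φ (fun x => ENNReal.ofReal |f x|)

/-- The BMO norm (as an extended real number). -/
def bmoNorm (n : ℕ) (b : (Fin n → ℝ) → ℝ) : ℝ≥0∞ :=
  ⨆ (x : Fin n → ℝ) (r : ℝ) (_ : 0 < r),
    ENNReal.ofReal ((volume (eball n x r)).toReal⁻¹
      * ∫ y in eball n x r, |b y - ⨍ z in eball n x r, b z|)

/-- Sublinearity in each entry of a multi-(sub)linear operator. -/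
def EntrywiseSublinear (n m : ℕ)
    (T : (Fin m → ((Fin n → ℝ) → ℝ)) → ((Fin n → ℝ) → ℝ)) : Prop :=
  (∀ (f : Fin m → ((Fin n → ℝ) → ℝ)) (i : Fin m) (g h : (Fin n → ℝ) → ℝ)
      (x : Fin n → ℝ),
      |T (Function.update f i (g + h)) x|
        ≤ |T (Function.update f i g) x| + |T (Function.update f i h) x|) ∧
  (∀ (f : Fin m → ((Fin n → ℝ) → ℝ)) (i : Fin m) (c : ℝ) (g : (Fin n → ℝ) → ℝ)
      (x : Fin n → ℝ),
      |T (Function.update f i (c • g)) x| = |c| * |T (Function.update f i g) x|)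

/-- The multi-sublinear size condition (1.1) with constant `C`. -/
def SizeCond (n m : ℕ)
    (T : (Fin m → ((Fin n → ℝ) → ℝ)) → ((Fin n → ℝ) → ℝ)) (C : ℝ) : Prop :=
  ∀ f : Fin m → ((Fin n → ℝ) → ℝ),
    (∀ i, Integrable (f i)) → (∀ i, HasCompactSupport (f i)) →
    ∀ x, x ∉ ⋂ j, Function.support (f j) →
      |T f x| ≤ C * ∫ y : Fin m → (Fin n → ℝ),
        (∏ i, |f i (y i)|) / Real.sqrt (∑ i, eudist n x (y i) ^ 2) ^ (m * n)

/-- The multi-sublinear commutator size condition (1.2), with symbol `b` and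
distinguished index `i`, with constant `C`. -/
def CommSizeCond (n m : ℕ) (b : (Fin n → ℝ) → ℝ) (i : Fin m)
    (T : (Fin m → ((Fin n → ℝ) → ℝ)) → ((Fin n → ℝ) → ℝ)) (C : ℝ) : Prop :=
  ∀ f : Fin m → ((Fin n → ℝ) → ℝ),
    (∀ k, Integrable (f k)) → (∀ k, HasCompactSupport (f k)) →
    ∀ x, x ∉ ⋂ j, Function.support (f j) →
      |T f x| ≤ C * ∫ y : Fin m → (Fin n → ℝ),
        |b x - b (y i)| * (∏ k, |f k (y k)|)
          / Real.sqrt (∑ k, eudist n x (y k) ^ 2) ^ (m * n)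

/-- The Hardy–Littlewood maximal operator. -/
def hlMax (n : ℕ) (f : (Fin n → ℝ) → ℝ) (x : Fin n → ℝ) : ℝ≥0∞ :=
  ⨆ (r : ℝ) (_ : 0 < r),
    (volume (eball n x r))⁻¹ * ∫⁻ y in eball n x r, ENNReal.ofReal |f y|

/-- The maximal commutator of the Hardy–Littlewood maximal operator. -/
def maxComm (n : ℕ) (b f : (Fin n → ℝ) → ℝ) (x : Fin n → ℝ) : ℝ≥0∞ :=
  ⨆ (r : ℝ) (_ : 0 < r),
    (volume (eball n x r))⁻¹
      * ∫⁻ y in eball n x r, ENNReal.ofReal (|b x - b y| * |f y|)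

/-- The multi-sublinear maximal operator `M_m`. -/
def multiMax (n m : ℕ) (f : Fin m → ((Fin n → ℝ) → ℝ)) (x : Fin n → ℝ) : ℝ≥0∞ :=
  ⨆ (r : ℝ) (_ : 0 < r),
    ∏ i, (volume (eball n x r))⁻¹ * ∫⁻ y in eball n x r, ENNReal.ofReal |f i y|

/-- The multi-sublinear maximal commutator `M^{b⃗}_{m,i}`. -/
def multiMaxComm (n m : ℕ) (b : Fin m → ((Fin n → ℝ) → ℝ)) (i : Fin m)
    (f : Fin m → ((Fin n → ℝ) → ℝ)) (x : Fin n → ℝ) : ℝ≥0∞ :=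
  (⨆ (r : ℝ) (_ : 0 < r),
      (volume (eball n x r))⁻¹
        * ∫⁻ y in eball n x r, ENNReal.ofReal (|b i x - b i y| * |f i y|)) *
  (⨆ (r : ℝ) (_ : 0 < r),
      ∏ k ∈ Finset.univ.erase i,
        (volume (eball n x r))⁻¹ * ∫⁻ y in eball n x r, ENNReal.ofReal |f k y|)

/-- `w` is an `A₁` weight with constant `c`. -/
def IsA1Weight (n : ℕ) (w : (Fin n → ℝ) → ℝ) (c : ℝ) : Prop :=
  (∀ x, 0 < w x) ∧ LocallyIntegrable w ∧
    ∀ (x : Fin n → ℝ) (r : ℝ), 0 < r →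
      ∀ᵐ y ∂(volume.restrict (eball n x r)),
        (volume (eball n x r)).toReal⁻¹ * ∫ z in eball n x r, w z ≤ c * w y

/-- `T` is an `m`-linear Calderón–Zygmund operator. -/
def IsCZOperator (n m : ℕ)
    (T : (Fin m → ((Fin n → ℝ) → ℝ)) → ((Fin n → ℝ) → ℝ)) : Prop :=
  -- additivity in each entry
  (∀ (f : Fin m → ((Fin n → ℝ) → ℝ)) (i : Fin m) (g h : (Fin n → ℝ) → ℝ),
      T (Function.update f i (g + h))
        = T (Function.update f i g) + T (Function.update f i h)) ∧
  -- homogeneity in each entry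
  (∀ (f : Fin m → ((Fin n → ℝ) → ℝ)) (i : Fin m) (c : ℝ) (g : (Fin n → ℝ) → ℝ),
      T (Function.update f i (c • g)) = c • T (Function.update f i g)) ∧
  -- boundedness from a product of Lebesgue spaces
  (∃ (s : Fin m → ℝ) (s₀ A : ℝ), (∀ i, 1 ≤ s i) ∧ 0 < s₀ ∧
      (1 / s₀ = ∑ i, 1 / s i) ∧ 0 < A ∧
      ∀ f : Fin m → ((Fin n → ℝ) → ℝ), (∀ i, Measurable (f i)) →
        (∀ i, mixedNorm n (fun _ => s i) (f i) ≠ ⊤) →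
        mixedNorm n (fun _ => s₀) (T f)
          ≤ ENNReal.ofReal A * ∏ i, mixedNorm n (fun _ => s i) (f i)) ∧
  -- Calderón–Zygmund kernel and representation
  (∃ (K : (Fin n → ℝ) → (Fin m → (Fin n → ℝ)) → ℝ) (ε C : ℝ), 0 < ε ∧ 0 < C ∧
      -- size estimate
      (∀ x y, ¬(∀ k, y k = x) →
        |K x y| ≤ C / (∑ k, eudist n x (y k)) ^ (m * n)) ∧
      -- regularity in the first variable
      (∀ x x' y, ¬(∀ k, y k = x) →
        2 * eudist n x x' ≤ (⨆ k, eudist n x (y k)) →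
        |K x y - K x' y|
          ≤ C * eudist n x x' ^ ε / (∑ k, eudist n x (y k)) ^ ((m * n : ℝ) + ε)) ∧
      -- regularity in each of the remaining variables
      (∀ x y (k : Fin m) (y' : Fin n → ℝ), ¬(∀ j, y j = x) →
        2 * eudist n (y k) y' ≤ (⨆ j, eudist n x (y j)) →
        |K x y - K x (Function.update y k y')|
          ≤ C * eudist n (y k) y' ^ ε / (∑ j, eudist n x (y j)) ^ ((m * n : ℝ) + ε)) ∧
      -- integral representation off the supports
      (∀ f : Fin m → ((Fin n → ℝ) → ℝ),
        (∀ j, Measurable (f j)) → (∀ j, ∃ M : ℝ, ∀ x, |f j x| ≤ M) →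
        (∀ j, HasCompactSupport (f j)) →
        ∀ x, x ∉ ⋂ j, Function.support (f j) →
          T f x = ∫ y : Fin m → (Fin n → ℝ), K x y * ∏ j, f j (y j)))

/-- The commutator `K^{b⃗}_{m,i}` of an `m`-linear operator. -/
def czComm (n m : ℕ) (T : (Fin m → ((Fin n → ℝ) → ℝ)) → ((Fin n → ℝ) → ℝ))
    (b : Fin m → ((Fin n → ℝ) → ℝ)) (i : Fin m)
    (f : Fin m → ((Fin n → ℝ) → ℝ)) : (Fin n → ℝ) → ℝ :=
  fun x => b i x * T f x - T (Function.update f i fun y => b i y * f i y) x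

namespace MB

/-- one-dimensional dyadic index with shift `a` -/
def idx (k : ℤ) (a t : ℝ) : ℤ := ⌊(2:ℝ) ^ k * t - (-1) ^ k * a⌋

/-- multidimensional dyadic index -/
def cidx {d : ℕ} (α : Fin d → ℝ) (k : ℤ) (x : Fin d → ℝ) : Fin d → ℤ :=
  fun i => idx k (α i) (x i)

/-- the dyadic cell of level `k` containing `x` -/
def cell {d : ℕ} (α : Fin d → ℝ) (k : ℤ) (x : Fin d → ℝ) : Set (Fin d → ℝ) :=
  cidx α k ⁻¹' {cidx α k x}

lemma mem_cell {d : ℕ} {α : Fin d → ℝ} {k : ℤ} {x y : Fin d → ℝ} :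
    y ∈ cell α k x ↔ cidx α k y = cidx α k x := Iff.rfl

lemma self_mem_cell {d : ℕ} {α : Fin d → ℝ} {k : ℤ} {x : Fin d → ℝ} : x ∈ cell α k x := rfl

lemma cell_eq {d : ℕ} {α : Fin d → ℝ} {k : ℤ} {x y : Fin d → ℝ} (h : y ∈ cell α k x) :
    cell α k y = cell α k x := by
  unfold cell; rw [mem_cell.1 h]

lemma measurable_idx (k : ℤ) (a : ℝ) : Measurable (idx k a) := by
  unfold idx; fun_prop

lemma measurable_cidx {d : ℕ} (α : Fin d → ℝ) (k : ℤ) : Measurable (cidx α k) := by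
  unfold cidx
  refine measurable_pi_lambda _ fun i => (measurable_idx k (α i)).comp (measurable_pi_apply i)

lemma measurableSet_cell {d : ℕ} (α : Fin d → ℝ) (k : ℤ) (x : Fin d → ℝ) :
    MeasurableSet (cell α k x) :=
  measurable_cidx α k (measurableSet_singleton _)

/-- admissible shifts -/
def Adm {d : ℕ} (α : Fin d → ℝ) : Prop := ∀ i, ∃ z : ℤ, 3 * α i = z

lemma idx_step {k : ℤ} {a s t : ℝ} (ha : ∃ z : ℤ, 3 * a = z)
    (h : idx (k + 1) a s = idx (k + 1) a t) : idx k a s = idx k a t := by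
  obtain ⟨z, hz⟩ := ha
  have key : ∀ u : ℝ, idx k a u = (idx (k + 1) a u - (((-1 : ℤˣ) ^ k : ℤˣ) : ℤ) * z) / 2 := by
    intro u
    unfold idx
    have h1 : (2:ℝ) ^ k * u - (-1) ^ k * a
        = ((2:ℝ) ^ (k + 1) * u - (-1) ^ (k + 1) * a - (((((-1 : ℤˣ) ^ k : ℤˣ) : ℤ) * z : ℤ) : ℝ)) / 2 := by
      rw [zpow_add₀ (by norm_num), zpow_add₀ (by norm_num)]
      have : ((((-1 : ℤˣ) ^ k : ℤˣ) : ℤ) : ℝ) = (-1) ^ k := by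
        rcases Int.even_or_odd k with hk | hk
        · rw [hk.neg_one_zpow, hk.neg_one_zpow]; simp
        · rw [hk.neg_one_zpow, hk.neg_one_zpow]; simp
      push_cast
      rw [this, ← hz]
      ring
    rw [h1]
    have h2 : ∀ v : ℝ, ⌊v / 2⌋ = ⌊v⌋ / 2 := by
      intro v
      have := Int.floor_div_natCast v 2
      simpa using this
    rw [h2, Int.floor_sub_intCast]
  rw [key s, key t, h]

lemma cidx_mono {d : ℕ} {α : Fin d → ℝ} (hα : Adm α) {k l : ℤ} (hkl : k ≤ l)
    {x y : Fin d → ℝ} (h : cidx α l y = cidx α l x) : cidx α k y = cidx α k x := by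
  obtain ⟨j, rfl⟩ := Int.le.dest hkl
  clear hkl
  induction j with
  | zero => simpa using h
  | succ j ih =>
    apply ih
    funext i
    apply idx_step (hα i)
    have := congrFun h i
    simp only [cidx] at this
    push_cast at this
    rw [← add_assoc] at this
    exact this

lemma cell_subset {d : ℕ} {α : Fin d → ℝ} (hα : Adm α) {k l : ℤ} (hkl : k ≤ l)
    {x : Fin d → ℝ} : cell α l x ⊆ cell α k x := fun _ h => cidx_mono hα hkl h

/-- corner of a cell -/
def corner {d : ℕ} (α : Fin d → ℝ) (k : ℤ) (x : Fin d → ℝ) : Fin d → ℝ :=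
  fun i => (2:ℝ) ^ (-k) * (cidx α k x i + (-1) ^ k * α i)

lemma cell_eq_pi {d : ℕ} (α : Fin d → ℝ) (k : ℤ) (x : Fin d → ℝ) :
    cell α k x = Set.pi univ fun i => Ico (corner α k x i) (corner α k x i + 2 ^ (-k)) := by
  ext y
  simp only [mem_cell, mem_pi, mem_univ, true_imp_iff, mem_Ico, funext_iff]
  refine forall_congr' fun i => ?_
  have h2 : (0:ℝ) < 2 ^ k := by positivity
  simp only [corner]
  generalize hz : cidx α k x i = z
  simp only [cidx, idx, Int.floor_eq_iff, zpow_neg]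
  constructor
  · rintro ⟨h, h'⟩
    constructor
    · rw [inv_mul_le_iff₀ h2]; linarith
    · rw [← mul_add_one, ← div_eq_inv_mul, lt_div_iff₀ h2]; linarith
  · rintro ⟨h, h'⟩
    rw [inv_mul_le_iff₀ h2] at h
    rw [← mul_add_one, ← div_eq_inv_mul, lt_div_iff₀ h2] at h'
    constructor <;> linarith

lemma volume_cell {d : ℕ} (α : Fin d → ℝ) (k : ℤ) (x : Fin d → ℝ) :
    volume (cell α k x) = ENNReal.ofReal ((2:ℝ) ^ (-k)) ^ d := by
  rw [cell_eq_pi, volume_pi_pi]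
  simp

lemma volume_cell_ne_zero {d : ℕ} (α : Fin d → ℝ) (k : ℤ) (x : Fin d → ℝ) :
    volume (cell α k x) ≠ 0 := by
  rw [volume_cell]
  apply pow_ne_zero
  have : (0:ℝ) < 2 ^ (-k) := by positivity
  simpa using this

lemma volume_cell_ne_top {d : ℕ} (α : Fin d → ℝ) (k : ℤ) (x : Fin d → ℝ) :
    volume (cell α k x) ≠ ⊤ := by
  rw [volume_cell]; exact ENNReal.pow_ne_top ENNReal.ofReal_ne_top

lemma localize {d : ℕ} {α : Fin d → ℝ} {k : ℤ} {μ : Measure (Fin d → ℝ)} {S : Set (Fin d → ℝ)}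
    (hS : ∀ x ∈ S, cell α k x ⊆ S) {g h : (Fin d → ℝ) → ℝ≥0∞}
    (hgh : ∀ x ∈ S, ∫⁻ y in cell α k x, g y ∂μ ≤ ∫⁻ y in cell α k x, h y ∂μ) :
    ∫⁻ y in S, g y ∂μ ≤ ∫⁻ y in S, h y ∂μ := by
  classical
  let s : (Fin d → ℤ) → Set (Fin d → ℝ) := fun j => if j ∈ cidx α k '' S then cidx α k ⁻¹' {j} else ∅
  have hU : S = ⋃ j, s j := by
    ext x
    simp only [mem_iUnion, s]
    constructor
    · intro hx
      refine ⟨cidx α k x, ?_⟩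
      rw [if_pos ⟨x, hx, rfl⟩]; rfl
    · rintro ⟨j, hj⟩
      split_ifs at hj with hjS
      · obtain ⟨y, hy, rfl⟩ := hjS
        exact hS y hy hj
      · exact hj.elim
  have hm : ∀ j, MeasurableSet (s j) := by
    intro j; simp only [s]; split_ifs
    · exact measurable_cidx α k (measurableSet_singleton _)
    · exact MeasurableSet.empty
  have hd : Pairwise (Function.onFun Disjoint s) := by
    intro i j hij
    rw [Function.onFun, Set.disjoint_left]
    intro x hxi hxj
    simp only [s] at hxi hxj
    split_ifs at hxi hxj
    · exact hij (hxi.symm.trans hxj)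
    all_goals first | exact hxi.elim | exact hxj.elim
  rw [hU, lintegral_iUnion hm hd, lintegral_iUnion hm hd]
  refine ENNReal.tsum_le_tsum fun j => ?_
  simp only [s]
  split_ifs with hj
  · obtain ⟨y, hy, rfl⟩ := hj
    exact hgh y hy
  · simp

/-- dyadic average w.r.t. `μ` -/
def Ek {d : ℕ} (α : Fin d → ℝ) (μ : Measure (Fin d → ℝ)) (k : ℤ) (f : (Fin d → ℝ) → ℝ≥0∞)
    (x : Fin d → ℝ) : ℝ≥0∞ :=
  (μ (cell α k x))⁻¹ * ∫⁻ y in cell α k x, f y ∂μ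

/-- dyadic maximal function w.r.t. `μ` -/
def Mx {d : ℕ} (α : Fin d → ℝ) (μ : Measure (Fin d → ℝ)) (f : (Fin d → ℝ) → ℝ≥0∞)
    (x : Fin d → ℝ) : ℝ≥0∞ := ⨆ k : ℤ, Ek α μ k f x

lemma measurable_Ek {d : ℕ} (α : Fin d → ℝ) (μ : Measure (Fin d → ℝ)) (k : ℤ)
    (f : (Fin d → ℝ) → ℝ≥0∞) : Measurable (Ek α μ k f) := by
  have : Ek α μ k f = (fun j : Fin d → ℤ =>
      (μ (cidx α k ⁻¹' {j}))⁻¹ * ∫⁻ y in cidx α k ⁻¹' {j}, f y ∂μ) ∘ cidx α k := rfl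
  rw [this]
  exact (measurable_of_countable _).comp (measurable_cidx α k)

lemma measurable_Mx {d : ℕ} (α : Fin d → ℝ) (μ : Measure (Fin d → ℝ))
    (f : (Fin d → ℝ) → ℝ≥0∞) : Measurable (Mx α μ f) :=
  Measurable.iSup fun k => measurable_Ek α μ k f

lemma Ek_congr {d : ℕ} {α : Fin d → ℝ} {μ : Measure (Fin d → ℝ)} {k : ℤ}
    {f : (Fin d → ℝ) → ℝ≥0∞} {x y : Fin d → ℝ} (h : y ∈ cell α k x) :
    Ek α μ k f y = Ek α μ k f x := by
  unfold Ek; rw [cell_eq h]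

lemma Ek_le_Mx {d : ℕ} (α : Fin d → ℝ) (μ : Measure (Fin d → ℝ)) (k : ℤ)
    (f : (Fin d → ℝ) → ℝ≥0∞) (x) : Ek α μ k f x ≤ Mx α μ f x :=
  le_iSup (fun k => Ek α μ k f x) k

lemma Ek_mul_le {d : ℕ} (α : Fin d → ℝ) (μ : Measure (Fin d → ℝ)) (k : ℤ)
    (f : (Fin d → ℝ) → ℝ≥0∞) (x) :
    Ek α μ k f x * μ (cell α k x) ≤ ∫⁻ y in cell α k x, f y ∂μ := by
  unfold Ek
  rw [mul_comm, ← mul_assoc]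
  calc _ ≤ 1 * ∫⁻ y in cell α k x, f y ∂μ := by gcongr; exact ENNReal.mul_inv_le_one _
    _ = _ := one_mul _

/-- weak type bound -/
lemma weak_type {d : ℕ} {α : Fin d → ℝ} (hα : Adm α) (μ : Measure (Fin d → ℝ))
    (f : (Fin d → ℝ) → ℝ≥0∞) (c : ℝ≥0∞) :
    c * μ {x | c < Mx α μ f x} ≤ ∫⁻ x, f x ∂μ := by
  classical
  have h1 : ∀ N : ℕ, c * μ {x | ∃ j : ℕ, c < Ek α μ (j - N) f x} ≤ ∫⁻ x, f x ∂μ := by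
    intro N
    let S : ℕ → Set (Fin d → ℝ) := fun j =>
      {x | c < Ek α μ (j - N) f x ∧ ∀ i < j, Ek α μ (i - N) f x ≤ c}
    have hU : {x | ∃ j : ℕ, c < Ek α μ (j - N) f x} = ⋃ j, S j := by
      ext x
      simp only [mem_ofPred_eq, mem_iUnion, S]
      constructor
      · intro h
        exact ⟨Nat.find h, Nat.find_spec h, fun i hi => not_lt.1 (Nat.find_min h hi)⟩
      · rintro ⟨j, hj, -⟩; exact ⟨j, hj⟩
    have hm : ∀ j, MeasurableSet (S j) := by
      intro j
      refine MeasurableSet.inter (measurableSet_lt measurable_const (measurable_Ek _ _ _ _)) ?_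
      have : {x | ∀ i < j, Ek α μ (i - N) f x ≤ c} = ⋂ i, ⋂ (_ : i < j), {x | Ek α μ (i - N) f x ≤ c} := by
        ext; simp
      change MeasurableSet {x | ∀ i < j, Ek α μ (i - N) f x ≤ c}
      rw [this]
      exact MeasurableSet.iInter fun i => MeasurableSet.iInter fun _ =>
        measurableSet_le (measurable_Ek _ _ _ _) measurable_const
    have hd : Pairwise (Function.onFun Disjoint S) := by
      have : ∀ i j, i < j → Disjoint (S i) (S j) := by
        intro i j hij
        rw [Set.disjoint_left]
        rintro x ⟨h1, -⟩ ⟨-, h2⟩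
        exact absurd h1 (not_lt.2 (h2 i hij))
      intro i j hij
      rcases lt_or_gt_of_ne hij with h | h
      · exact this i j h
      · exact (this j i h).symm
    have hsat : ∀ j, ∀ x ∈ S j, cell α (j - N) x ⊆ S j := by
      rintro j x ⟨hx1, hx2⟩ y hy
      refine ⟨by rwa [Ek_congr hy], fun i hi => ?_⟩
      rw [Ek_congr (cell_subset hα (by omega) hy)]
      exact hx2 i hi
    rw [hU, measure_iUnion hd hm, ← ENNReal.tsum_mul_left]
    calc ∑' j, c * μ (S j) ≤ ∑' j, ∫⁻ x in S j, f x ∂μ := by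
          refine ENNReal.tsum_le_tsum fun j => ?_
          rw [← setLIntegral_const]
          refine localize (k := j - N) (hsat j) fun x hx => ?_
          rw [setLIntegral_const]
          exact le_trans (by gcongr; exact hx.1.le) (Ek_mul_le α μ (j - N) f x)
      _ = ∫⁻ x in ⋃ j, S j, f x ∂μ := (lintegral_iUnion hm hd _).symm
      _ ≤ _ := setLIntegral_le_lintegral _ _
  have h2 : {x | c < Mx α μ f x} = ⋃ N : ℕ, {x | ∃ j : ℕ, c < Ek α μ (j - N) f x} := by
    ext x
    simp only [mem_ofPred_eq, mem_iUnion, Mx, lt_iSup_iff]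
    constructor
    · rintro ⟨k, hk⟩
      refine ⟨k.natAbs, (k + k.natAbs).toNat, ?_⟩
      have : ((k + k.natAbs).toNat : ℤ) - (k.natAbs : ℤ) = k := by omega
      rwa [this]
    · rintro ⟨N, j, h⟩; exact ⟨_, h⟩
  have hmono : Monotone fun N : ℕ => {x | ∃ j : ℕ, c < Ek α μ (j - N) f x} := by
    rintro N N' h x ⟨j, hj⟩
    refine ⟨j + (N' - N), ?_⟩
    have : ((j + (N' - N) : ℕ) : ℤ) - N' = j - N := by omega
    rwa [this]
  rw [h2, hmono.measure_iUnion, ENNReal.mul_iSup]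
  exact iSup_le h1

end MB

namespace MB

lemma lint_rpow {r : ℝ} (hr : -1 < r) (c : ℝ) (hc : 0 ≤ c) :
    ∫⁻ t in Ioo (0:ℝ) c, ENNReal.ofReal (t ^ r) = ENNReal.ofReal (c ^ (r + 1) / (r + 1)) := by
  rw [restrict_Ioo_eq_restrict_Ioc, ← ofReal_integral_eq_lintegral_ofReal]
  · rw [← intervalIntegral.integral_of_le hc, integral_rpow (Or.inl hr)]
    rw [Real.zero_rpow (by linarith), sub_zero]
  · exact (intervalIntegrable_iff_integrableOn_Ioc_of_le hc).1
      (intervalIntegral.intervalIntegrable_rpow' hr)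
  · filter_upwards [ae_restrict_mem measurableSet_Ioc] with t ht
    exact Real.rpow_nonneg ht.1.le _

lemma lay_eq {r : ℝ} (hr : -1 < r) (c : ℝ) (hc : 0 ≤ c) :
    ∫⁻ t in Ioi (0:ℝ), (if ENNReal.ofReal t < ENNReal.ofReal c then ENNReal.ofReal (t ^ r) else 0)
      = ENNReal.ofReal (c ^ (r + 1) / (r + 1)) := by
  rw [← lint_rpow hr c hc]
  rw [← lintegral_indicator measurableSet_Ioi, ← lintegral_indicator measurableSet_Ioo]
  congr 1
  ext t
  by_cases ht : 0 < t
  · by_cases htc : t < c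
    · simp [ht, htc, ENNReal.ofReal_lt_ofReal_iff (ht.trans htc)]
    · simp [ht, htc, ENNReal.ofReal_le_ofReal (not_lt.1 htc)]
  · simp [ht]

lemma lay1 {p : ℝ} (hp : 0 < p) (a : ℝ≥0∞) :
    a ^ p ≤ ∫⁻ t in Ioi (0:ℝ),
      (if ENNReal.ofReal t < a then ENNReal.ofReal p * ENNReal.ofReal (t ^ (p - 1)) else 0) := by
  have hfin : ∀ c : ℝ, 0 ≤ c → ENNReal.ofReal c ≤ a → ENNReal.ofReal c ^ p ≤ ∫⁻ t in Ioi (0:ℝ),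
      (if ENNReal.ofReal t < a then ENNReal.ofReal p * ENNReal.ofReal (t ^ (p - 1)) else 0) := by
    intro c hc hca
    have h := lay_eq (r := p - 1) (by linarith) c hc
    calc ENNReal.ofReal c ^ p = ENNReal.ofReal p * ENNReal.ofReal (c ^ (p - 1 + 1) / (p - 1 + 1)) := by
          rw [ENNReal.ofReal_rpow_of_nonneg hc hp.le, ← ENNReal.ofReal_mul hp.le]
          congr 1
          rw [sub_add_cancel]; field_simp
      _ = ∫⁻ t in Ioi (0:ℝ), ENNReal.ofReal p *
          (if ENNReal.ofReal t < ENNReal.ofReal c then ENNReal.ofReal (t ^ (p-1)) else 0) := by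
          rw [← h, lintegral_const_mul' _ _ ENNReal.ofReal_ne_top]
      _ ≤ _ := by
          refine lintegral_mono fun t => ?_
          dsimp only
          split_ifs with h1 h2
          · exact le_rfl
          · exact absurd (h1.trans_le hca) h2
          · simp
          · simp
  by_cases ha : a = ⊤
  · subst ha
    rw [ENNReal.top_rpow_of_pos hp]
    apply le_of_eq
    symm
    refine ENNReal.eq_top_of_forall_nnreal_le fun r => ?_
    refine le_trans ?_ (hfin (((r : ℝ)) ^ (1/p)) (by positivity) le_top)
    rw [ENNReal.ofReal_rpow_of_nonneg (by positivity) hp.le, ← Real.rpow_mul (by positivity),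
      one_div, inv_mul_cancel₀ hp.ne', Real.rpow_one]
    simp
  · have := hfin a.toReal ENNReal.toReal_nonneg (by rw [ENNReal.ofReal_toReal ha])
    rwa [ENNReal.ofReal_toReal ha] at this

lemma Ek_mono {d : ℕ} {α : Fin d → ℝ} {μ : Measure (Fin d → ℝ)} {k : ℤ}
    {f g : (Fin d → ℝ) → ℝ≥0∞} (h : ∀ x, f x ≤ g x) (x) : Ek α μ k f x ≤ Ek α μ k g x := by
  unfold Ek; gcongr; exact h _

lemma Mx_mono {d : ℕ} {α : Fin d → ℝ} {μ : Measure (Fin d → ℝ)}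
    {f g : (Fin d → ℝ) → ℝ≥0∞} (h : ∀ x, f x ≤ g x) (x) : Mx α μ f x ≤ Mx α μ g x :=
  iSup_mono fun _ => Ek_mono h x

lemma Ek_add {d : ℕ} {α : Fin d → ℝ} {μ : Measure (Fin d → ℝ)} {k : ℤ}
    {f g : (Fin d → ℝ) → ℝ≥0∞} (hf : Measurable f) (x) :
    Ek α μ k (fun x => f x + g x) x = Ek α μ k f x + Ek α μ k g x := by
  unfold Ek
  rw [lintegral_add_left hf, mul_add]

lemma Ek_const_le {d : ℕ} {α : Fin d → ℝ} {μ : Measure (Fin d → ℝ)} {k : ℤ} (c : ℝ≥0∞) (x) :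
    Ek α μ k (fun _ => c) x ≤ c := by
  unfold Ek
  rw [setLIntegral_const, mul_comm c, ← mul_assoc]
  calc _ ≤ 1 * c := by gcongr; exact ENNReal.inv_mul_le_one _
    _ = c := one_mul c

lemma weak2 {d : ℕ} {α : Fin d → ℝ} (hα : Adm α) (μ : Measure (Fin d → ℝ))
    {f : (Fin d → ℝ) → ℝ≥0∞} (hf : Measurable f) (c : ℝ≥0∞) (hc : c ≠ ⊤) :
    c * μ {x | 2 * c < Mx α μ f x} ≤ ∫⁻ x, (if c < f x then f x else 0) ∂μ := by
  have hg : Measurable fun x => if c < f x then f x else 0 :=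
    Measurable.ite (measurableSet_lt measurable_const hf) hf measurable_const
  refine le_trans ?_ (weak_type hα μ (fun x => if c < f x then f x else 0) c)
  refine mul_le_mul' le_rfl (measure_mono ?_)
  intro x hx
  have h1 : ∀ k, Ek α μ k f x ≤ Ek α μ k (fun x => if c < f x then f x else 0) x + c := by
    intro k
    calc Ek α μ k f x ≤ Ek α μ k (fun x => (if c < f x then f x else 0) + c) x := by
          refine Ek_mono (fun x => ?_) x
          split_ifs with h
          · exact le_self_add
          · simpa using h
      _ ≤ _ := by rw [Ek_add hg]; gcongr; exact Ek_const_le c x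
  have h2 : Mx α μ f x ≤ Mx α μ (fun x => if c < f x then f x else 0) x + c :=
    iSup_le fun k => (h1 k).trans (by gcongr; exact Ek_le_Mx _ _ _ _ _)
  have h3 : 2 * c < Mx α μ (fun x => if c < f x then f x else 0) x + c := lt_of_lt_of_le hx h2
  rw [two_mul] at h3
  exact (ENNReal.add_lt_add_iff_right hc).1 h3

lemma strong_type {p : ℝ} (hp : 1 < p) : ∃ C : NNReal, ∀ (d : ℕ) (α : Fin d → ℝ), Adm α →
    ∀ (μ : Measure (Fin d → ℝ)) [SFinite μ] (f : (Fin d → ℝ) → ℝ≥0∞), Measurable f →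
    ∫⁻ x, (Mx α μ f x) ^ p ∂μ ≤ C * ∫⁻ x, f x ^ p ∂μ := by
  refine ⟨Real.toNNReal (p * 2 * 2 ^ (p - 1) / (p - 1)), ?_⟩
  intro d α hα μ _ f hf
  have hp0 : 0 < p := by linarith
  have hp1 : 0 < p - 1 := by linarith
  have hconst : (0:ℝ) < p * 2 * 2 ^ (p - 1) / (p - 1) := by positivity
  by_cases htop : ∫⁻ x, f x ^ p ∂μ = ⊤
  · rw [htop, ENNReal.mul_top]; · exact le_top
    rw [Ne, ENNReal.coe_eq_zero, Real.toNNReal_eq_zero, not_le]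
    exact hconst
  have hfin : ∀ᵐ x ∂μ, f x < ⊤ := by
    filter_upwards [ae_lt_top (hf.pow_const p) htop] with x hx
    by_contra h
    rw [not_lt, top_le_iff] at h
    rw [h, ENNReal.top_rpow_of_pos hp0] at hx
    exact lt_irrefl _ hx
  have hM := measurable_Mx α μ f
  have hofR : Measurable fun t : ℝ => ENNReal.ofReal t := ENNReal.measurable_ofReal
  have hrp : ∀ r : ℝ, Measurable fun t : ℝ => ENNReal.ofReal (t ^ r) := fun r => by fun_prop
  calc ∫⁻ x, (Mx α μ f x) ^ p ∂μ
      ≤ ∫⁻ x, (∫⁻ t in Ioi (0:ℝ), (if ENNReal.ofReal t < Mx α μ f x then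
          ENNReal.ofReal p * ENNReal.ofReal (t ^ (p - 1)) else 0)) ∂μ :=
        lintegral_mono fun x => lay1 hp0 _
    _ = ∫⁻ t in Ioi (0:ℝ), ∫⁻ x, (if ENNReal.ofReal t < Mx α μ f x then
          ENNReal.ofReal p * ENNReal.ofReal (t ^ (p - 1)) else 0) ∂μ := by
        rw [lintegral_lintegral_swap]
        apply Measurable.aemeasurable
        refine Measurable.ite (measurableSet_lt (hofR.comp measurable_snd) (hM.comp measurable_fst))
          ?_ measurable_const
        exact ((hrp (p-1)).comp measurable_snd).const_mul _
    _ ≤ ∫⁻ t in Ioi (0:ℝ), ∫⁻ x, (if ENNReal.ofReal t < ENNReal.ofReal (2 * (f x).toReal) then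
          (ENNReal.ofReal p * 2 * f x) * ENNReal.ofReal (t ^ (p - 2)) else 0) ∂μ := by
        refine setLIntegral_mono' measurableSet_Ioi fun t ht => ?_
        have ht : 0 < t := ht
        have hw := weak2 hα μ hf (ENNReal.ofReal (t / 2)) ENNReal.ofReal_ne_top
        have h2 : 2 * ENNReal.ofReal (t / 2) = ENNReal.ofReal t := by
          rw [show (2:ℝ≥0∞) = ENNReal.ofReal 2 by simp, ← ENNReal.ofReal_mul (by norm_num)]
          congr 1; ring
        rw [h2] at hw
        have e1 : ∫⁻ x, (if ENNReal.ofReal t < Mx α μ f x then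
            ENNReal.ofReal p * ENNReal.ofReal (t ^ (p - 1)) else 0) ∂μ
            = ENNReal.ofReal p * ENNReal.ofReal (t ^ (p - 1)) * μ {x | ENNReal.ofReal t < Mx α μ f x} := by
          rw [← lintegral_indicator_const (measurableSet_lt measurable_const hM)]
          refine lintegral_congr fun x => ?_
          by_cases h : ENNReal.ofReal t < Mx α μ f x <;> simp [h]
        have e2 : ENNReal.ofReal (t ^ (p - 1)) = 2 * ENNReal.ofReal (t ^ (p - 2)) * ENNReal.ofReal (t / 2) := by
          rw [mul_right_comm, h2, ← ENNReal.ofReal_mul ht.le]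
          congr 1
          rw [mul_comm, ← Real.rpow_add_one ht.ne']
          congr 1; ring
        rw [e1, e2]
        calc _ = (ENNReal.ofReal p * 2 * ENNReal.ofReal (t ^ (p - 2))) *
              (ENNReal.ofReal (t / 2) * μ {x | ENNReal.ofReal t < Mx α μ f x}) := by ring
          _ ≤ (ENNReal.ofReal p * 2 * ENNReal.ofReal (t ^ (p - 2))) *
              ∫⁻ x, (if ENNReal.ofReal (t / 2) < f x then f x else 0) ∂μ := by gcongr
          _ = ∫⁻ x, (ENNReal.ofReal p * 2 * ENNReal.ofReal (t ^ (p - 2))) *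
              (if ENNReal.ofReal (t / 2) < f x then f x else 0) ∂μ := by
              rw [lintegral_const_mul]
              exact Measurable.ite (measurableSet_lt measurable_const hf) hf measurable_const
          _ ≤ _ := by
              refine lintegral_mono_ae ?_
              filter_upwards [hfin] with x hx
              split_ifs with h1 h3
              · apply le_of_eq; ring
              · exfalso; apply h3
                rw [← ENNReal.ofReal_toReal hx.ne, ENNReal.ofReal_lt_ofReal_iff_of_nonneg (by positivity)] at h1
                rw [ENNReal.ofReal_lt_ofReal_iff_of_nonneg ht.le]
                linarith
              · simp
              · simp
    _ = ∫⁻ x, (∫⁻ t in Ioi (0:ℝ), (if ENNReal.ofReal t < ENNReal.ofReal (2 * (f x).toReal) then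
          (ENNReal.ofReal p * 2 * f x) * ENNReal.ofReal (t ^ (p - 2)) else 0)) ∂μ := by
        rw [lintegral_lintegral_swap]
        apply Measurable.aemeasurable
        refine Measurable.ite (measurableSet_lt (hofR.comp measurable_fst) ?_) ?_ measurable_const
        · exact (hofR.comp (hf.ennreal_toReal.const_mul 2)).comp measurable_snd
        · exact ((hf.comp measurable_snd).const_mul _).mul ((hrp (p-2)).comp measurable_fst)
    _ ≤ ∫⁻ x, (Real.toNNReal (p * 2 * 2 ^ (p - 1) / (p - 1)) : ℝ≥0∞) * f x ^ p ∂μ := by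
        refine lintegral_mono_ae ?_
        filter_upwards [hfin] with x hx
        have h := lay_eq (r := p - 2) (by linarith) (2 * (f x).toReal) (by positivity)
        have : ∀ t : ℝ, (if ENNReal.ofReal t < ENNReal.ofReal (2 * (f x).toReal) then
          (ENNReal.ofReal p * 2 * f x) * ENNReal.ofReal (t ^ (p - 2)) else 0) =
          (ENNReal.ofReal p * 2 * f x) * (if ENNReal.ofReal t < ENNReal.ofReal (2 * (f x).toReal) then
            ENNReal.ofReal (t ^ (p - 2)) else 0) := by intro t; split_ifs <;> simp
        simp_rw [this]
        rw [lintegral_const_mul' _ _ (by finiteness), h]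
        set a := (f x).toReal with ha
        have ha0 : 0 ≤ a := ENNReal.toReal_nonneg
        rw [← ENNReal.ofReal_toReal hx.ne, ← ha, ENNReal.ofReal_rpow_of_nonneg ha0 hp0.le]
        change _ ≤ ENNReal.ofReal _ * _
        rw [← ENNReal.ofReal_mul hconst.le, show (2:ℝ≥0∞) = ENNReal.ofReal 2 by simp,
          ← ENNReal.ofReal_mul hp0.le, ← ENNReal.ofReal_mul (by positivity),
          ← ENNReal.ofReal_mul (by positivity)]
        apply ENNReal.ofReal_le_ofReal
        apply le_of_eq
        rw [show p - 2 + 1 = p - 1 by ring, Real.mul_rpow (by norm_num) ha0]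
        have : a ^ p = a * a ^ (p - 1) := by
          rcases ha0.eq_or_lt with h0 | h0
          · rw [← h0, Real.zero_rpow hp0.ne', zero_mul]
          · rw [mul_comm, ← Real.rpow_add_one h0.ne']; congr 1; ring
        rw [this]; ring
    _ = _ := by rw [lintegral_const_mul _ (hf.pow_const p)]

end MB

namespace MB

lemma Ek_vol_mul {d : ℕ} (α : Fin d → ℝ) (k : ℤ) (f : (Fin d → ℝ) → ℝ≥0∞) (x) :
    Ek α volume k f x * volume (cell α k x) = ∫⁻ y in cell α k x, f y := by
  unfold Ek
  rw [mul_comm, ← mul_assoc, ENNReal.mul_inv_cancel (volume_cell_ne_zero _ _ _)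
    (volume_cell_ne_top _ _ _), one_mul]

lemma Ek_vol_pos {d : ℕ} (α : Fin d → ℝ) (k : ℤ) {f : (Fin d → ℝ) → ℝ≥0∞} (hf : Measurable f)
    (hpos : ∀ᵐ x, 0 < f x) (x) : Ek α volume k f x ≠ 0 := by
  intro h
  have := Ek_vol_mul α k f x
  rw [h, zero_mul] at this
  have h2 := (lintegral_eq_zero_iff hf).1 this.symm
  have h3 : ∀ᵐ y ∂(volume.restrict (cell α k x)), False := by
    filter_upwards [h2, ae_restrict_of_ae hpos] with y hy hy'
    exact hy'.ne' hy
  rw [ae_iff] at h3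
  simp at h3
  exact volume_cell_ne_zero _ _ _ h3

/-- Dyadic Muckenhoupt theorem, following Lerner. -/
lemma muck {s : ℝ} (hs : 1 < s) (A : NNReal) : ∃ C : NNReal, ∀ (d : ℕ) (α : Fin d → ℝ), Adm α →
    ∀ v σ : (Fin d → ℝ) → ℝ≥0∞, Measurable v → Measurable σ →
    (∀ᵐ x, 0 < v x ∧ v x < ⊤) → (∀ᵐ x, σ x = v x ^ (-(1 / (s - 1)))) →
    (∀ x k, Ek α volume k v x * (Ek α volume k σ x) ^ (s - 1) ≤ A) →
    ∀ f : (Fin d → ℝ) → ℝ≥0∞, Measurable f →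
    ∫⁻ x, (Mx α volume f x) ^ s * v x ≤ C * ∫⁻ x, f x ^ s * v x := by
  have hs0 : 0 < s := by linarith
  have hs1 : 0 < s - 1 := by linarith
  have hs' : 1 < s / (s - 1) := by rw [lt_div_iff₀ hs1]; linarith
  obtain ⟨C1, hC1⟩ := strong_type hs
  obtain ⟨C2, hC2⟩ := strong_type hs'
  refine ⟨A ^ (s / (s - 1)) * C2 * C1, ?_⟩
  intro d α hα v σ hv hσ hvpos hσv hA f hf
  have hσpos : ∀ᵐ x, 0 < σ x ∧ σ x < ⊤ := by
    filter_upwards [hvpos, hσv] with x hx hx'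
    rw [hx']
    exact ⟨ENNReal.rpow_pos hx.1 hx.2.ne,
      (ENNReal.rpow_ne_top_of_ne_zero hx.1.ne' hx.2.ne).lt_top⟩
  set μσ := (volume : Measure (Fin d → ℝ)).withDensity σ with hμσ
  set μv := (volume : Measure (Fin d → ℝ)).withDensity v with hμv
  set m := Mx α μσ (fun x => f x / σ x) with hm
  have hmm : Measurable m := measurable_Mx _ _ _
  set g : (Fin d → ℝ) → ℝ≥0∞ := fun x => m x ^ (s - 1) / v x with hg
  have hgm : Measurable g := (hmm.pow_const _).div hv
  have hfσ : Measurable fun x => f x / σ x := hf.div hσ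
  have hEv0 : ∀ x k, Ek α volume k v x ≠ 0 := fun x k => Ek_vol_pos α k hv (hvpos.mono fun _ h => h.1) x
  have hEσ0 : ∀ x k, Ek α volume k σ x ≠ 0 := fun x k => Ek_vol_pos α k hσ (hσpos.mono fun _ h => h.1) x
  have hEσt : ∀ x k, Ek α volume k σ x ≠ ⊤ := by
    intro x k h
    have := hA x k
    rw [h, ENNReal.top_rpow_of_pos hs1, ENNReal.mul_top (hEv0 x k)] at this
    exact absurd this (by simp)
  have hEvt : ∀ x k, Ek α volume k v x ≠ ⊤ := by
    intro x k h
    have := hA x k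
    rw [h, ENNReal.top_mul] at this
    · exact absurd this (by simp)
    · exact (ENNReal.rpow_pos (pos_iff_ne_zero.2 (hEσ0 x k)) (hEσt x k)).ne'
  have hμσQ : ∀ x k, μσ (cell α k x) = Ek α volume k σ x * volume (cell α k x) := by
    intro x k
    rw [hμσ, withDensity_apply _ (measurableSet_cell _ _ _), Ek_vol_mul]
  have hμvQ : ∀ x k, μv (cell α k x) = Ek α volume k v x * volume (cell α k x) := by
    intro x k
    rw [hμv, withDensity_apply _ (measurableSet_cell _ _ _), Ek_vol_mul]
  have hpt : ∀ x k, Ek α volume k f x ^ (s - 1) ≤ A * Mx α μv g x := by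
    intro x k
    have h1 : ∀ y ∈ cell α k x, Ek α volume k f x ≤ Ek α volume k σ x * m y := by
      intro y hy
      have e1 : ∫⁻ z in cell α k x, f z = ∫⁻ z in cell α k x, f z / σ z ∂μσ := by
        rw [hμσ, setLIntegral_withDensity_eq_setLIntegral_mul _ hσ hfσ (measurableSet_cell _ _ _)]
        refine setLIntegral_congr_fun_ae (measurableSet_cell _ _ _) ?_
        filter_upwards [hσpos] with z hz _
        simp only [Pi.mul_apply]
        rw [ENNReal.mul_div_cancel hz.1.ne' hz.2.ne]
      have e2 : Ek α volume k f x = Ek α volume k σ x * Ek α μσ k (fun x => f x / σ x) x := by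
        unfold Ek
        rw [← e1, hμσQ, Ek]
        set V := volume (cell α k x)
        have hV0 : V ≠ 0 := volume_cell_ne_zero _ _ _
        have hVt : V ≠ ⊤ := volume_cell_ne_top _ _ _
        have hE0 := hEσ0 x k
        have hEt := hEσt x k
        simp only [Ek] at hE0 hEt
        rw [ENNReal.mul_inv (Or.inl hE0) (Or.inl hEt), ← mul_assoc, ← mul_assoc,
          ENNReal.mul_inv_cancel hE0 hEt, one_mul]
      rw [e2]
      gcongr
      rw [← Ek_congr hy]
      exact Ek_le_Mx _ _ _ _ _
    have h2 : Ek α volume k f x ^ (s - 1) * volume (cell α k x)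
        ≤ Ek α volume k σ x ^ (s - 1) * ∫⁻ y in cell α k x, m y ^ (s - 1) := by
      rw [← setLIntegral_const, ← lintegral_const_mul _ (hmm.pow_const _)]
      refine setLIntegral_mono' (measurableSet_cell _ _ _) fun y hy => ?_
      rw [← ENNReal.mul_rpow_of_nonneg _ _ hs1.le]
      exact ENNReal.rpow_le_rpow (h1 y hy) hs1.le
    have h3 : ∫⁻ y in cell α k x, m y ^ (s - 1) = ∫⁻ y in cell α k x, g y ∂μv := by
      rw [hμv, setLIntegral_withDensity_eq_setLIntegral_mul _ hv hgm (measurableSet_cell _ _ _)]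
      refine setLIntegral_congr_fun_ae (measurableSet_cell _ _ _) ?_
      filter_upwards [hvpos] with z hz _
      simp only [Pi.mul_apply, hg]
      rw [ENNReal.mul_div_cancel hz.1.ne' hz.2.ne]
    have h4 : ∫⁻ y in cell α k x, g y ∂μv = μv (cell α k x) * Ek α μv k g x := by
      unfold Ek
      rw [← mul_assoc, ENNReal.mul_inv_cancel, one_mul]
      · rw [hμvQ]; exact mul_ne_zero (hEv0 x k) (volume_cell_ne_zero _ _ _)
      · rw [hμvQ]; exact ENNReal.mul_ne_top (hEvt x k) (volume_cell_ne_top _ _ _)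
    rw [h3, h4, hμvQ] at h2
    have h5 : Ek α volume k f x ^ (s - 1) * volume (cell α k x)
      ≤ (A * Mx α μv g x) * volume (cell α k x) := by
      refine h2.trans ?_
      calc _ = (Ek α volume k v x * Ek α volume k σ x ^ (s - 1)) * Ek α μv k g x * volume (cell α k x) := by ring
        _ ≤ _ := by
          gcongr
          · exact hA x k
          · exact Ek_le_Mx _ _ _ _ _
    exact (ENNReal.mul_le_mul_iff_left (volume_cell_ne_zero _ _ _) (volume_cell_ne_top _ _ _)).1 h5
  have hpt2 : ∀ x, Mx α volume f x ^ s ≤ A ^ (s / (s - 1)) * Mx α μv g x ^ (s / (s - 1)) := by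
    intro x
    rw [← ENNReal.mul_rpow_of_nonneg _ _ (by positivity)]
    have : Mx α volume f x ≤ (A * Mx α μv g x) ^ (1 / (s - 1)) := by
      refine iSup_le fun k => ?_
      rw [one_div, ENNReal.le_rpow_inv_iff hs1]
      exact hpt x k
    calc _ ≤ ((A * Mx α μv g x) ^ (1 / (s - 1))) ^ s := ENNReal.rpow_le_rpow this hs0.le
      _ = _ := by rw [← ENNReal.rpow_mul]; congr 1; ring
  calc ∫⁻ x, (Mx α volume f x) ^ s * v x
      ≤ ∫⁻ x, A ^ (s / (s - 1)) * (Mx α μv g x ^ (s / (s - 1)) * v x) := by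
        refine lintegral_mono fun x => ?_
        dsimp only
        rw [← mul_assoc]; gcongr; exact hpt2 x
    _ = A ^ (s / (s - 1)) * ∫⁻ x, Mx α μv g x ^ (s / (s - 1)) ∂μv := by
        rw [lintegral_const_mul' _ _ (ENNReal.rpow_ne_top_of_nonneg (by positivity) ENNReal.coe_ne_top)]
        congr 1
        rw [lintegral_withDensity_eq_lintegral_mul _ hv ((measurable_Mx _ _ _).pow_const _)]
        refine lintegral_congr fun x => ?_
        simp only [Pi.mul_apply]; rw [mul_comm]
    _ ≤ A ^ (s / (s - 1)) * (C2 * ∫⁻ x, g x ^ (s / (s - 1)) ∂μv) := by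
        gcongr; exact hC2 d α hα μv g hgm
    _ = A ^ (s / (s - 1)) * (C2 * ∫⁻ x, m x ^ s ∂μσ) := by
        congr 2
        rw [hμv, hμσ, lintegral_withDensity_eq_lintegral_mul _ hv (hgm.pow_const _),
          lintegral_withDensity_eq_lintegral_mul _ hσ (hmm.pow_const _)]
        refine lintegral_congr_ae ?_
        filter_upwards [hvpos, hσv] with x hx hx'
        simp only [Pi.mul_apply, hg, hx']
        rw [ENNReal.div_rpow_of_nonneg _ _ (by positivity), ← ENNReal.rpow_mul,
          mul_div_cancel₀ _ hs1.ne', mul_comm, mul_comm (v x ^ _), ENNReal.mul_comm_div, mul_comm, mul_comm (m x ^ s)]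
        congr 1
        rw [ENNReal.div_eq_inv_mul, ← ENNReal.rpow_neg]
        nth_rw 2 [← ENNReal.rpow_one (v x)]
        rw [← ENNReal.rpow_add _ _ hx.1.ne' hx.2.ne]
        congr 1
        field_simp
        ring
    _ ≤ A ^ (s / (s - 1)) * (C2 * (C1 * ∫⁻ x, (f x / σ x) ^ s ∂μσ)) := by
        gcongr; exact hC1 d α hα μσ _ hfσ
    _ = A ^ (s / (s - 1)) * (C2 * (C1 * ∫⁻ x, f x ^ s * v x)) := by
        congr 3
        rw [hμσ, lintegral_withDensity_eq_lintegral_mul _ hσ (hfσ.pow_const _)]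
        refine lintegral_congr_ae ?_
        filter_upwards [hvpos, hσv, hσpos] with x hx hx' hx2
        simp only [Pi.mul_apply]
        rw [ENNReal.div_rpow_of_nonneg _ _ hs0.le, mul_comm, ENNReal.mul_comm_div]
        congr 1
        rw [ENNReal.div_eq_inv_mul, ← ENNReal.rpow_neg]
        nth_rw 2 [← ENNReal.rpow_one (σ x)]
        rw [← ENNReal.rpow_add _ _ hx2.1.ne' hx2.2.ne, hx', ← ENNReal.rpow_mul]
        nth_rw 2 [← ENNReal.rpow_one (v x)]
        congr 1
        field_simp
        ring
    _ = _ := by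
        push_cast
        rw [ENNReal.coe_rpow_of_nonneg _ (by positivity)]
        ring

end MB

namespace MB

lemma mpw {β : Type*} [MeasurableSpace β] {f w : β → ℝ≥0∞} (hf : Measurable f) (hw : Measurable w)
    (s : ℝ) : Measurable fun x => f x ^ s * w x := (hf.pow_const _).mul hw

lemma trunc_exists {d : ℕ} {f : (Fin d → ℝ) → ℝ≥0∞} {L : ℝ≥0∞} (h : L < ∫⁻ x, f x) :
    ∃ φ : (Fin d → ℝ) → ℝ≥0∞, Measurable φ ∧ (∀ x, φ x ≤ f x) ∧ ∫⁻ x, φ x < ⊤ ∧ L < ∫⁻ x, φ x := by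
  rw [lintegral_eq_nnreal] at h
  obtain ⟨φ, hφ⟩ := lt_iSup_iff.1 h
  obtain ⟨hφf, hφ⟩ := lt_iSup_iff.1 hφ
  have : L < ∫⁻ x, (φ x : ℝ≥0∞) := by
    rw [← SimpleFunc.lintegral_eq_lintegral] at hφ
    simpa using hφ
  obtain ⟨g, hg, h1, h2⟩ := SimpleFunc.exists_lt_lintegral_simpleFunc_of_lt_lintegral this
  refine ⟨fun x => g x, g.measurable.coe_nnreal_ennreal, fun x => ?_, h1, h2⟩
  exact le_trans (ENNReal.coe_le_coe.2 (hg x)) (hφf x)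

/-- dyadic `A_1` weights -/
structure A1 {d : ℕ} (α : Fin d → ℝ) (K : NNReal) (U : (Fin d → ℝ) → ℝ≥0∞) : Prop where
  meas : Measurable U
  pos : ∀ᵐ x, 0 < U x ∧ U x < ⊤
  le : ∀ x k, Ek α volume k U x ≤ K * U x

lemma ae_cell_exists {d : ℕ} (α : Fin d → ℝ) (k : ℤ) (x : Fin d → ℝ) {p : (Fin d → ℝ) → Prop}
    (hp : ∀ᵐ y, p y) : ∃ y ∈ cell α k x, p y := by
  by_contra hcon
  push Not at hcon
  refine volume_cell_ne_zero α k x ?_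
  refine measure_mono_null ?_ (ae_iff.1 hp)
  intro y hy; exact hcon y hy

lemma A1.Ek_ne_zero {d : ℕ} {α : Fin d → ℝ} {K : NNReal} {U} (h : A1 α K U) (k x) :
    Ek α volume k U x ≠ 0 := Ek_vol_pos α k h.meas (h.pos.mono fun _ h => h.1) x

lemma A1.Ek_ne_top {d : ℕ} {α : Fin d → ℝ} {K : NNReal} {U} (h : A1 α K U) (k x) :
    Ek α volume k U x ≠ ⊤ := by
  obtain ⟨y, hy, hy'⟩ := ae_cell_exists α k x h.pos
  rw [← Ek_congr hy]
  exact ((h.le y k).trans_lt (ENNReal.mul_lt_top ENNReal.coe_lt_top hy'.2)).ne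

lemma A1.one {d : ℕ} (α : Fin d → ℝ) : A1 α 1 (fun _ => 1) :=
  ⟨measurable_const, by simp, fun x k => by simpa using Ek_const_le 1 x⟩

lemma A1.K_ne_zero {d : ℕ} {α : Fin d → ℝ} {K : NNReal} {U} (h : A1 α K U) : K ≠ 0 := by
  rintro rfl
  have := h.le 0 0
  simp at this
  exact h.Ek_ne_zero _ _ this

lemma A1.mono {d : ℕ} {α : Fin d → ℝ} {K K' : NNReal} {U} (h : A1 α K U) (hK : K ≤ K') : A1 α K' U :=
  ⟨h.meas, h.pos, fun x k => (h.le x k).trans (by gcongr)⟩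

/-- Hölder for averages -/
lemma Ek_holder {d : ℕ} (α : Fin d → ℝ) (k : ℤ) {f g : (Fin d → ℝ) → ℝ≥0∞} (hf : Measurable f)
    (hg : Measurable g) {p q : ℝ} (hp : 0 ≤ p) (hq : 0 ≤ q) (hpq : p + q = 1) (x) :
    Ek α volume k (fun y => f y ^ p * g y ^ q) x ≤ Ek α volume k f x ^ p * Ek α volume k g x ^ q := by
  unfold Ek
  rw [ENNReal.mul_rpow_of_nonneg _ _ hp, ENNReal.mul_rpow_of_nonneg _ _ hq]
  set V := (volume (cell α k x))⁻¹
  have hV0 : V ≠ 0 := ENNReal.inv_ne_zero.2 (volume_cell_ne_top _ _ _)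
  have hVt : V ≠ ⊤ := ENNReal.inv_ne_top.2 (volume_cell_ne_zero _ _ _)
  calc _ ≤ V * ((∫⁻ y in cell α k x, f y) ^ p * (∫⁻ y in cell α k x, g y) ^ q) := by
        gcongr
        exact ENNReal.lintegral_mul_norm_pow_le hf.aemeasurable hg.aemeasurable hp hq hpq
    _ = (V ^ p * V ^ q) * ((∫⁻ y in cell α k x, f y) ^ p * (∫⁻ y in cell α k x, g y) ^ q) := by
        rw [← ENNReal.rpow_add _ _ hV0 hVt, hpq, ENNReal.rpow_one]
    _ = _ := by ring

lemma Ek_jensen {d : ℕ} (α : Fin d → ℝ) (k : ℤ) {f : (Fin d → ℝ) → ℝ≥0∞} (hf : Measurable f)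
    {p : ℝ} (hp : 0 ≤ p) (hp1 : p ≤ 1) (x) :
    Ek α volume k (fun y => f y ^ p) x ≤ Ek α volume k f x ^ p := by
  have := Ek_holder α k hf (measurable_const (a := (1:ℝ≥0∞))) hp (sub_nonneg.2 hp1) (by ring) x
  simp only [ENNReal.one_rpow, mul_one] at this
  refine this.trans ?_
  calc _ ≤ Ek α volume k f x ^ p * 1 := by
        gcongr
        exact ENNReal.rpow_le_one (Ek_const_le _ _) (sub_nonneg.2 hp1)
    _ = _ := mul_one _

lemma Ek_const_mul {d : ℕ} (α : Fin d → ℝ) (μ : Measure (Fin d → ℝ)) (k : ℤ) {f : (Fin d → ℝ) → ℝ≥0∞}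
    (hf : Measurable f) (c : ℝ≥0∞) (x) :
    Ek α μ k (fun y => c * f y) x = c * Ek α μ k f x := by
  unfold Ek; rw [lintegral_const_mul _ hf]; ring

lemma Ek_le_of_cell {d : ℕ} (α : Fin d → ℝ) (μ : Measure (Fin d → ℝ)) (k : ℤ)
    {f g : (Fin d → ℝ) → ℝ≥0∞} {x} (h : ∀ y ∈ cell α k x, f y ≤ g y) :
    Ek α μ k f x ≤ Ek α μ k g x := by
  unfold Ek
  gcongr 1
  exact setLIntegral_mono' (measurableSet_cell _ _ _) h

lemma rpow_neg_anti {a b : ℝ≥0∞} (h : a ≤ b) {c : ℝ} (hc : 0 ≤ c) : b ^ (-c) ≤ a ^ (-c) := by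
  rw [ENNReal.rpow_neg, ENNReal.rpow_neg]
  exact ENNReal.inv_le_inv.2 (ENNReal.rpow_le_rpow h hc)

lemma A1.neg_le {d : ℕ} {α : Fin d → ℝ} {K : NNReal} {U} (h : A1 α K U) {c : ℝ} (hc : 0 ≤ c)
    (k x) {y} (hy : y ∈ cell α k x) :
    U y ^ (-c) ≤ (K:ℝ≥0∞) ^ c * Ek α volume k U x ^ (-c) := by
  have h1 := h.le y k
  rw [Ek_congr hy] at h1
  have hK : (K:ℝ≥0∞) ≠ 0 := by simpa using h.K_ne_zero
  have h2 : (K:ℝ≥0∞)⁻¹ * Ek α volume k U x ≤ U y := by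
    rw [mul_comm, ← div_eq_mul_inv]
    exact ENNReal.div_le_of_le_mul' h1
  refine (rpow_neg_anti h2 hc).trans (le_of_eq ?_)
  rw [ENNReal.mul_rpow_of_ne_top (by simpa using h.K_ne_zero) (h.Ek_ne_top k x), ENNReal.inv_rpow,
    ENNReal.rpow_neg, inv_inv]

/-- the weight `U2^a U1^(-c)` is in `A_s` for `a ≤ 1`, `c ≤ s - 1` -/
lemma A1.Acond {d : ℕ} {α : Fin d → ℝ} {K : NNReal} {U1 U2} (h1 : A1 α K U1) (h2 : A1 α K U2)
    {s a c : ℝ} (hs : 1 < s) (ha : 0 ≤ a) (ha1 : a ≤ 1) (hc : 0 ≤ c) (hc1 : c ≤ s - 1) (x k) :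
    Ek α volume k (fun y => U2 y ^ a * U1 y ^ (-c)) x *
    (Ek α volume k (fun y => U2 y ^ (-(a / (s - 1))) * U1 y ^ (c / (s - 1))) x) ^ (s - 1)
      ≤ (K ^ (c + a) : NNReal) := by
  have hs1 : 0 < s - 1 := by linarith
  set e1 := Ek α volume k U1 x
  set e2 := Ek α volume k U2 x
  have b1 : Ek α volume k (fun y => U2 y ^ a * U1 y ^ (-c)) x ≤ (K:ℝ≥0∞) ^ c * e1 ^ (-c) * e2 ^ a := by
    calc _ ≤ Ek α volume k (fun y => ((K:ℝ≥0∞) ^ c * e1 ^ (-c)) * U2 y ^ a) x := by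
          refine Ek_le_of_cell _ _ _ fun y hy => ?_
          rw [mul_comm]; gcongr; exact h1.neg_le hc k x hy
      _ = _ := Ek_const_mul _ _ _ (h2.meas.pow_const _) _ _
      _ ≤ _ := by gcongr; exact Ek_jensen _ _ h2.meas ha ha1 _
  have hac : 0 ≤ a / (s - 1) := by positivity
  have b2 : Ek α volume k (fun y => U2 y ^ (-(a / (s - 1))) * U1 y ^ (c / (s - 1))) x
      ≤ (K:ℝ≥0∞) ^ (a / (s - 1)) * e2 ^ (-(a / (s - 1))) * e1 ^ (c / (s - 1)) := by
    calc _ ≤ Ek α volume k (fun y => ((K:ℝ≥0∞) ^ (a / (s - 1)) * e2 ^ (-(a / (s - 1)))) * U1 y ^ (c / (s - 1))) x := by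
          refine Ek_le_of_cell _ _ _ fun y hy => ?_
          gcongr; exact h2.neg_le hac k x hy
      _ = _ := Ek_const_mul _ _ _ (h1.meas.pow_const _) _ _
      _ ≤ _ := by
        gcongr; exact Ek_jensen _ _ h1.meas (by positivity) ((div_le_one hs1).2 hc1) _
  have b3 : (Ek α volume k (fun y => U2 y ^ (-(a / (s - 1))) * U1 y ^ (c / (s - 1))) x) ^ (s - 1)
      ≤ (K:ℝ≥0∞) ^ a * e2 ^ (-a) * e1 ^ c := by
    refine (ENNReal.rpow_le_rpow b2 hs1.le).trans (le_of_eq ?_)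
    rw [ENNReal.mul_rpow_of_nonneg _ _ hs1.le, ENNReal.mul_rpow_of_nonneg _ _ hs1.le,
      ← ENNReal.rpow_mul, ← ENNReal.rpow_mul, ← ENNReal.rpow_mul, div_mul_cancel₀ _ hs1.ne',
      neg_mul, div_mul_cancel₀ _ hs1.ne', div_mul_cancel₀ _ hs1.ne']
  have hK : (K:ℝ≥0∞) ≠ 0 := by simpa using h1.K_ne_zero
  calc _ ≤ ((K:ℝ≥0∞) ^ c * e1 ^ (-c) * e2 ^ a) * ((K:ℝ≥0∞) ^ a * e2 ^ (-a) * e1 ^ c) := mul_le_mul' b1 b3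
    _ = ((K:ℝ≥0∞) ^ c * (K:ℝ≥0∞) ^ a) * (e1 ^ (-c) * e1 ^ c) * (e2 ^ a * e2 ^ (-a)) := by ring
    _ = _ := by
      rw [← ENNReal.rpow_add _ _ hK ENNReal.coe_ne_top,
        ← ENNReal.rpow_add _ _ (h1.Ek_ne_zero k x) (h1.Ek_ne_top k x),
        ← ENNReal.rpow_add _ _ (h2.Ek_ne_zero k x) (h2.Ek_ne_top k x)]
      simp only [neg_add_cancel, add_neg_cancel, ENNReal.rpow_zero, mul_one]
      rw [ENNReal.coe_rpow_of_nonneg _ (by linarith)]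

lemma A1.wpos {d : ℕ} {α : Fin d → ℝ} {K : NNReal} {U1 U2} (h1 : A1 α K U1) (h2 : A1 α K U2)
    (a c : ℝ) : ∀ᵐ x, 0 < U2 x ^ a * U1 x ^ c ∧ U2 x ^ a * U1 x ^ c < ⊤ := by
  filter_upwards [h1.pos, h2.pos] with x h1 h2
  refine ⟨ENNReal.mul_pos (ENNReal.rpow_pos h2.1 h2.2.ne).ne' (ENNReal.rpow_pos h1.1 h1.2.ne).ne',
    ENNReal.mul_lt_top ?_ ?_⟩
  · exact (ENNReal.rpow_ne_top_of_ne_zero h2.1.ne' h2.2.ne).lt_top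
  · exact (ENNReal.rpow_ne_top_of_ne_zero h1.1.ne' h1.2.ne).lt_top

/-- Muckenhoupt bounds for factored weights -/
lemma muckU {s a c : ℝ} (hs : 1 < s) (ha : 0 ≤ a) (ha1 : a ≤ 1) (hc : 0 ≤ c) (hc1 : c ≤ s - 1)
    (K : NNReal) : ∃ C : NNReal, ∀ (d : ℕ) (α : Fin d → ℝ), Adm α →
    ∀ U1 U2 : (Fin d → ℝ) → ℝ≥0∞, A1 α K U1 → A1 α K U2 →
    ∀ f : (Fin d → ℝ) → ℝ≥0∞, Measurable f →
    ∫⁻ x, (Mx α volume f x) ^ s * (U2 x ^ a * U1 x ^ (-c))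
      ≤ C * ∫⁻ x, f x ^ s * (U2 x ^ a * U1 x ^ (-c)) := by
  obtain ⟨C, hC⟩ := muck hs (K ^ (c + a))
  refine ⟨C, fun d α hα U1 U2 h1 h2 f hf => ?_⟩
  refine hC d α hα (fun x => U2 x ^ a * U1 x ^ (-c))
    (fun x => U2 x ^ (-(a / (s - 1))) * U1 x ^ (c / (s - 1)))
    ((h2.meas.pow_const _).mul (h1.meas.pow_const _))
    ((h2.meas.pow_const _).mul (h1.meas.pow_const _)) (h1.wpos h2 _ _) ?_
    (fun x k => h1.Acond h2 hs ha ha1 hc hc1 x k) f hf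
  filter_upwards [h1.pos, h2.pos] with x h1 h2
  rw [ENNReal.mul_rpow_of_ne_top (ENNReal.rpow_ne_top_of_ne_zero h2.1.ne' h2.2.ne)
    (ENNReal.rpow_ne_top_of_ne_zero h1.1.ne' h1.2.ne), ← ENNReal.rpow_mul, ← ENNReal.rpow_mul]
  congr 2
  · ring
  · ring

lemma Ek_tsum {d : ℕ} (α : Fin d → ℝ) (μ : Measure (Fin d → ℝ)) (k : ℤ)
    {f : ℕ → (Fin d → ℝ) → ℝ≥0∞} (hf : ∀ j, Measurable (f j)) (x) :
    Ek α μ k (fun y => ∑' j, f j y) x = ∑' j, Ek α μ k (f j) x := by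
  unfold Ek
  rw [lintegral_tsum fun j => (hf j).aemeasurable, ENNReal.tsum_mul_left]

/-- Rubio de Francia algorithm -/
lemma rdf {s : ℝ} (hs : 1 < s) (A : NNReal) : ∃ K C : NNReal, ∀ (d : ℕ) (α : Fin d → ℝ)
    (w : (Fin d → ℝ) → ℝ≥0∞), Measurable w → (∀ᵐ x, 0 < w x ∧ w x < ⊤) →
    (∀ f : (Fin d → ℝ) → ℝ≥0∞, Measurable f →
      ∫⁻ x, (Mx α volume f x) ^ s * w x ≤ A * ∫⁻ x, f x ^ s * w x) →
    ∀ g : (Fin d → ℝ) → ℝ≥0∞, Measurable g → ∫⁻ x, g x ^ s * w x ≠ ⊤ → ∀ ε : ℝ≥0∞, ε ≠ 0 → ε ≠ ⊤ →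
    ∃ V, A1 α K V ∧ (∀ x, g x ≤ V x) ∧ ∫⁻ x, V x ^ s * w x ≤ C * ((∫⁻ x, g x ^ s * w x) + ε) := by
  have hs0 : 0 < s := by linarith
  set c : NNReal := 2 * max 1 A with hc
  have hc1 : (1:NNReal) ≤ c := by
    rw [hc]; nlinarith [le_max_left 1 A]
  have hcA : 2 * A ≤ c := by rw [hc]; gcongr; exact le_max_right 1 A
  have hc0 : (c:ℝ≥0∞) ≠ 0 := by
    have : c ≠ 0 := (lt_of_lt_of_le one_pos hc1).ne'
    exact_mod_cast this
  have hcs : (2 * A : ℝ≥0∞) ≤ (c:ℝ≥0∞) ^ s := by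
    calc (2 * A : ℝ≥0∞) ≤ c := by exact_mod_cast hcA
      _ = (c:ℝ≥0∞) ^ (1:ℝ) := (ENNReal.rpow_one _).symm
      _ ≤ _ := ENNReal.rpow_le_rpow_of_exponent_le (by exact_mod_cast hc1) hs.le
  refine ⟨2 * c, 2 ^ s * 2 * 2 ^ (s - 1), ?_⟩
  intro d α w hw hwpos hM g hg hgfin ε hε hεt
  obtain ⟨ψ0, hψ0, hψm, hψε⟩ := exists_pos_lintegral_lt_of_sigmaFinite
    (volume : Measure (Fin d → ℝ)) hε
  set ψ : (Fin d → ℝ) → ℝ≥0∞ := fun x => ((ψ0 x : ℝ≥0∞) / w x) ^ (1 / s) with hψ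
  have hψmeas : Measurable ψ := (hψm.coe_nnreal_ennreal.div hw).pow_const _
  set h : ℕ → (Fin d → ℝ) → ℝ≥0∞ := fun j => (Mx α volume)^[j] (fun x => g x + ψ x) with hh
  have hsucc : ∀ j, h (j + 1) = Mx α volume (h j) := fun j => by
    simp only [hh]; rw [Function.iterate_succ_apply']
  have hmeas : ∀ j, Measurable (h j) := by
    intro j
    cases j with
    | zero => exact hg.add hψmeas
    | succ j => rw [hsucc]; exact measurable_Mx _ _ _
  set W := ∫⁻ x, h 0 x ^ s * w x with hW
  have hWle : W ≤ 2 ^ (s - 1) * ((∫⁻ x, g x ^ s * w x) + ε) := by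
    have e1 : ∫⁻ x, ψ x ^ s * w x ≤ ε := by
      refine le_trans (le_of_eq ?_) hψε.le
      refine lintegral_congr_ae ?_
      filter_upwards [hwpos] with x hx
      simp only [hψ]
      rw [← ENNReal.rpow_mul, one_div_mul_cancel hs0.ne', ENNReal.rpow_one,
        ENNReal.div_mul_cancel hx.1.ne' hx.2.ne]
    calc W ≤ ∫⁻ x, 2 ^ (s - 1) * (g x ^ s * w x + ψ x ^ s * w x) := by
          refine lintegral_mono fun x => ?_
          dsimp only
          rw [← add_mul, ← mul_assoc]
          gcongr
          exact ENNReal.rpow_add_le_mul_rpow_add_rpow _ _ hs.le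
      _ = 2 ^ (s - 1) * ((∫⁻ x, g x ^ s * w x) + ∫⁻ x, ψ x ^ s * w x) := by
          rw [lintegral_const_mul' _ _ (ENNReal.rpow_ne_top_of_nonneg (by linarith) (by simp)),
            lintegral_add_left (mpw hg hw s)]
      _ ≤ _ := by gcongr
  have hWfin : W ≠ ⊤ := by
    refine (hWle.trans_lt (ENNReal.mul_lt_top ?_ ?_)).ne
    · exact (ENNReal.rpow_ne_top_of_nonneg (by linarith) (by simp)).lt_top
    · exact ENNReal.add_lt_top.2 ⟨hgfin.lt_top, hεt.lt_top⟩
  have hiter : ∀ j, ∫⁻ x, h j x ^ s * w x ≤ (A:ℝ≥0∞) ^ j * W := by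
    intro j
    induction j with
    | zero => simp [hW]
    | succ j ih =>
      rw [hsucc]
      refine (hM _ (hmeas j)).trans ?_
      rw [pow_succ']; rw [mul_assoc]; gcongr
  -- the summands
  set y : ℕ → (Fin d → ℝ) → ℝ≥0∞ := fun j x => ((c:ℝ≥0∞)⁻¹) ^ j * h j x with hy
  have hymeas : ∀ j, Measurable (y j) := fun j => (hmeas j).const_mul _
  set V : (Fin d → ℝ) → ℝ≥0∞ := fun x => ∑' j, (2⁻¹ : ℝ≥0∞) ^ j * y j x with hV
  have hVm : Measurable V := Measurable.tsum fun j => (hymeas j).const_mul _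
  have hV0 : ∀ x, g x + ψ x ≤ V x := by
    intro x
    have := ENNReal.le_tsum (f := fun j => (2⁻¹ : ℝ≥0∞) ^ j * y j x) 0
    simpa [hy, hh] using this
  have hVs : ∀ x, V x ^ s ≤ 2 ^ s * ∑' j, y j x ^ s := by
    intro x
    have h1 : V x ≤ 2 * ⨆ j, y j x := by
      calc V x ≤ ∑' j, (2⁻¹ : ℝ≥0∞) ^ j * ⨆ j, y j x := by
            refine ENNReal.tsum_le_tsum fun j => ?_
            gcongr; exact le_iSup (fun j => y j x) j
        _ = _ := by
          rw [ENNReal.tsum_mul_right, ENNReal.tsum_geometric, ENNReal.one_sub_inv_two, inv_inv]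
    calc V x ^ s ≤ (2 * ⨆ j, y j x) ^ s := ENNReal.rpow_le_rpow h1 hs0.le
      _ = 2 ^ s * (⨆ j, y j x) ^ s := ENNReal.mul_rpow_of_nonneg _ _ hs0.le
      _ ≤ _ := by
        gcongr
        have h3 : (⨆ j, y j x) ≤ (∑' j, y j x ^ s) ^ (1 / s) := by
          refine iSup_le fun j => ?_
          rw [one_div, ENNReal.le_rpow_inv_iff hs0]
          exact ENNReal.le_tsum (f := fun j => y j x ^ s) j
        calc _ ≤ ((∑' j, y j x ^ s) ^ (1 / s)) ^ s := ENNReal.rpow_le_rpow h3 hs0.le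
          _ = _ := by rw [← ENNReal.rpow_mul, one_div_mul_cancel hs0.ne', ENNReal.rpow_one]
  have hVint : ∫⁻ x, V x ^ s * w x ≤ 2 ^ s * 2 * W := by
    calc ∫⁻ x, V x ^ s * w x ≤ ∫⁻ x, ∑' j, 2 ^ s * (y j x ^ s * w x) := by
          refine lintegral_mono fun x => ?_
          dsimp only
          rw [ENNReal.tsum_mul_left, ENNReal.tsum_mul_right, ← mul_assoc]
          gcongr; exact hVs x
      _ = ∑' j, ∫⁻ x, 2 ^ s * (y j x ^ s * w x) :=
          lintegral_tsum fun j => ((((hymeas j).pow_const _).mul hw).const_mul _).aemeasurable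
      _ ≤ ∑' j : ℕ, 2 ^ s * ((2⁻¹ : ℝ≥0∞) ^ j * W) := by
          refine ENNReal.tsum_le_tsum fun j => ?_
          rw [lintegral_const_mul _ (mpw (hymeas j) hw s)]
          gcongr
          have e : ∀ x, y j x ^ s * w x = (((c:ℝ≥0∞) ^ s)⁻¹) ^ j * (h j x ^ s * w x) := by
            intro x
            simp only [hy]
            rw [ENNReal.mul_rpow_of_nonneg _ _ hs0.le, mul_assoc]
            congr 1
            rw [← ENNReal.inv_rpow, ← ENNReal.rpow_natCast, ← ENNReal.rpow_natCast,
              ← ENNReal.rpow_mul, ← ENNReal.rpow_mul, mul_comm]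
          simp_rw [e]
          rw [lintegral_const_mul _ (mpw (hmeas j) hw s)]
          calc _ ≤ (((c:ℝ≥0∞) ^ s)⁻¹) ^ j * ((A:ℝ≥0∞) ^ j * W) := by gcongr; exact hiter j
            _ = ((((c:ℝ≥0∞) ^ s)⁻¹) * A) ^ j * W := by rw [mul_pow]; ring
            _ ≤ _ := by
              gcongr
              rw [mul_comm, ← div_eq_mul_inv]
              refine ENNReal.div_le_of_le_mul ?_
              calc (A:ℝ≥0∞) = 2⁻¹ * (2 * A) := by
                    rw [← mul_assoc, ENNReal.inv_mul_cancel (by simp) (by simp), one_mul]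
                _ ≤ _ := by gcongr
      _ = _ := by
          rw [ENNReal.tsum_mul_left, ENNReal.tsum_mul_right, ENNReal.tsum_geometric,
            ENNReal.one_sub_inv_two, inv_inv, mul_assoc]
  have hVt : ∀ᵐ x, V x < ⊤ := by
    have hfin : ∫⁻ x, V x ^ s * w x ≠ ⊤ := by
      refine (hVint.trans_lt (ENNReal.mul_lt_top (ENNReal.mul_lt_top ?_ (by simp)) hWfin.lt_top)).ne
      exact (ENNReal.rpow_ne_top_of_nonneg hs0.le (by simp)).lt_top
    filter_upwards [ae_lt_top ((hVm.pow_const _).mul hw) hfin, hwpos] with x hx hx'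
    by_contra hcon
    rw [not_lt_top_iff] at hcon
    simp only [Pi.mul_apply] at hx
    rw [hcon, ENNReal.top_rpow_of_pos hs0, ENNReal.top_mul hx'.1.ne'] at hx
    exact lt_irrefl _ hx
  refine ⟨V, ⟨hVm, ?_, ?_⟩, fun x => le_trans le_self_add (hV0 x), ?_⟩
  · filter_upwards [hVt, hwpos] with x hx hx'
    refine ⟨lt_of_lt_of_le ?_ (le_trans le_add_self (hV0 x)), hx⟩
    simp only [hψ]
    refine ENNReal.rpow_pos (ENNReal.div_pos ?_ hx'.2.ne) (ENNReal.div_ne_top ENNReal.coe_ne_top hx'.1.ne')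
    simpa using (hψ0 x).ne'
  · intro x k
    rw [hV, Ek_tsum _ _ _ fun j => (hymeas j).const_mul _]
    rw [← ENNReal.tsum_mul_left]
    calc _ ≤ ∑' j : ℕ, ((2 * c : NNReal) : ℝ≥0∞) * ((2⁻¹ : ℝ≥0∞) ^ (j + 1) * y (j + 1) x) := by
          refine ENNReal.tsum_le_tsum fun j => ?_
          rw [Ek_const_mul _ _ _ (hymeas j)]
          simp only [hy]
          rw [Ek_const_mul _ _ _ (hmeas j), hsucc, pow_succ, pow_succ]
          push_cast
          calc _ = 2⁻¹ ^ j * (c:ℝ≥0∞)⁻¹ ^ j * Ek α volume k (h j) x := by ring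
            _ ≤ 2⁻¹ ^ j * (c:ℝ≥0∞)⁻¹ ^ j * Mx α volume (h j) x := by gcongr; exact Ek_le_Mx _ _ _ _ _
            _ = (2 * 2⁻¹) * ((c:ℝ≥0∞) * (c:ℝ≥0∞)⁻¹) * (2⁻¹ ^ j * (c:ℝ≥0∞)⁻¹ ^ j * Mx α volume (h j) x) := by
              rw [ENNReal.mul_inv_cancel hc0 ENNReal.coe_ne_top,
                ENNReal.mul_inv_cancel (by simp) (by simp), one_mul, one_mul]
            _ = _ := by ring
      _ ≤ _ := ENNReal.tsum_comp_le_tsum_of_injective (add_left_injective 1) _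
  · refine hVint.trans ?_
    push_cast
    rw [ENNReal.coe_rpow_of_nonneg _ hs0.le, ENNReal.coe_rpow_of_nonneg _ (by linarith)]
    push_cast
    calc _ ≤ 2 ^ s * 2 * (2 ^ (s - 1) * ((∫⁻ x, g x ^ s * w x) + ε)) := by gcongr
      _ = _ := by ring

end MB

namespace MB

/-- weighted boundedness of a family of pairs at exponent `p` -/
def WB {d : ℕ} (α : Fin d → ℝ) (p : ℝ)
    (𝓕 : Set (((Fin d → ℝ) → ℝ≥0∞) × ((Fin d → ℝ) → ℝ≥0∞))) : Prop :=
  ∀ θ : ℝ, 0 < θ → θ < 1 → ∀ K : NNReal, ∃ C : NNReal, ∀ P ∈ 𝓕, ∀ U1 U2, A1 α K U1 → A1 α K U2 →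
    ∫⁻ x, P.1 x ^ p * (U2 x ^ θ * U1 x ^ (-(θ * (p - 1))))
      ≤ C * ∫⁻ x, P.2 x ^ p * (U2 x ^ θ * U1 x ^ (-(θ * (p - 1))))

lemma rpow_aux {a : ℝ≥0∞} (h0 : a ≠ 0) (ht : a ≠ ⊤) {x y z : ℝ} (h : x + y = z) :
    a ^ x * a ^ y = a ^ z := by rw [← ENNReal.rpow_add _ _ h0 ht, h]

lemma rpow_cancel (a : ℝ≥0∞) {t : ℝ} (ht : 0 < t) : (a ^ (1 / t)) ^ t = a := by
  rw [← ENNReal.rpow_mul, one_div_mul_cancel ht.ne', ENNReal.rpow_one]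

lemma extrap {d : ℕ} {α : Fin d → ℝ} (hα : Adm α) {p q : ℝ} (hp : 1 < p) (hq : 1 < q)
    {𝓕 : Set (((Fin d → ℝ) → ℝ≥0∞) × ((Fin d → ℝ) → ℝ≥0∞))}
    (hmeas : ∀ P ∈ 𝓕, Measurable P.1 ∧ Measurable P.2) (H : WB α p 𝓕) : WB α q 𝓕 := by
  intro θ hθ0 hθ1 K
  have hp0 : 0 < p := by linarith
  have hq0 : 0 < q := by linarith
  set q' : ℝ := q / (q - 1) with hq'
  set p' : ℝ := p / (p - 1) with hp'
  have hq1 : 0 < q - 1 := by linarith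
  have hp1 : 0 < p - 1 := by linarith
  have hq'1 : 1 < q' := by rw [hq', lt_div_iff₀ hq1]; linarith
  have hq'0 : 0 < q' := by linarith
  have hp'1 : 1 < p' := by rw [hp', lt_div_iff₀ hp1]; linarith
  have hp'0 : 0 < p' := by linarith
  have hqq : 1 / q + 1 / q' = 1 := by rw [hq']; field_simp; ring
  have hpp : 1 / p + 1 / p' = 1 := by rw [hp']; field_simp; ring
  have hq'm : q' - 1 = 1 / (q - 1) := by rw [hq']; field_simp; ring
  set τ : ℝ := max ((1 + θ * (q - 1)) / q) ((1 + θ * (q' - 1)) / q') with hτ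
  have hτ1 : τ < 1 := by
    rw [hτ, max_lt_iff, div_lt_one hq0, div_lt_one hq'0]
    constructor
    · nlinarith
    · nlinarith
  have hτa : 1 + θ * (q - 1) ≤ q * τ := by
    have := le_max_left ((1 + θ * (q - 1)) / q) ((1 + θ * (q' - 1)) / q')
    rw [← hτ, div_le_iff₀ hq0] at this; linarith
  have hτb : 1 + θ * (q' - 1) ≤ q' * τ := by
    have := le_max_right ((1 + θ * (q - 1)) / q) ((1 + θ * (q' - 1)) / q')
    rw [← hτ, div_le_iff₀ hq'0] at this; linarith
  have hsa : 1 < q * τ := by nlinarith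
  have hsb : 1 < q' * τ := by nlinarith
  have hτ0 : 0 < τ := by nlinarith
  obtain ⟨A1c, hA1⟩ := muckU (s := q * τ) (a := θ) (c := θ * (q - 1)) hsa hθ0.le hθ1.le
    (by positivity) (by linarith) K
  obtain ⟨A2c, hA2⟩ := muckU (s := q' * τ) (a := θ) (c := θ * (q' - 1)) hsb hθ0.le hθ1.le
    (mul_nonneg hθ0.le (by linarith)) (by linarith) K
  obtain ⟨K1, C1, hR1⟩ := rdf hsa A1c
  obtain ⟨K2, C2, hR2⟩ := rdf hsb A2c
  obtain ⟨C3, hC3⟩ := H τ hτ0 hτ1 (max K1 K2)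
  -- the total constant
  set D : NNReal := C3 ^ (1 / p) * (C1 ^ (1 / q) * (C2 * 2) ^ (1 / q')) with hD
  refine ⟨D ^ q + 1, ?_⟩
  rintro ⟨F, G⟩ hP U1 U2 hU1 hU2
  obtain ⟨hF, hG⟩ := hmeas _ hP
  simp only at hF hG ⊢
  set w : (Fin d → ℝ) → ℝ≥0∞ := fun x => U2 x ^ θ * U1 x ^ (-(θ * (q - 1))) with hw
  set w' : (Fin d → ℝ) → ℝ≥0∞ := fun x => U1 x ^ θ * U2 x ^ (-(θ * (q' - 1))) with hw'
  have hwm : Measurable w := mpw hU2.meas (hU1.meas.pow_const _) _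
  have hw'm : Measurable w' := mpw hU1.meas (hU2.meas.pow_const _) _
  have hwpos : ∀ᵐ x, 0 < w x ∧ w x < ⊤ := hU1.wpos hU2 _ _
  have hw'pos : ∀ᵐ x, 0 < w' x ∧ w' x < ⊤ := hU2.wpos hU1 _ _
  have hww' : ∀ᵐ x, w' x = w x ^ (-(q' / q)) := by
    filter_upwards [hU1.pos, hU2.pos] with x h1 h2
    simp only [hw, hw']
    rw [ENNReal.mul_rpow_of_ne_top (ENNReal.rpow_ne_top_of_ne_zero h2.1.ne' h2.2.ne)
      (ENNReal.rpow_ne_top_of_ne_zero h1.1.ne' h1.2.ne), ← ENNReal.rpow_mul, ← ENNReal.rpow_mul,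
      mul_comm]
    congr 2
    · rw [hq'm, hq']; field_simp
    · rw [hq']; field_simp
  set Γ := ∫⁻ x, G x ^ q * w x with hΓ
  refine le_of_forall_lt fun L hL => ?_
  obtain ⟨φ, hφm, hφF, hZt, hLZ⟩ := trunc_exists hL
  refine hLZ.trans_le ?_
  set Z := ∫⁻ x, φ x with hZ
  have hZ0 : Z ≠ 0 := (lt_of_le_of_lt (zero_le) hLZ).ne'
  by_cases hΓt : Γ = ⊤
  · rw [hΓt, ENNReal.mul_top (by simp)]
    exact le_top
  suffices hmain : ∀ ε : ℝ≥0∞, ε ≠ 0 → ε ≠ ⊤ → Z ≤ (D:ℝ≥0∞) ^ q * (Γ + ε) by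
    have hlim : Z ≤ (D:ℝ≥0∞) ^ q * Γ := by
      refine ENNReal.le_of_forall_pos_le_add fun ε hε _ => ?_
      have hDt : (D:ℝ≥0∞) ^ q ≠ ⊤ := ENNReal.rpow_ne_top_of_nonneg hq0.le ENNReal.coe_ne_top
      have h1 := hmain (ε / ((D:ℝ≥0∞) ^ q + 1))
        (ENNReal.div_pos (by simpa using hε.ne') (by simpa using hDt)).ne'
        (ENNReal.div_ne_top ENNReal.coe_ne_top (by simp))
      refine h1.trans ?_
      rw [mul_add]
      gcongr
      calc _ ≤ ((D:ℝ≥0∞) ^ q + 1) * (ε / ((D:ℝ≥0∞) ^ q + 1)) := by gcongr; exact le_self_add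
        _ ≤ ε := ENNReal.mul_div_le
    refine hlim.trans ?_
    gcongr
    push_cast
    rw [ENNReal.coe_rpow_of_nonneg _ hq0.le]
    exact le_self_add
  intro ε hε hεt
  -- first weight
  set g1 : (Fin d → ℝ) → ℝ≥0∞ := fun x => G x ^ (1 / τ) with hg1
  have e1 : ∫⁻ x, g1 x ^ (q * τ) * w x = Γ := by
    refine lintegral_congr fun x => ?_
    simp only [hg1]
    rw [← ENNReal.rpow_mul]; congr 2; field_simp
  obtain ⟨V1, hV1, hgV1, hV1i⟩ := hR1 d α w hwm hwpos (fun f hf => hA1 d α hα U1 U2 hU1 hU2 f hf)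
    g1 (hG.pow_const _) (by rw [e1]; exact hΓt) ε hε hεt
  rw [e1] at hV1i
  -- second weight
  set Ft : (Fin d → ℝ) → ℝ≥0∞ := fun x => (φ x / w x) ^ (1 / q) with hFt
  have hFtm : Measurable Ft := (hφm.div hwm).pow_const _
  set g2 : (Fin d → ℝ) → ℝ≥0∞ := fun x => (Ft x ^ (q - 1) * w x) ^ (1 / τ) with hg2
  have e2 : ∫⁻ x, g2 x ^ (q' * τ) * w' x = Z := by
    refine lintegral_congr_ae ?_
    filter_upwards [hwpos, hww'] with x hx hx'
    simp only [hg2, hFt]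
    rw [hx', ← ENNReal.rpow_mul, ← ENNReal.rpow_mul,
      ENNReal.mul_rpow_of_nonneg _ _ (by positivity), ← ENNReal.rpow_mul, mul_assoc,
      rpow_aux hx.1.ne' hx.2.ne (z := 1) (by rw [hq']; field_simp; ring), ENNReal.rpow_one]
    have : 1 / q * (q - 1) * (1 / τ * (q' * τ)) = 1 := by rw [hq']; field_simp
    rw [this, ENNReal.rpow_one, ENNReal.div_mul_cancel hx.1.ne' hx.2.ne]
  obtain ⟨V2, hV2, hgV2, hV2i⟩ := hR2 d α w' hw'm hw'pos (fun f hf => hA2 d α hα U2 U1 hU2 hU1 f hf)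
    g2 (((hFtm.pow_const _).mul hwm).pow_const _) (by rw [e2]; exact hZt.ne) Z hZ0 hZt.ne
  rw [e2] at hV2i
  set I := ∫⁻ x, V1 x ^ τ * V2 x ^ τ with hI
  have hGV : ∀ x, G x ≤ V1 x ^ τ := by
    intro x
    calc G x = g1 x ^ τ := by
          simp only [hg1]; rw [← ENNReal.rpow_mul, one_div_mul_cancel hτ0.ne', ENNReal.rpow_one]
      _ ≤ _ := ENNReal.rpow_le_rpow (hgV1 x) hτ0.le
  have hFV : ∀ x, Ft x ^ (q - 1) * w x ≤ V2 x ^ τ := by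
    intro x
    calc Ft x ^ (q - 1) * w x = g2 x ^ τ := by
          simp only [hg2]; rw [rpow_cancel _ hτ0]
      _ ≤ _ := ENNReal.rpow_le_rpow (hgV2 x) hτ0.le
  -- step 1
  have s1 : Z ≤ ∫⁻ x, F x * V2 x ^ τ := by
    refine lintegral_mono_ae ?_
    filter_upwards [hwpos] with x hx
    have f1 : Ft x ≤ F x := by
      simp only [hFt]
      rw [one_div, ENNReal.rpow_inv_le_iff hq0]
      exact ENNReal.div_le_of_le_mul (hφF x)
    have f2 : φ x = Ft x * (Ft x ^ (q - 1) * w x) := by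
      have : Ft x * Ft x ^ (q - 1) = Ft x ^ q := by
        conv_lhs => enter [1]; rw [← ENNReal.rpow_one (Ft x)]
        rw [← ENNReal.rpow_add_of_nonneg _ _ zero_le_one hq1.le]
        congr 1; ring
      rw [← mul_assoc, this]
      simp only [hFt]
      rw [← ENNReal.rpow_mul, one_div_mul_cancel hq0.ne', ENNReal.rpow_one,
        ENNReal.div_mul_cancel hx.1.ne' hx.2.ne]
    rw [f2]
    gcongr
    exact hFV x
  -- step 2
  have s2 : ∫⁻ x, F x * V2 x ^ τ ≤
      (∫⁻ x, F x ^ p * (V2 x ^ τ * V1 x ^ (-(τ * (p - 1))))) ^ (1 / p) * I ^ (1 / p') := by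
    refine le_trans (le_of_eq ?_) (ENNReal.lintegral_mul_norm_pow_le
      (f := fun x => F x ^ p * (V2 x ^ τ * V1 x ^ (-(τ * (p - 1)))))
      (g := fun x => V1 x ^ τ * V2 x ^ τ) ?_ ?_ (by positivity) (by positivity) hpp)
    · refine lintegral_congr_ae ?_
      filter_upwards [hV1.pos, hV2.pos] with x h1 h2
      rw [ENNReal.mul_rpow_of_nonneg _ _ (by positivity), ENNReal.mul_rpow_of_nonneg _ _ (by positivity),
        ENNReal.mul_rpow_of_nonneg _ _ (by positivity), ← ENNReal.rpow_mul, ← ENNReal.rpow_mul,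
        ← ENNReal.rpow_mul, ← ENNReal.rpow_mul, ← ENNReal.rpow_mul, mul_one_div_cancel hp0.ne',
        ENNReal.rpow_one]
      calc F x * V2 x ^ τ = F x * (V2 x ^ (τ * (1 / p)) * V2 x ^ (τ * (1 / p'))) *
            (V1 x ^ (-(τ * (p - 1)) * (1 / p)) * V1 x ^ (τ * (1 / p'))) := by
            rw [rpow_aux h2.1.ne' h2.2.ne (z := τ) (by rw [← mul_add, hpp, mul_one]),
              rpow_aux h1.1.ne' h1.2.ne (z := 0) (by rw [hp']; field_simp; ring), ENNReal.rpow_zero, mul_one]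
        _ = _ := by ring
    · exact (mpw hF (mpw hV2.meas (hV1.meas.pow_const _) _) _).aemeasurable
    · exact (mpw hV1.meas (hV2.meas.pow_const _) _).aemeasurable
  -- step 3
  have s3 : ∫⁻ x, F x ^ p * (V2 x ^ τ * V1 x ^ (-(τ * (p - 1)))) ≤ C3 * I := by
    refine (hC3 _ hP V1 V2 (hV1.mono (le_max_left _ _)) (hV2.mono (le_max_right _ _))).trans ?_
    gcongr 1
    refine lintegral_mono_ae ?_
    filter_upwards [hV1.pos] with x h1
    calc _ ≤ (V1 x ^ τ) ^ p * (V2 x ^ τ * V1 x ^ (-(τ * (p - 1)))) := by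
          gcongr; exact hGV x
      _ = V2 x ^ τ * (V1 x ^ (τ * p) * V1 x ^ (-(τ * (p - 1)))) := by
          rw [← ENNReal.rpow_mul]; ring
      _ = _ := by
          rw [rpow_aux h1.1.ne' h1.2.ne (z := τ) (by ring), mul_comm]
  have s4 : Z ≤ (C3:ℝ≥0∞) ^ (1 / p) * I := by
    calc Z ≤ (C3 * I) ^ (1 / p) * I ^ (1 / p') := by
          refine (s1.trans s2).trans ?_
          gcongr
      _ = (C3:ℝ≥0∞) ^ (1 / p) * (I ^ (1 / p) * I ^ (1 / p')) := by
          rw [ENNReal.mul_rpow_of_nonneg _ _ (by positivity), mul_assoc]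
      _ = _ := by
          rw [← ENNReal.rpow_add_of_nonneg _ _ (by positivity) (by positivity), hpp, ENNReal.rpow_one]
  have s5 : I ≤ (∫⁻ x, V1 x ^ (q * τ) * w x) ^ (1 / q) * (∫⁻ x, V2 x ^ (q' * τ) * w' x) ^ (1 / q') := by
    refine le_trans (le_of_eq ?_) (ENNReal.lintegral_mul_norm_pow_le
      (f := fun x => V1 x ^ (q * τ) * w x)
      (g := fun x => V2 x ^ (q' * τ) * w' x) ?_ ?_ (by positivity) (by positivity) hqq)
    · refine lintegral_congr_ae ?_
      filter_upwards [hwpos, hww'] with x hx hx'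
      rw [hx']
      generalize w x = W at hx
      rw [ENNReal.mul_rpow_of_nonneg _ _ (by positivity), ENNReal.mul_rpow_of_nonneg _ _ (by positivity),
        ← ENNReal.rpow_mul, ← ENNReal.rpow_mul, ← ENNReal.rpow_mul]
      have t1 : q * τ * (1 / q) = τ := by field_simp
      have t2 : q' * τ * (1 / q') = τ := by field_simp
      rw [t1, t2]
      calc V1 x ^ τ * V2 x ^ τ = V1 x ^ τ * V2 x ^ τ * (W ^ (1 / q) * W ^ (-(q' / q) * (1 / q'))) := by
            rw [rpow_aux hx.1.ne' hx.2.ne (z := 0) (by field_simp; ring), ENNReal.rpow_zero, mul_one]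
        _ = _ := by ring
    · exact (mpw hV1.meas hwm _).aemeasurable
    · exact (mpw hV2.meas hw'm _).aemeasurable
  have s6 : Z ≤ (D:ℝ≥0∞) * (Γ + ε) ^ (1 / q) * Z ^ (1 / q') := by
    calc Z ≤ (C3:ℝ≥0∞) ^ (1 / p) * ((C1 * (Γ + ε)) ^ (1 / q) * (C2 * (Z + Z)) ^ (1 / q')) := by
          refine s4.trans ?_
          gcongr
          refine s5.trans ?_
          gcongr
      _ = _ := by
          rw [← two_mul, ← mul_assoc (C2:ℝ≥0∞), ENNReal.mul_rpow_of_nonneg _ _ (by positivity : 0 ≤ 1 / q),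
            ENNReal.mul_rpow_of_nonneg _ Z (by positivity : 0 ≤ 1 / q'), hD]
          push_cast
          rw [ENNReal.coe_rpow_of_nonneg _ (by positivity), ENNReal.coe_rpow_of_nonneg _ (by positivity),
            ENNReal.coe_rpow_of_nonneg _ (by positivity)]
          push_cast
          ring
  have s7 : Z ^ (1 / q) ≤ (D:ℝ≥0∞) * (Γ + ε) ^ (1 / q) := by
    have hZ' : Z = Z ^ (1 / q) * Z ^ (1 / q') := by
      rw [rpow_aux hZ0 hZt.ne hqq, ENNReal.rpow_one]
    rw [hZ'] at s6
    have h0 : Z ^ (1 / q') ≠ 0 := (ENNReal.rpow_pos (pos_iff_ne_zero.2 hZ0) hZt.ne).ne'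
    have ht : Z ^ (1 / q') ≠ ⊤ := ENNReal.rpow_ne_top_of_ne_zero hZ0 hZt.ne
    rw [← hZ'] at s6
    conv_lhs at s6 => rw [hZ']
    exact (ENNReal.mul_le_mul_iff_left h0 ht).1 s6
  calc Z = (Z ^ (1 / q)) ^ q := by
        rw [← ENNReal.rpow_mul, one_div_mul_cancel hq0.ne', ENNReal.rpow_one]
    _ ≤ ((D:ℝ≥0∞) * (Γ + ε) ^ (1 / q)) ^ q := ENNReal.rpow_le_rpow s7 hq0.le
    _ = _ := by
      rw [ENNReal.mul_rpow_of_nonneg _ _ hq0.le, ← ENNReal.rpow_mul, one_div_mul_cancel hq0.ne',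
        ENNReal.rpow_one]

end MB

namespace MB

lemma mixedLnorm_cons : ∀ (n : ℕ) (q : Fin (n + 1) → ℝ) (g : (Fin (n + 1) → ℝ) → ℝ≥0∞),
    mixedLnorm (n + 1) q g = mixedLnorm n (fun i => q i.succ)
      (fun y => (∫⁻ t : ℝ, g (Fin.cons t y) ^ q 0) ^ (1 / q 0)) := by
  intro n
  induction n with
  | zero =>
    intro q g
    simp only [mixedLnorm]
    congr 1
    refine lintegral_congr fun t => ?_
    congr 2
    ext i
    fin_cases i
    rfl
  | succ n ih =>
    intro q g
    rw [mixedLnorm, mixedLnorm]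
    simp only [ih]
    congr 1
    refine lintegral_congr fun t => ?_
    congr 1
    congr 1
    ext y
    simp only [Fin.cons_snoc_eq_snoc_cons]
    rfl

lemma measurable_snoc {n : ℕ} {β : Type*} [MeasurableSpace β] {f : β → Fin n → ℝ} {t : β → ℝ}
    (hf : Measurable f) (ht : Measurable t) :
    Measurable fun b => (Fin.snoc (f b) (t b) : Fin (n + 1) → ℝ) := by
  refine measurable_pi_lambda _ fun i => ?_
  refine Fin.lastCases ?_ (fun i => ?_) i
  · simpa using ht
  · simpa using measurable_pi_iff.1 hf i

lemma measurable_cons {n : ℕ} {β : Type*} [MeasurableSpace β] {f : β → Fin n → ℝ} {t : β → ℝ}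
    (hf : Measurable f) (ht : Measurable t) :
    Measurable fun b => (Fin.cons (t b) (f b) : Fin (n + 1) → ℝ) := by
  refine measurable_pi_lambda _ fun i => ?_
  refine Fin.cases ?_ (fun i => ?_) i
  · simpa using ht
  · simpa using measurable_pi_iff.1 hf i

lemma mp_snoc (n : ℕ) : MeasurePreserving
    (fun p : ℝ × (Fin n → ℝ) => (Fin.snoc p.2 p.1 : Fin (n + 1) → ℝ)) volume volume := by
  have := (volume_preserving_piFinSuccAbove (fun _ : Fin (n + 1) => ℝ) (Fin.last n)).symm
  have e : (fun p : ℝ × (Fin n → ℝ) => (Fin.snoc p.2 p.1 : Fin (n + 1) → ℝ))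
      = ⇑(MeasurableEquiv.piFinSuccAbove (fun _ : Fin (n + 1) => ℝ) (Fin.last n)).symm := by
    ext p i
    simp [MeasurableEquiv.piFinSuccAbove, Fin.insertNthEquiv]
  rw [e]
  exact this

lemma mp_cons (n : ℕ) : MeasurePreserving
    (fun p : ℝ × (Fin n → ℝ) => (Fin.cons p.1 p.2 : Fin (n + 1) → ℝ)) volume volume := by
  have := (volume_preserving_piFinSuccAbove (fun _ : Fin (n + 1) => ℝ) 0).symm
  have e : (fun p : ℝ × (Fin n → ℝ) => (Fin.cons p.1 p.2 : Fin (n + 1) → ℝ))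
      = ⇑(MeasurableEquiv.piFinSuccAbove (fun _ : Fin (n + 1) => ℝ) 0).symm := by
    ext p i
    simp [MeasurableEquiv.piFinSuccAbove, Fin.insertNthEquiv]
  rw [e]
  exact this

lemma lint_cons {n : ℕ} {f : (Fin (n + 1) → ℝ) → ℝ≥0∞} (hf : Measurable f) :
    ∫⁻ x, f x = ∫⁻ y : Fin n → ℝ, ∫⁻ t : ℝ, f (Fin.cons t y) := by
  rw [← (mp_cons n).lintegral_comp hf]
  rw [Measure.volume_eq_prod]
  exact lintegral_prod_symm _
    (hf.comp (measurable_cons measurable_snd measurable_fst)).aemeasurable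

lemma measurable_mixedLnorm : ∀ (n : ℕ) (q : Fin n → ℝ) {β : Type} [MeasurableSpace β]
    (g : β → (Fin n → ℝ) → ℝ≥0∞), Measurable (fun p : β × (Fin n → ℝ) => g p.1 p.2) →
    Measurable fun b => mixedLnorm n q (g b) := by
  intro n
  induction n with
  | zero =>
    intro q β _ g hg
    simp only [mixedLnorm]
    exact hg.comp (measurable_id.prodMk measurable_const)
  | succ n ih =>
    intro q β _ g hg
    simp only [mixedLnorm]
    refine Measurable.pow_const ?_ _
    have := ih (fun i => q i.castSucc) (β := β × ℝ) (fun b y => g b.1 (Fin.snoc y b.2)) ?_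
    · exact Measurable.lintegral_prod_right' (f := fun b : β × ℝ => mixedLnorm n (fun i => q i.castSucc)
          (fun y => g b.1 (Fin.snoc y b.2)) ^ q (Fin.last n)) (this.pow_const _)
    · exact hg.comp ((measurable_fst.comp measurable_fst).prodMk
        (measurable_snoc measurable_snd (measurable_snd.comp measurable_fst)))

lemma measurable_mixedLnorm_snoc {n : ℕ} (q : Fin n → ℝ) {g : (Fin (n + 1) → ℝ) → ℝ≥0∞}
    (hg : Measurable g) : Measurable fun t : ℝ => mixedLnorm n q (fun y => g (Fin.snoc y t)) :=
  measurable_mixedLnorm n q (fun t y => g (Fin.snoc y t))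
    (hg.comp (measurable_snoc measurable_snd measurable_fst))

lemma mixedLnorm_mono_ae : ∀ (n : ℕ) (q : Fin n → ℝ), (∀ j, 0 < q j) →
    ∀ {f g : (Fin n → ℝ) → ℝ≥0∞}, (∀ᵐ x, f x ≤ g x) → mixedLnorm n q f ≤ mixedLnorm n q g := by
  intro n
  induction n with
  | zero =>
    intro q _ f g h
    simp only [mixedLnorm]
    have hv : (volume : Measure (Fin 0 → ℝ)) = Measure.dirac (fun i => i.elim0) := by
      rw [volume_pi]; exact Measure.pi_of_empty _ _
    rw [hv, ae_dirac_eq] at h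
    exact h
  | succ n ih =>
    intro q hq f g h
    simp only [mixedLnorm]
    have h1 := (mp_snoc n).quasiMeasurePreserving.ae h
    rw [Measure.volume_eq_prod] at h1
    have h2 := Measure.ae_ae_of_ae_prod h1
    refine ENNReal.rpow_le_rpow ?_ (by have := hq (Fin.last n); positivity)
    refine lintegral_mono_ae ?_
    filter_upwards [h2] with t ht
    refine ENNReal.rpow_le_rpow ?_ (hq _).le
    exact ih _ (fun j => hq _) ht

lemma mixedLnorm_mono {n : ℕ} {q : Fin n → ℝ} (hq : ∀ j, 0 < q j)
    {f g : (Fin n → ℝ) → ℝ≥0∞} (h : ∀ x, f x ≤ g x) : mixedLnorm n q f ≤ mixedLnorm n q g :=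
  mixedLnorm_mono_ae n q hq (Filter.Eventually.of_forall h)

lemma mixedLnorm_const_mul : ∀ (n : ℕ) (q : Fin n → ℝ), (∀ j, 0 < q j) →
    ∀ (c : ℝ≥0∞), c ≠ ⊤ → ∀ (g : (Fin n → ℝ) → ℝ≥0∞),
    mixedLnorm n q (fun x => c * g x) = c * mixedLnorm n q g := by
  intro n
  induction n with
  | zero => intro q _ c _ g; rfl
  | succ n ih =>
    intro q hq c hc g
    simp only [mixedLnorm]
    have hl := hq (Fin.last n)
    simp_rw [ih (fun i => q i.castSucc) (fun j => hq _) c hc, ENNReal.mul_rpow_of_nonneg _ _ hl.le]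
    rw [lintegral_const_mul' _ _ (ENNReal.rpow_ne_top_of_nonneg hl.le hc),
      ENNReal.mul_rpow_of_nonneg _ _ (by positivity), ← ENNReal.rpow_mul, mul_one_div_cancel hl.ne',
      ENNReal.rpow_one]

lemma rpow_add_le' {q : ℝ} (hq : 0 < q) (a b : ℝ≥0∞) : (a + b) ^ q ≤ 2 ^ q * (a ^ q + b ^ q) := by
  have : a + b ≤ 2 * max a b := by
    rw [two_mul]; exact add_le_add (le_max_left _ _) (le_max_right _ _)
  calc (a + b) ^ q ≤ (2 * max a b) ^ q := ENNReal.rpow_le_rpow this hq.le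
    _ = 2 ^ q * (max a b) ^ q := ENNReal.mul_rpow_of_nonneg _ _ hq.le
    _ ≤ _ := by
      gcongr
      rcases max_choice a b with h | h <;> rw [h]
      · exact le_self_add
      · exact le_add_self

lemma mixedLnorm_add : ∀ (n : ℕ) (q : Fin n → ℝ), (∀ j, 0 < q j) → ∃ C : NNReal,
    ∀ (f g : (Fin n → ℝ) → ℝ≥0∞), Measurable f → Measurable g →
    mixedLnorm n q (fun x => f x + g x) ≤ C * (mixedLnorm n q f + mixedLnorm n q g) := by
  intro n
  induction n with
  | zero => intro q _; refine ⟨1, fun f g _ _ => ?_⟩; simp [mixedLnorm]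
  | succ n ih =>
    intro q hq
    obtain ⟨C, hC⟩ := ih (fun i => q i.castSucc) (fun j => hq _)
    set l := q (Fin.last n) with hl
    have hl0 : 0 < l := hq _
    refine ⟨C * 2 * 2 ^ (1 / l), fun f g hf hg => ?_⟩
    simp only [mixedLnorm, ← hl]
    set N := fun (f : (Fin (n + 1) → ℝ) → ℝ≥0∞) (t : ℝ) =>
      mixedLnorm n (fun i => q i.castSucc) (fun y => f (Fin.snoc y t)) with hN
    have hNf : Measurable (N f) := measurable_mixedLnorm_snoc _ hf
    have hNg : Measurable (N g) := measurable_mixedLnorm_snoc _ hg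
    have hsn : ∀ t, Measurable fun y : Fin n → ℝ => (Fin.snoc y t : Fin (n + 1) → ℝ) :=
      fun t => measurable_snoc measurable_id measurable_const
    calc _ ≤ (∫⁻ t, (C:ℝ≥0∞) ^ l * 2 ^ l * (N f t ^ l + N g t ^ l)) ^ (1 / l) := by
          refine ENNReal.rpow_le_rpow ?_ (by positivity)
          refine lintegral_mono fun t => ?_
          refine (ENNReal.rpow_le_rpow (hC _ _ (hf.comp (hsn t)) (hg.comp (hsn t))) hl0.le).trans ?_
          rw [ENNReal.mul_rpow_of_nonneg _ _ hl0.le, mul_assoc]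
          gcongr
          exact rpow_add_le' hl0 _ _
      _ = (C:ℝ≥0∞) * 2 * ((∫⁻ t, N f t ^ l) + ∫⁻ t, N g t ^ l) ^ (1 / l) := by
          rw [lintegral_const_mul' _ _ (ENNReal.mul_ne_top
            (ENNReal.rpow_ne_top_of_nonneg hl0.le ENNReal.coe_ne_top)
            (ENNReal.rpow_ne_top_of_nonneg hl0.le (by simp))),
            lintegral_add_left (hNf.pow_const _), ← ENNReal.mul_rpow_of_nonneg _ _ hl0.le,
            ENNReal.mul_rpow_of_nonneg _ _ (by positivity), ← ENNReal.rpow_mul,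
            mul_one_div_cancel hl0.ne', ENNReal.rpow_one]
      _ ≤ (C:ℝ≥0∞) * 2 * (2 ^ (1 / l) * ((∫⁻ t, N f t ^ l) ^ (1 / l) + (∫⁻ t, N g t ^ l) ^ (1 / l))) := by
          gcongr
          exact rpow_add_le' (by positivity) _ _
      _ = _ := by
          push_cast
          rw [ENNReal.coe_rpow_of_nonneg _ (by positivity)]
          push_cast
          ring

lemma mixedLnorm_zero (n : ℕ) (q : Fin n → ℝ) (hq : ∀ j, 0 < q j) :
    mixedLnorm n q (fun _ => 0) = 0 := by
  simpa using mixedLnorm_const_mul n q hq 0 (by simp) (fun _ => 0)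

lemma mixedLnorm_sum (n : ℕ) (q : Fin n → ℝ) (hq : ∀ j, 0 < q j) {ι : Type} (s : Finset ι) :
    ∃ C : NNReal, ∀ (f : ι → (Fin n → ℝ) → ℝ≥0∞), (∀ i, Measurable (f i)) →
    mixedLnorm n q (fun x => ∑ i ∈ s, f i x) ≤ C * ∑ i ∈ s, mixedLnorm n q (f i) := by
  classical
  obtain ⟨D, hD⟩ := mixedLnorm_add n q hq
  induction s using Finset.induction_on with
  | empty => exact ⟨0, fun f _ => by simp [mixedLnorm_zero n q hq]⟩
  | insert a s ha ih =>
    obtain ⟨C, hC⟩ := ih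
    refine ⟨D * (1 + C), fun f hf => ?_⟩
    simp only [Finset.sum_insert ha]
    refine (hD _ _ (hf a) (Finset.measurable_fun_sum s fun i _ => hf i)).trans ?_
    push_cast
    rw [mul_assoc]
    gcongr
    calc _ ≤ mixedLnorm n q (f a) + C * ∑ i ∈ s, mixedLnorm n q (f i) := by gcongr; exact hC f hf
      _ ≤ (1 + C) * mixedLnorm n q (f a) + (1 + C) * ∑ i ∈ s, mixedLnorm n q (f i) := by
        gcongr
        · conv_lhs => rw [← one_mul (mixedLnorm n q (f a))]
          gcongr; exact le_self_add
        · exact le_add_self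
      _ = _ := by rw [mul_add]

/-- Hölder inequality in mixed Lebesgue spaces -/
lemma mixedLnorm_holder : ∀ (n : ℕ) {ι : Type} (s : Finset ι) (q : Fin n → ℝ) (Q : ι → Fin n → ℝ),
    (∀ j, 0 < q j) → (∀ k j, 0 < Q k j) → (∀ j, 1 / q j = ∑ k ∈ s, 1 / Q k j) →
    ∀ (f : ι → (Fin n → ℝ) → ℝ≥0∞), (∀ i, Measurable (f i)) →
    mixedLnorm n q (fun x => ∏ i ∈ s, f i x) ≤ ∏ i ∈ s, mixedLnorm n (Q i) (f i) := by
  intro n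
  induction n with
  | zero => intro ι s q Q _ _ _ f _; simp [mixedLnorm]
  | succ n ih =>
    intro ι s q Q hq hQ hqQ f hf
    simp only [mixedLnorm]
    set l := q (Fin.last n) with hl
    have hl0 : 0 < l := hq _
    set N := fun (i : ι) (t : ℝ) =>
      mixedLnorm n (fun j => Q i j.castSucc) (fun y => f i (Fin.snoc y t)) with hN
    have hNf : ∀ i, Measurable (N i) := fun i => measurable_mixedLnorm_snoc _ (hf i)
    have hsn : ∀ t, Measurable fun y : Fin n → ℝ => (Fin.snoc y t : Fin (n + 1) → ℝ) :=
      fun t => measurable_snoc measurable_id measurable_const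
    calc _ ≤ (∫⁻ t, ∏ i ∈ s, (N i t ^ (Q i (Fin.last n))) ^ (l / Q i (Fin.last n))) ^ (1 / l) := by
          refine ENNReal.rpow_le_rpow ?_ (by positivity)
          refine lintegral_mono fun t => ?_
          refine (ENNReal.rpow_le_rpow (ih s (fun j => q j.castSucc) (fun i j => Q i j.castSucc)
            (fun j => hq _) (fun k j => hQ _ _) (fun j => hqQ _) (fun i y => f i (Fin.snoc y t))
            (fun i => (hf i).comp (hsn t))) hl0.le).trans (le_of_eq ?_)
          rw [← ENNReal.prod_rpow_of_nonneg hl0.le]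
          refine Finset.prod_congr rfl fun i _ => ?_
          rw [← ENNReal.rpow_mul, mul_div_cancel₀ _ (hQ i _).ne']
      _ ≤ (∏ i ∈ s, (∫⁻ t, N i t ^ (Q i (Fin.last n))) ^ (l / Q i (Fin.last n))) ^ (1 / l) := by
          refine ENNReal.rpow_le_rpow ?_ (by positivity)
          refine ENNReal.lintegral_prod_norm_pow_le s (fun i _ => ((hNf i).pow_const _).aemeasurable) ?_ ?_
          · have := hqQ (Fin.last n)
            calc _ = l * ∑ k ∈ s, 1 / Q k (Fin.last n) := by
                  rw [Finset.mul_sum]; refine Finset.sum_congr rfl fun i _ => ?_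
                  ring
              _ = 1 := by rw [← this, ← hl]; field_simp
          · intro i _; have := hQ i (Fin.last n); positivity
      _ = _ := by
          rw [← ENNReal.prod_rpow_of_nonneg (by positivity)]
          refine Finset.prod_congr rfl fun i _ => ?_
          rw [← ENNReal.rpow_mul]
          congr 1
          have := hQ i (Fin.last n)
          field_simp

end MB

namespace MB

lemma vol_zero_dim : (volume : Measure (Fin 0 → ℝ)) = Measure.dirac (fun i => i.elim0) := by
  rw [volume_pi]; exact Measure.pi_of_empty _ _

lemma ae_tail {n : ℕ} {p : (Fin n → ℝ) → Prop} (h : ∀ᵐ y, p y) :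
    ∀ᵐ x : Fin (n + 1) → ℝ, p (Fin.tail x) := by
  have h1 : ∀ᵐ z : ℝ × (Fin n → ℝ), p z.2 := by
    rw [Measure.volume_eq_prod]
    exact Measure.quasiMeasurePreserving_snd.ae h
  have mp := (volume_preserving_piFinSuccAbove (fun _ : Fin (n + 1) => ℝ) 0)
  have h2 := mp.quasiMeasurePreserving.ae h1
  filter_upwards [h2] with x hx
  have e : ((MeasurableEquiv.piFinSuccAbove (fun _ : Fin (n + 1) => ℝ) 0) x).2 = Fin.tail x := by
    ext i
    simp [MeasurableEquiv.piFinSuccAbove, Fin.insertNthEquiv, Fin.tail, Fin.removeNth]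
  rw [← e]; exact hx

lemma measurable_tail {n : ℕ} : Measurable (Fin.tail : (Fin (n + 1) → ℝ) → (Fin n → ℝ)) :=
  measurable_pi_lambda _ fun _ => measurable_pi_apply _

lemma Ek_tail {n : ℕ} (α : Fin (n + 1) → ℝ) (k : ℤ) {U : (Fin n → ℝ) → ℝ≥0∞} (hU : Measurable U)
    (x : Fin (n + 1) → ℝ) :
    Ek α volume k (fun x => U (Fin.tail x)) x = Ek (Fin.tail α) volume k U (Fin.tail x) := by
  set I : Set ℝ := {t | idx k (α 0) t = idx k (α 0) (x 0)} with hI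
  have hIm : MeasurableSet I := measurable_idx k (α 0) (measurableSet_singleton (idx k (α 0) (x 0)))
  have key : ∀ V : (Fin n → ℝ) → ℝ≥0∞, Measurable V → ∫⁻ y in cell α k x, V (Fin.tail y)
      = volume I * ∫⁻ y in cell (Fin.tail α) k (Fin.tail x), V y := by
    intro V hV
    have hVt : Measurable (fun y : Fin (n + 1) → ℝ => V (Fin.tail y)) := hV.comp measurable_tail
    rw [← lintegral_indicator (measurableSet_cell _ _ _), ← lintegral_indicator (measurableSet_cell _ _ _),
      lint_cons (hVt.indicator (measurableSet_cell _ _ _)),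
      ← lintegral_const_mul _ (hV.indicator (measurableSet_cell _ _ _))]
    refine lintegral_congr fun y => ?_
    have : ∀ t, (cell α k x).indicator (fun y => V (Fin.tail y)) (Fin.cons t y)
        = I.indicator (fun _ => (cell (Fin.tail α) k (Fin.tail x)).indicator V y) t := by
      intro t
      have : (Fin.cons t y : Fin (n + 1) → ℝ) ∈ cell α k x ↔
          t ∈ I ∧ y ∈ cell (Fin.tail α) k (Fin.tail x) := by
        simp only [mem_cell, funext_iff, Fin.forall_fin_succ, cidx, hI, mem_ofPred_eq]
        rfl
      by_cases h1 : t ∈ I <;> by_cases h2 : y ∈ cell (Fin.tail α) k (Fin.tail x) <;>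
        simp [indicator, this, h1, h2]
    simp_rw [this]
    rw [lintegral_indicator hIm, setLIntegral_const, mul_comm]
  have hv : volume (cell α k x) = volume I * volume (cell (Fin.tail α) k (Fin.tail x)) := by
    have := key (fun _ => 1) measurable_const
    simpa using this
  have h0 : volume I ≠ 0 := by
    intro h; rw [h, zero_mul] at hv; exact volume_cell_ne_zero _ _ _ hv
  have ht : volume I ≠ ⊤ := by
    intro h
    rw [h, ENNReal.top_mul (volume_cell_ne_zero _ _ _)] at hv
    exact volume_cell_ne_top _ _ _ hv
  unfold Ek
  rw [key U hU, hv, ENNReal.mul_inv (Or.inl h0) (Or.inl ht)]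
  calc _ = (volume I)⁻¹ * volume I * ((volume (cell (Fin.tail α) k (Fin.tail x)))⁻¹ *
      ∫⁻ y in cell (Fin.tail α) k (Fin.tail x), U y) := by ring
    _ = _ := by rw [ENNReal.inv_mul_cancel h0 ht, one_mul]

lemma A1.tail {n : ℕ} {α : Fin (n + 1) → ℝ} {K : NNReal} {U : (Fin n → ℝ) → ℝ≥0∞}
    (h : A1 (Fin.tail α) K U) : A1 α K (fun x => U (Fin.tail x)) :=
  ⟨h.meas.comp measurable_tail, ae_tail h.pos, fun x k => by
    rw [Ek_tail α k h.meas]; exact h.le _ _⟩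

/-- from weighted estimates to mixed norm estimates -/
lemma chain : ∀ (d : ℕ) (α : Fin d → ℝ), Adm α → ∀ (q : Fin d → ℝ), (∀ j, 1 < q j) →
    ∀ p : ℝ, 1 < p → ∀ 𝓕 : Set (((Fin d → ℝ) → ℝ≥0∞) × ((Fin d → ℝ) → ℝ≥0∞)),
    (∀ P ∈ 𝓕, Measurable P.1 ∧ Measurable P.2) → WB α p 𝓕 →
    ∃ C : NNReal, ∀ P ∈ 𝓕, mixedLnorm d q P.1 ≤ C * mixedLnorm d q P.2 := by
  intro d
  induction d with
  | zero =>
    intro α hα q hq p hp 𝓕 hm H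
    obtain ⟨C, hC⟩ := H (1 / 2) (by norm_num) (by norm_num) 1
    refine ⟨C ^ (1 / p), fun P hP => ?_⟩
    have h := hC P hP _ _ (A1.one α) (A1.one α)
    have hp0 : 0 < p := by linarith
    simp only [ENNReal.one_rpow, mul_one, vol_zero_dim] at h
    rw [lintegral_dirac' _ ((hm P hP).1.pow_const _), lintegral_dirac' _ ((hm P hP).2.pow_const _)] at h
    simp only [mixedLnorm]
    have h2 := ENNReal.rpow_le_rpow h (z := 1 / p) (by positivity)
    rw [ENNReal.mul_rpow_of_nonneg _ _ (by positivity), ← ENNReal.rpow_mul, ← ENNReal.rpow_mul,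
      mul_one_div_cancel hp0.ne', ENNReal.rpow_one, ENNReal.rpow_one] at h2
    rwa [ENNReal.coe_rpow_of_nonneg _ (by positivity)]
  | succ d ih =>
    intro α hα q hq p hp 𝓕 hm H
    have hq0 : 0 < q 0 := by linarith [hq 0]
    have H2 := extrap hα hp (hq 0) hm H
    set R : ((Fin (d + 1) → ℝ) → ℝ≥0∞) → (Fin d → ℝ) → ℝ≥0∞ :=
      fun g y => (∫⁻ t : ℝ, g (Fin.cons t y) ^ q 0) ^ (1 / q 0) with hR
    have hRm : ∀ g, Measurable g → Measurable (R g) := by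
      intro g hg
      refine Measurable.pow_const ?_ _
      exact Measurable.lintegral_prod_right' (f := fun b : (Fin d → ℝ) × ℝ => g (Fin.cons b.2 b.1) ^ q 0)
        ((hg.comp (measurable_cons measurable_fst measurable_snd)).pow_const _)
    obtain ⟨C, hC⟩ := ih (Fin.tail α) (fun i => hα _) (fun i => q i.succ) (fun j => hq _) (q 0) (hq 0)
      ((fun P => (R P.1, R P.2)) '' 𝓕) (by
        rintro _ ⟨P, hP, rfl⟩
        exact ⟨hRm _ (hm P hP).1, hRm _ (hm P hP).2⟩) (by
        intro θ hθ0 hθ1 K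
        obtain ⟨C, hC⟩ := H2 θ hθ0 hθ1 K
        refine ⟨C, ?_⟩
        rintro _ ⟨P, hP, rfl⟩ U1 U2 h1 h2
        have h := hC P hP _ _ h1.tail h2.tail
        have key : ∀ g, Measurable g → ∫⁻ x : Fin (d + 1) → ℝ, g x ^ q 0 *
            (U2 (Fin.tail x) ^ θ * U1 (Fin.tail x) ^ (-(θ * (q 0 - 1))))
            = ∫⁻ y, R g y ^ q 0 * (U2 y ^ θ * U1 y ^ (-(θ * (q 0 - 1)))) := by
          intro g hg
          have t2 : Measurable (fun x : Fin (d + 1) → ℝ => U2 (Fin.tail x)) := h2.meas.comp measurable_tail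
          have t1 : Measurable (fun x : Fin (d + 1) → ℝ => U1 (Fin.tail x)) := h1.meas.comp measurable_tail
          rw [lint_cons (mpw hg (mpw t2 (t1.pow_const _) _) _)]
          refine lintegral_congr fun y => ?_
          simp only [hR]
          rw [rpow_cancel _ hq0]
          simp only [Function.comp_apply, Fin.tail_cons]
          rw [lintegral_mul_const]
          exact (hg.comp (measurable_cons measurable_const measurable_id)).pow_const _
        rw [key _ (hm P hP).1, key _ (hm P hP).2] at h
        exact h)
    refine ⟨C, fun P hP => ?_⟩
    rw [mixedLnorm_cons, mixedLnorm_cons]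
    exact hC _ ⟨P, hP, rfl⟩

/-- the norm of a product indicator -/
lemma mixedLnorm_box : ∀ (n : ℕ) (q : Fin n → ℝ), (∀ j, 0 < q j) → ∀ (x : Fin n → ℝ) (r : ℝ),
    mixedLnorm n q ((Set.pi univ fun i => Ioo (x i - r) (x i + r)).indicator fun _ => 1)
      = ENNReal.ofReal (2 * r) ^ (∑ j, 1 / q j) := by
  intro n
  induction n with
  | zero => intro q _ x r; simp [mixedLnorm]
  | succ n ih =>
    intro q hq x r
    simp only [mixedLnorm]
    have hl := hq (Fin.last n)
    have : ∀ t : ℝ, mixedLnorm n (fun i => q i.castSucc) (fun y =>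
        (Set.pi univ fun i => Ioo (x i - r) (x i + r)).indicator (fun _ => 1)
          (Fin.snoc y t : Fin (n + 1) → ℝ)) ^ q (Fin.last n)
        = (Ioo (x (Fin.last n) - r) (x (Fin.last n) + r)).indicator
          (fun _ => (ENNReal.ofReal (2 * r) ^ (∑ j : Fin n, 1 / q j.castSucc)) ^ q (Fin.last n)) t := by
      intro t
      by_cases ht : t ∈ Ioo (x (Fin.last n) - r) (x (Fin.last n) + r)
      · rw [indicator_of_mem ht, ← ih (fun i => q i.castSucc) (fun j => hq _) (fun i => x i.castSucc) r]
        congr 2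
        ext y
        have : (Fin.snoc y t : Fin (n + 1) → ℝ) ∈ (Set.pi univ fun i => Ioo (x i - r) (x i + r)) ↔
            y ∈ (Set.pi univ fun i : Fin n => Ioo (x i.castSucc - r) (x i.castSucc + r)) := by
          simp only [mem_pi, mem_univ, true_imp_iff, Fin.forall_fin_succ', Fin.snoc_castSucc, Fin.snoc_last]
          tauto
        simp [indicator, this]
      · rw [indicator_of_notMem ht]
        have : (fun y : Fin n → ℝ => (Set.pi univ fun i => Ioo (x i - r) (x i + r)).indicator
            (fun _ => (1:ℝ≥0∞)) (Fin.snoc y t : Fin (n + 1) → ℝ)) = fun _ => 0 := by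
          ext y
          rw [indicator_of_notMem]
          intro h
          apply ht
          simpa using h (Fin.last n) (mem_univ _)
        rw [this, mixedLnorm_zero _ _ (fun j => hq _), ENNReal.zero_rpow_of_pos hl]
    simp_rw [this]
    rw [lintegral_indicator measurableSet_Ioo, setLIntegral_const, Real.volume_Ioo,
      ENNReal.mul_rpow_of_nonneg _ _ (by positivity), ← ENNReal.rpow_mul, mul_one_div_cancel hl.ne',
      ENNReal.rpow_one, Fin.sum_univ_castSucc,
      ENNReal.rpow_add_of_nonneg _ _ (Finset.sum_nonneg fun j _ => by
        have := hq j.castSucc; positivity) (by positivity)]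
    congr 3
    ring

end MB

namespace MB

/-- average over a dyadic cell -/
def Bv {d : ℕ} (α : Fin d → ℝ) (b : (Fin d → ℝ) → ℝ) (k : ℤ) (x : Fin d → ℝ) : ℝ :=
  ⨍ y in cell α k x, b y

lemma Bv_congr {d : ℕ} {α : Fin d → ℝ} {b : (Fin d → ℝ) → ℝ} {k : ℤ}
    {x y : Fin d → ℝ} (h : y ∈ cell α k x) : Bv α b k y = Bv α b k x := by
  unfold Bv; rw [cell_eq h]

/-- center of a cell -/
def ctr {d : ℕ} (α : Fin d → ℝ) (k : ℤ) (x : Fin d → ℝ) : Fin d → ℝ :=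
  fun i => corner α k x i + 2 ^ (-k) / 2

lemma cell_sub_ball {d : ℕ} (α : Fin d → ℝ) (k : ℤ) (x : Fin d → ℝ) :
    cell α k x ⊆ Metric.closedBall (ctr α k x) (2 ^ (-k) / 2) := by
  intro y hy
  rw [cell_eq_pi] at hy
  have h2 : (0:ℝ) < 2 ^ (-k) := by positivity
  rw [Metric.mem_closedBall, dist_pi_le_iff (by positivity)]
  intro i
  have := hy i (mem_univ _)
  simp only [mem_Ico] at this
  rw [Real.dist_eq, abs_le]
  simp only [ctr]
  constructor <;> linarith [this.1, this.2]

lemma cell_ae_ball {d : ℕ} (α : Fin d → ℝ) (k : ℤ) (x : Fin d → ℝ) :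
    cell α k x =ᵐ[volume] Metric.closedBall (ctr α k x) (2 ^ (-k) / 2) := by
  refine ae_eq_of_subset_of_measure_ge (cell_sub_ball α k x) ?_ (measurableSet_cell _ _ _).nullMeasurableSet ?_
  · rw [volume_cell, Real.volume_pi_closedBall _ (by positivity), ← ENNReal.ofReal_pow (by positivity)]
    simp [mul_div_cancel₀]
  · exact (isCompact_closedBall _ _).measure_lt_top.ne

lemma intOn_cell {d : ℕ} {α : Fin d → ℝ} {b : (Fin d → ℝ) → ℝ} (hb : LocallyIntegrable b) (k x) :
    IntegrableOn b (cell α k x) :=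
  (hb.integrableOn_isCompact (isCompact_closedBall _ _)).mono_set (cell_sub_ball α k x)

lemma measurable_Bv {d : ℕ} (α : Fin d → ℝ) (b : (Fin d → ℝ) → ℝ) (k : ℤ) : Measurable (Bv α b k) := by
  have : Bv α b k = (fun j : Fin d → ℤ => ⨍ y in cidx α k ⁻¹' {j}, b y) ∘ cidx α k := rfl
  rw [this]
  exact (measurable_of_countable _).comp (measurable_cidx α k)

/-- Lebesgue differentiation along cells -/
lemma Bv_tendsto {d : ℕ} (α : Fin d → ℝ) {b : (Fin d → ℝ) → ℝ} (hb : LocallyIntegrable b) :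
    ∀ᵐ x, Filter.Tendsto (fun N : ℕ => Bv α b N x) Filter.atTop (nhds (b x)) := by
  have h := IsUnifLocDoublingMeasure.ae_tendsto_average (μ := (volume : Measure (Fin d → ℝ))) hb 1
  filter_upwards [h] with x hx
  have := hx (l := Filter.atTop) (fun N : ℕ => ctr α N x) (fun N : ℕ => (2:ℝ) ^ (-(N:ℤ)) / 2) ?_ ?_
  · refine this.congr fun N => ?_
    unfold Bv
    exact (setAverage_congr (cell_ae_ball α N x)).symm
  · rw [tendsto_nhdsWithin_iff]
    constructor
    · have : Filter.Tendsto (fun N : ℕ => ((1/2:ℝ)) ^ N / 2) Filter.atTop (nhds (0 / 2)) :=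
        (_root_.tendsto_pow_atTop_nhds_zero_of_lt_one (by norm_num) (by norm_num)).div_const _
      simpa using this
    · exact Filter.Eventually.of_forall fun N => by
        simp only [mem_Ioi]; positivity
  · exact Filter.Eventually.of_forall fun N => by
      rw [one_mul]; exact cell_sub_ball α N x self_mem_cell

lemma Bv_sub_le {d : ℕ} {α : Fin d → ℝ} {b : (Fin d → ℝ) → ℝ} (hb : LocallyIntegrable b) (k x) (c : ℝ) :
    ENNReal.ofReal |Bv α b k x - c| * volume (cell α k x) ≤
      ∫⁻ y in cell α k x, ENNReal.ofReal |b y - c| := by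
  have hi := intOn_cell (α := α) hb k x
  have h0 := volume_cell_ne_zero α k x
  have ht := volume_cell_ne_top α k x
  have hr : 0 < (volume (cell α k x)).toReal := ENNReal.toReal_pos h0 ht
  have hc : IntegrableOn (fun _ => c) (cell α k x) := integrableOn_const ht
  have hic : IntegrableOn (fun y => b y - c) (cell α k x) := hi.sub hc
  have e1 : ∫ y in cell α k x, (b y - c) = (volume (cell α k x)).toReal * (Bv α b k x - c) := by
    rw [integral_sub hi hc, setIntegral_const]
    unfold Bv
    rw [setAverage_eq, smul_eq_mul, smul_eq_mul, Measure.real]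
    field_simp
  have e2 : ENNReal.ofReal (∫ y in cell α k x, |b y - c|) = ∫⁻ y in cell α k x, ENNReal.ofReal |b y - c| :=
    ofReal_integral_eq_lintegral_ofReal hic.abs (Filter.Eventually.of_forall fun y => abs_nonneg _)
  rw [← e2]
  conv_lhs => rw [← ENNReal.ofReal_toReal ht]
  rw [← ENNReal.ofReal_mul (abs_nonneg _)]
  apply ENNReal.ofReal_le_ofReal
  calc |Bv α b k x - c| * (volume (cell α k x)).toReal
      = |∫ y in cell α k x, (b y - c)| := by rw [e1, abs_mul, abs_of_pos hr, mul_comm]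
    _ ≤ _ := abs_integral_le_integral_abs

/-- dyadic BMO -/
structure BMOd {d : ℕ} (α : Fin d → ℝ) (K : ℝ) (b : (Fin d → ℝ) → ℝ) : Prop where
  meas : Measurable b
  loc : LocallyIntegrable b
  pos : 0 < K
  le : ∀ x k, ∫⁻ y in cell α k x, ENNReal.ofReal |b y - Bv α b k x| ≤ ENNReal.ofReal K * volume (cell α k x)

lemma ofReal_mul_cancel {a c : ℝ} {V : ℝ≥0∞} (hc : 0 ≤ c) (h0 : V ≠ 0) (ht : V ≠ ⊤)
    (h : ENNReal.ofReal a * V ≤ ENNReal.ofReal c * V) : a ≤ c := by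
  have := (ENNReal.mul_le_mul_iff_left h0 ht).1 h
  exact (ENNReal.ofReal_le_ofReal_iff hc).1 this

lemma vol_cell_succ {d : ℕ} (α : Fin d → ℝ) (k : ℤ) (x : Fin d → ℝ) :
    volume (cell α k x) = ENNReal.ofReal (2 ^ d) * volume (cell α (k + 1) x) := by
  rw [volume_cell, volume_cell, ← ENNReal.ofReal_pow (by positivity), ← ENNReal.ofReal_pow (by positivity),
    ← ENNReal.ofReal_mul (by positivity), ← mul_pow]
  congr 2
  rw [neg_add, zpow_add₀ (by norm_num)]
  norm_num
  ring

lemma BMOd.step {d : ℕ} {α : Fin d → ℝ} (hα : Adm α) {K : ℝ} {b : (Fin d → ℝ) → ℝ} (h : BMOd α K b)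
    (k x) : |Bv α b (k + 1) x - Bv α b k x| ≤ 2 ^ d * K := by
  have hK := h.pos
  refine ofReal_mul_cancel (by positivity) (volume_cell_ne_zero α (k+1) x) (volume_cell_ne_top α (k+1) x) ?_
  refine (Bv_sub_le h.loc _ _ _).trans ?_
  calc _ ≤ ∫⁻ y in cell α k x, ENNReal.ofReal |b y - Bv α b k x| :=
        lintegral_mono_set (cell_subset hα (by omega))
    _ ≤ _ := h.le x k
    _ = _ := by
      rw [vol_cell_succ, ← mul_assoc, ← ENNReal.ofReal_mul hK.le, mul_comm K]

end MB

namespace MB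

lemma JN_trunc {d : ℕ} {α : Fin d → ℝ} (hα : Adm α) {K s : ℝ} {b : (Fin d → ℝ) → ℝ} (h : BMOd α K b)
    (hs : 0 < s) (hsK : Real.exp (s * (2 ^ d * K + 4 * K)) ≤ 2) (N : ℤ) :
    ∀ (j : ℕ) (x : Fin d → ℝ), ∫⁻ y in cell α (N - j) x,
      ENNReal.ofReal (Real.exp (s * |Bv α b N y - Bv α b (N - j) x|)) ≤ 4 * volume (cell α (N - j) x) := by
  intro j
  have hK := h.pos
  induction j using Nat.strong_induction_on with
  | _ j ih =>
  intro x
  set k : ℤ := N - j with hk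
  set Q := cell α k x with hQ
  set β := Bv α b k x with hβ
  set g : (Fin d → ℝ) → ℝ≥0∞ := fun y => ENNReal.ofReal (Real.exp (s * |Bv α b N y - β|)) with hg
  set D : ℕ → (Fin d → ℝ) → ℝ := fun i y => |Bv α b (k + 1 + i) y - β| with hD
  have hDm : ∀ i, Measurable (D i) := fun i =>
    (((measurable_Bv α b _).sub_const _)).abs
  set S : ℕ → Set (Fin d → ℝ) := fun i =>
    {y | y ∈ Q ∧ i < j ∧ 4 * K < D i y ∧ ∀ i' < i, D i' y ≤ 4 * K} with hS
  have hSm : ∀ i, MeasurableSet (S i) := by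
    intro i
    have : S i = Q ∩ ({y | i < j} ∩ ({y | 4 * K < D i y} ∩ ⋂ i' : ℕ, ⋂ _ : i' < i, {y | D i' y ≤ 4 * K})) := by
      ext y; simp [hS]; tauto
    rw [this]
    refine (measurableSet_cell _ _ _).inter ((MeasurableSet.const _).inter
      ((measurableSet_lt measurable_const (hDm i)).inter ?_))
    exact MeasurableSet.iInter fun i' => MeasurableSet.iInter fun _ =>
      measurableSet_le (hDm i') measurable_const
  have hScell : ∀ i, ∀ y ∈ S i, cell α (k + 1 + i) y ⊆ S i := by
    intro i y hy z hz
    obtain ⟨h1, h2, h3, h4⟩ := hy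
    have hcong : ∀ i' ≤ i, D i' z = D i' y := by
      intro i' hi'
      simp only [hD]
      rw [Bv_congr (cell_subset hα (by omega) hz)]
    refine ⟨?_, h2, by rwa [hcong i le_rfl], fun i' hi' => by rw [hcong i' hi'.le]; exact h4 i' hi'⟩
    have : z ∈ cell α k y := cell_subset hα (by omega) hz
    rwa [cell_eq h1] at this
  have hdisj : Pairwise (Function.onFun Disjoint S) := by
    have key : ∀ a c, a < c → Disjoint (S a) (S c) := by
      intro a c hac
      rw [Set.disjoint_left]
      intro y h1 h2
      exact absurd (h2.2.2.2 a hac) (not_le.2 h1.2.2.1)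
    intro a c hac
    rcases lt_or_gt_of_ne hac with h | h
    · exact key _ _ h
    · exact (key _ _ h).symm
  -- measure of the stopping sets
  have hmeas : ∑' i, volume (S i) * ENNReal.ofReal (4 * K) ≤ ENNReal.ofReal K * volume Q := by
    calc ∑' i, volume (S i) * ENNReal.ofReal (4 * K)
        ≤ ∑' i, ∫⁻ y in S i, ENNReal.ofReal |b y - β| := by
          refine ENNReal.tsum_le_tsum fun i => ?_
          rw [mul_comm, ← setLIntegral_const]
          refine localize (k := k + 1 + i) (hScell i) fun y hy => ?_
          rw [setLIntegral_const]
          refine le_trans ?_ (Bv_sub_le h.loc _ _ _)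
          gcongr
          exact hy.2.2.1.le
      _ = ∫⁻ y in ⋃ i, S i, ENNReal.ofReal |b y - β| := (lintegral_iUnion hSm hdisj _).symm
      _ ≤ ∫⁻ y in Q, ENNReal.ofReal |b y - β| :=
          lintegral_mono_set (iUnion_subset fun i y hy => hy.1)
      _ ≤ _ := h.le x k
  have hmeas2 : ∑' i, volume (S i) * 4 ≤ volume Q := by
    rw [ENNReal.tsum_mul_right] at hmeas ⊢
    have hK0 : ENNReal.ofReal K ≠ 0 := by simpa using hK
    rw [mul_comm 4 K, ENNReal.ofReal_mul hK.le, ← mul_assoc, mul_comm _ (ENNReal.ofReal K), mul_assoc,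
      ENNReal.mul_le_mul_iff_right hK0 ENNReal.ofReal_ne_top] at hmeas
    simpa using hmeas
  have hSbound : ∀ i, ∫⁻ y in S i, g y ≤ 2 * (volume (S i) * 4) := by
    intro i
    have : 2 * (volume (S i) * 4) = ∫⁻ y in S i, 8 := by
      rw [setLIntegral_const]; rw [mul_comm (volume _), ← mul_assoc]; norm_num
    rw [this]
    refine localize (k := k + 1 + i) (hScell i) fun y hy => ?_
    rw [setLIntegral_const]
    have hij := hy.2.1
    have e : k + 1 + i = N - ((j - 1 - i : ℕ) : ℤ) := by omega
    have ih' := ih (j - 1 - i) (by omega) y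
    rw [← e] at ih'
    have hjump : |Bv α b (k + 1 + i) y - β| ≤ 2 ^ d * K + 4 * K := by
      have h1 := h.step hα (k + i) y
      have h2 : |Bv α b (k + i) y - β| ≤ 4 * K := by
        cases i with
        | zero =>
          have : Bv α b (k + (0:ℕ)) y = β := by
            simp only [Nat.cast_zero, add_zero]; exact Bv_congr hy.1
          rw [this]; simp; positivity
        | succ i =>
          have := hy.2.2.2 i (by omega)
          simp only [hD] at this
          rwa [show k + ((i + 1 : ℕ) : ℤ) = k + 1 + i by push_cast; ring]
      rw [show k + (i : ℤ) + 1 = k + 1 + i by ring] at h1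
      calc _ = |(Bv α b (k + 1 + i) y - Bv α b (k + i) y) + (Bv α b (k + i) y - β)| := by congr 1; ring
        _ ≤ _ := (abs_add_le _ _).trans (add_le_add h1 h2)
    calc ∫⁻ z in cell α (k + 1 + i) y, g z
        ≤ ∫⁻ z in cell α (k + 1 + i) y, 2 *
          ENNReal.ofReal (Real.exp (s * |Bv α b N z - Bv α b (k + 1 + i) y|)) := by
          refine lintegral_mono fun z => ?_
          simp only [hg]
          rw [show (2:ℝ≥0∞) = ENNReal.ofReal 2 by norm_num, ← ENNReal.ofReal_mul (by norm_num)]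
          apply ENNReal.ofReal_le_ofReal
          refine le_trans ?_ (mul_le_mul_of_nonneg_right hsK (Real.exp_nonneg _))
          rw [← Real.exp_add, Real.exp_le_exp, ← mul_add]
          refine mul_le_mul_of_nonneg_left ?_ hs.le
          calc _ = |(Bv α b N z - Bv α b (k + 1 + i) y) + (Bv α b (k + 1 + i) y - β)| := by congr 1; ring
            _ ≤ _ := (abs_add_le _ _).trans (by linarith)
      _ = 2 * ∫⁻ z in cell α (k + 1 + i) y,
          ENNReal.ofReal (Real.exp (s * |Bv α b N z - Bv α b (k + 1 + i) y|)) :=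
          lintegral_const_mul' _ _ (by norm_num)
      _ ≤ 2 * (4 * volume (cell α (k + 1 + i) y)) := by gcongr
      _ = _ := by rw [← mul_assoc]; norm_num
  have hrest : ∫⁻ y in Q \ ⋃ i, S i, g y ≤ 2 * volume Q := by
    calc ∫⁻ y in Q \ ⋃ i, S i, g y ≤ ∫⁻ y in Q \ ⋃ i, S i, 2 := by
          refine setLIntegral_mono' ((measurableSet_cell _ _ _).diff (MeasurableSet.iUnion hSm)) ?_
          rintro y ⟨hyQ, hyn⟩
          have hall : ∀ i < j, D i y ≤ 4 * K := by
            by_contra hcon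
            push Not at hcon
            classical
            have hf := Nat.find_spec hcon
            refine hyn (mem_iUnion.2 ⟨Nat.find hcon, hyQ, hf.1, hf.2, fun i' hi' => ?_⟩)
            have := Nat.find_min hcon hi'
            push Not at this
            exact this (by omega)
          have hle : |Bv α b N y - β| ≤ 4 * K := by
            rcases Nat.eq_zero_or_pos j with h0 | h0
            · have : Bv α b N y = β := by
                have : N = k := by omega
                rw [this]; exact Bv_congr hyQ
              rw [this]; simp; positivity
            · have := hall (j - 1) (by omega)
              simp only [hD] at this
              rwa [show k + 1 + ((j - 1 : ℕ) : ℤ) = N by omega] at this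
          simp only [hg]
          rw [show (2:ℝ≥0∞) = ENNReal.ofReal 2 by norm_num]
          apply ENNReal.ofReal_le_ofReal
          refine le_trans (Real.exp_le_exp.2 ?_) hsK
          refine mul_le_mul_of_nonneg_left (hle.trans ?_) hs.le
          have : (0:ℝ) ≤ 2 ^ d * K := by positivity
          linarith
      _ = 2 * volume (Q \ ⋃ i, S i) := setLIntegral_const _ _
      _ ≤ _ := by gcongr; exact sdiff_subset
  calc ∫⁻ y in Q, g y ≤ ∫⁻ y in (Q \ ⋃ i, S i) ∪ ⋃ i, S i, g y :=
        lintegral_mono_set (by intro y hy; by_cases h : y ∈ ⋃ i, S i <;> simp_all)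
    _ ≤ (∫⁻ y in Q \ ⋃ i, S i, g y) + ∫⁻ y in ⋃ i, S i, g y := lintegral_union_le _ _ _
    _ ≤ 2 * volume Q + ∑' i, ∫⁻ y in S i, g y := add_le_add hrest (lintegral_iUnion_le _ _)
    _ ≤ 2 * volume Q + ∑' i, 2 * (volume (S i) * 4) := by gcongr; exact hSbound _
    _ ≤ 2 * volume Q + 2 * volume Q := by rw [ENNReal.tsum_mul_left]; gcongr
    _ = 4 * volume Q := by rw [← add_mul]; norm_num

lemma JN {d : ℕ} {α : Fin d → ℝ} (hα : Adm α) {K s : ℝ} {b : (Fin d → ℝ) → ℝ} (h : BMOd α K b)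
    (hs : 0 < s) (hsK : Real.exp (s * (2 ^ d * K + 4 * K)) ≤ 2) (k : ℤ) (x : Fin d → ℝ) :
    Ek α volume k (fun y => ENNReal.ofReal (Real.exp (s * |b y - Bv α b k x|))) x ≤ 4 := by
  have h1 : ∫⁻ y in cell α k x, ENNReal.ofReal (Real.exp (s * |b y - Bv α b k x|))
      ≤ 4 * volume (cell α k x) := by
    calc ∫⁻ y in cell α k x, ENNReal.ofReal (Real.exp (s * |b y - Bv α b k x|))
        = ∫⁻ y in cell α k x, Filter.liminf (fun N : ℕ =>
          ENNReal.ofReal (Real.exp (s * |Bv α b N y - Bv α b k x|))) Filter.atTop := by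
          refine lintegral_congr_ae (ae_restrict_of_ae ?_)
          filter_upwards [Bv_tendsto α h.loc] with y hy
          refine (Filter.Tendsto.liminf_eq ?_).symm
          refine (ENNReal.continuous_ofReal.tendsto _).comp ?_
          exact (Real.continuous_exp.tendsto _).comp (((hy.sub_const _).abs).const_mul _)
      _ ≤ Filter.liminf (fun N : ℕ => ∫⁻ y in cell α k x,
          ENNReal.ofReal (Real.exp (s * |Bv α b N y - Bv α b k x|))) Filter.atTop := by
          refine lintegral_liminf_le fun N => ?_
          have := measurable_Bv α b N
          fun_prop
      _ ≤ 4 * volume (cell α k x) := by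
          refine Filter.liminf_le_of_frequently_le' (Filter.Eventually.frequently ?_)
          filter_upwards [Filter.eventually_ge_atTop k.toNat] with N hN
          have := JN_trunc hα h hs hsK N (N - k).toNat x
          rwa [show (N:ℤ) - (((N:ℤ) - k).toNat : ℤ) = k by omega] at this
  unfold Ek
  calc _ ≤ (volume (cell α k x))⁻¹ * (4 * volume (cell α k x)) := by gcongr
    _ = _ := by
      rw [mul_comm, mul_assoc, ENNReal.mul_inv_cancel (volume_cell_ne_zero _ _ _) (volume_cell_ne_top _ _ _), mul_one]

end MB

namespace MB

/-- exponential of a multiple of `b` -/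
def ex {d : ℕ} (b : (Fin d → ℝ) → ℝ) (c : ℝ) (y : Fin d → ℝ) : ℝ≥0∞ := ENNReal.ofReal (Real.exp (c * b y))

lemma ex_meas {d : ℕ} {b : (Fin d → ℝ) → ℝ} (hb : Measurable b) (c : ℝ) : Measurable (ex b c) := by
  unfold ex; fun_prop

lemma ex_pos {d : ℕ} (b : (Fin d → ℝ) → ℝ) (c : ℝ) (y) : ex b c y ≠ 0 := by
  simp [ex, Real.exp_pos]

lemma ex_top {d : ℕ} (b : (Fin d → ℝ) → ℝ) (c : ℝ) (y) : ex b c y ≠ ⊤ := ENNReal.ofReal_ne_top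

lemma ex_rpow {d : ℕ} (b : (Fin d → ℝ) → ℝ) (c p : ℝ) (y) : ex b c y ^ p = ex b (c * p) y := by
  unfold ex
  rw [ENNReal.ofReal_rpow_of_pos (Real.exp_pos _), ← Real.exp_mul]
  congr 2; ring

lemma ex_mul {d : ℕ} (b : (Fin d → ℝ) → ℝ) (c c' : ℝ) (y) : ex b c y * ex b c' y = ex b (c + c') y := by
  unfold ex
  rw [← ENNReal.ofReal_mul (Real.exp_nonneg _), ← Real.exp_add]
  congr 2; ring

lemma ex_zero {d : ℕ} (b : (Fin d → ℝ) → ℝ) (y) : ex b 0 y = 1 := by simp [ex]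

/-- exponent admissible for John-Nirenberg -/
def JNs (d : ℕ) (K s : ℝ) : Prop := 0 < s ∧ Real.exp (s * (2 ^ d * K + 4 * K)) ≤ 2

lemma JNs_exists (d : ℕ) {K : ℝ} (hK : 0 < K) : ∃ s, JNs d K s := by
  have hJ : 0 < 2 ^ d * K + 4 * K := by positivity
  have hl : 0 < Real.log 2 := Real.log_pos (by norm_num)
  refine ⟨Real.log 2 / (2 ^ d * K + 4 * K), by positivity, ?_⟩
  rw [div_mul_cancel₀ _ hJ.ne', Real.exp_log (by norm_num)]

lemma Ek_ex {d : ℕ} {α : Fin d → ℝ} (hα : Adm α) {K s : ℝ} {b : (Fin d → ℝ) → ℝ} (h : BMOd α K b)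
    (hs : JNs d K s) {t : ℝ} (ht : |t| = s) (k : ℤ) (x : Fin d → ℝ) :
    Ek α volume k (ex b t) x ≤ 4 * ENNReal.ofReal (Real.exp (t * Bv α b k x)) := by
  have hm : Measurable (fun y => ENNReal.ofReal (Real.exp (s * |b y - Bv α b k x|))) := by
    have := h.meas
    fun_prop
  calc Ek α volume k (ex b t) x ≤ Ek α volume k (fun y => ENNReal.ofReal (Real.exp (t * Bv α b k x)) *
        ENNReal.ofReal (Real.exp (s * |b y - Bv α b k x|))) x := by
        refine Ek_mono (fun y => ?_) x
        unfold ex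
        rw [← ENNReal.ofReal_mul (Real.exp_nonneg _), ← Real.exp_add]
        apply ENNReal.ofReal_le_ofReal
        rw [Real.exp_le_exp]
        have : t * (b y - Bv α b k x) ≤ s * |b y - Bv α b k x| := by
          rw [← ht, ← abs_mul]; exact le_abs_self _
        linarith
    _ = _ := Ek_const_mul α volume k hm _ x
    _ ≤ _ := by rw [mul_comm]; gcongr; exact JN hα h hs.1 hs.2 k x

lemma Ek_half {d : ℕ} {α : Fin d → ℝ} (hα : Adm α) {K s : ℝ} {b : (Fin d → ℝ) → ℝ} (h : BMOd α K b)
    (hs : JNs d K s) {t : ℝ} (ht : |t| = s) {L : NNReal} {U1 U2} (h1 : A1 α L U1) (h2 : A1 α L U2)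
    {θ : ℝ} (hθ0 : 0 < θ) (hθ1 : θ < 1) (k : ℤ) (x : Fin d → ℝ) :
    Ek α volume k (fun y => ex b (t * (1 - θ)) y * (U2 y ^ θ * U1 y ^ (-θ))) x ≤
      (L:ℝ≥0∞) ^ θ * 4 ^ (1 - θ) * (Ek α volume k U1 x ^ (-θ) * Ek α volume k U2 x ^ θ *
        ENNReal.ofReal (Real.exp (t * (1 - θ) * Bv α b k x))) := by
  set e1 := Ek α volume k U1 x
  set e2 := Ek α volume k U2 x
  have hm := mpw (ex_meas h.meas t) (h2.meas.pow_const θ) (1 - θ)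
  calc _ ≤ Ek α volume k (fun y => ((L:ℝ≥0∞) ^ θ * e1 ^ (-θ)) * (ex b t y ^ (1 - θ) * U2 y ^ θ)) x := by
        refine Ek_le_of_cell α volume k fun y hy => ?_
        rw [← ex_rpow]
        calc _ ≤ ex b t y ^ (1 - θ) * (U2 y ^ θ * ((L:ℝ≥0∞) ^ θ * e1 ^ (-θ))) := by
              gcongr; exact h1.neg_le hθ0.le k x hy
          _ = _ := by ring
    _ = ((L:ℝ≥0∞) ^ θ * e1 ^ (-θ)) * Ek α volume k (fun y => ex b t y ^ (1 - θ) * U2 y ^ θ) x :=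
        Ek_const_mul α volume k hm _ x
    _ ≤ ((L:ℝ≥0∞) ^ θ * e1 ^ (-θ)) * (Ek α volume k (ex b t) x ^ (1 - θ) * e2 ^ θ) := by
        gcongr
        exact Ek_holder α k (ex_meas h.meas t) h2.meas (by linarith) hθ0.le (by ring) x
    _ ≤ ((L:ℝ≥0∞) ^ θ * e1 ^ (-θ)) * ((4 * ENNReal.ofReal (Real.exp (t * Bv α b k x))) ^ (1 - θ) * e2 ^ θ) := by
        gcongr
        exact Ek_ex hα h hs ht k x
    _ = _ := by
        rw [ENNReal.mul_rpow_of_nonneg _ _ (by linarith), ENNReal.ofReal_rpow_of_pos (Real.exp_pos _),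
          ← Real.exp_mul, show t * Bv α b k x * (1 - θ) = t * (1 - θ) * Bv α b k x by ring]
        ring

lemma A2 {d : ℕ} {α : Fin d → ℝ} (hα : Adm α) {K s : ℝ} {b : (Fin d → ℝ) → ℝ} (h : BMOd α K b)
    (hs : JNs d K s) {t : ℝ} (ht : |t| = s) {L : NNReal} {U1 U2} (h1 : A1 α L U1) (h2 : A1 α L U2)
    {θ : ℝ} (hθ0 : 0 < θ) (hθ1 : θ < 1) (k : ℤ) (x : Fin d → ℝ) :
    Ek α volume k (fun y => ex b (t * (1 - θ)) y * (U2 y ^ θ * U1 y ^ (-θ))) x *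
    Ek α volume k (fun y => ex b (-t * (1 - θ)) y * (U1 y ^ θ * U2 y ^ (-θ))) x ≤
      ((L ^ θ * 4 ^ (1 - θ)) * (L ^ θ * 4 ^ (1 - θ)) : NNReal) := by
  refine (mul_le_mul' (Ek_half hα h hs ht h1 h2 hθ0 hθ1 k x)
    (Ek_half hα h hs (by rwa [abs_neg]) h2 h1 hθ0 hθ1 k x)).trans (le_of_eq ?_)
  push_cast
  rw [ENNReal.coe_rpow_of_nonneg _ hθ0.le, ENNReal.coe_rpow_of_nonneg _ (by linarith)]
  have a1 : Ek α volume k U1 x ^ (-θ) * Ek α volume k U1 x ^ θ = 1 := by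
    rw [rpow_aux (h1.Ek_ne_zero k x) (h1.Ek_ne_top k x) (z := 0) (by ring), ENNReal.rpow_zero]
  have a2 : Ek α volume k U2 x ^ (-θ) * Ek α volume k U2 x ^ θ = 1 := by
    rw [rpow_aux (h2.Ek_ne_zero k x) (h2.Ek_ne_top k x) (z := 0) (by ring), ENNReal.rpow_zero]
  have a3 : ENNReal.ofReal (Real.exp (t * (1 - θ) * Bv α b k x)) *
      ENNReal.ofReal (Real.exp (-t * (1 - θ) * Bv α b k x)) = 1 := by
    rw [← ENNReal.ofReal_mul (Real.exp_nonneg _), ← Real.exp_add]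
    ring_nf; simp
  calc _ = (L:ℝ≥0∞) ^ θ * 4 ^ (1 - θ) * ((L:ℝ≥0∞) ^ θ * 4 ^ (1 - θ)) *
      ((Ek α volume k U1 x ^ (-θ) * Ek α volume k U1 x ^ θ) * (Ek α volume k U2 x ^ (-θ) * Ek α volume k U2 x ^ θ)
      * (ENNReal.ofReal (Real.exp (t * (1 - θ) * Bv α b k x)) *
      ENNReal.ofReal (Real.exp (-t * (1 - θ) * Bv α b k x)))) := by ring
    _ = _ := by rw [a1, a2, a3]; simp

/-- weighted bound for the conjugated maximal function -/
lemma conj_bound {θ : ℝ} (hθ0 : 0 < θ) (hθ1 : θ < 1) (L : NNReal) : ∃ C : NNReal,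
    ∀ (d : ℕ) (α : Fin d → ℝ), Adm α → ∀ (K s : ℝ) (b : (Fin d → ℝ) → ℝ), BMOd α K b → JNs d K s →
    ∀ t : ℝ, |t| = s → ∀ U1 U2, A1 α L U1 → A1 α L U2 → ∀ f : (Fin d → ℝ) → ℝ≥0∞, Measurable f →
    ∫⁻ x, (ex b (t * (1 - θ) / 2) x * Mx α volume (fun y => ex b (-(t * (1 - θ) / 2)) y * f y) x) ^ (2:ℝ)
        * (U2 x ^ θ * U1 x ^ (-θ))
      ≤ C * ∫⁻ x, f x ^ (2:ℝ) * (U2 x ^ θ * U1 x ^ (-θ)) := by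
  obtain ⟨C, hC⟩ := muck (s := 2) (by norm_num) ((L ^ θ * 4 ^ (1 - θ)) * (L ^ θ * 4 ^ (1 - θ)))
  refine ⟨C, ?_⟩
  intro d α hα K s b hb hs t ht U1 U2 h1 h2 f hf
  have hfm : Measurable (fun y => ex b (-(t * (1 - θ) / 2)) y * f y) := (ex_meas hb.meas _).mul hf
  have key := hC d α hα (fun y => ex b (t * (1 - θ)) y * (U2 y ^ θ * U1 y ^ (-θ)))
    (fun y => ex b (-t * (1 - θ)) y * (U1 y ^ θ * U2 y ^ (-θ)))
    ((ex_meas hb.meas _).mul (mpw h2.meas (h1.meas.pow_const _) _))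
    ((ex_meas hb.meas _).mul (mpw h1.meas (h2.meas.pow_const _) _)) ?_ ?_ ?_ _ hfm
  · convert key using 1
    · refine lintegral_congr fun x => ?_
      rw [ENNReal.mul_rpow_of_nonneg _ _ (by norm_num), ex_rpow, div_mul_cancel₀ _ (by norm_num)]
      ring
    · congr 1
      refine lintegral_congr fun x => ?_
      rw [ENNReal.mul_rpow_of_nonneg _ _ (by norm_num), ex_rpow]
      calc _ = (ex b (-(t * (1 - θ) / 2) * 2) x * ex b (t * (1 - θ)) x) * (f x ^ (2:ℝ) * (U2 x ^ θ * U1 x ^ (-θ))) := by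
            rw [ex_mul]; ring_nf; rw [ex_zero]; ring
        _ = _ := by ring
  · filter_upwards [A1.wpos h1 h2 θ (-θ)] with x hx
    exact ⟨ENNReal.mul_pos (ex_pos _ _ _) hx.1.ne', ENNReal.mul_lt_top (ex_top _ _ _).lt_top hx.2⟩
  · filter_upwards [h1.pos, h2.pos] with x h1 h2
    have e2 : U2 x ^ θ ≠ 0 := (ENNReal.rpow_pos h2.1 h2.2.ne).ne'
    have e2' : U2 x ^ θ ≠ ⊤ := (ENNReal.rpow_ne_top_of_ne_zero h2.1.ne' h2.2.ne)
    have e1 : U1 x ^ (-θ) ≠ 0 := (ENNReal.rpow_pos h1.1 h1.2.ne).ne'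
    have e1' : U1 x ^ (-θ) ≠ ⊤ := (ENNReal.rpow_ne_top_of_ne_zero h1.1.ne' h1.2.ne)
    rw [ENNReal.mul_rpow_of_ne_top (ex_top _ _ _) (ENNReal.mul_ne_top e2' e1'),
      ENNReal.mul_rpow_of_ne_top e2' e1', ← ENNReal.rpow_mul, ← ENNReal.rpow_mul, ex_rpow]
    norm_num
    ring
  · intro x k
    have := A2 hα hb hs ht h1 h2 hθ0 hθ1 k x
    norm_num at this ⊢
    exact this

/-- dyadic maximal commutator -/
def Mb {d : ℕ} (α : Fin d → ℝ) (b : (Fin d → ℝ) → ℝ) (f : (Fin d → ℝ) → ℝ≥0∞)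
    (x : Fin d → ℝ) : ℝ≥0∞ :=
  ⨆ k : ℤ, (volume (cell α k x))⁻¹ * ∫⁻ y in cell α k x, ENNReal.ofReal |b x - b y| * f y

lemma measurable_Mb {d : ℕ} (α : Fin d → ℝ) {b : (Fin d → ℝ) → ℝ} (hb : Measurable b)
    {f : (Fin d → ℝ) → ℝ≥0∞} (hf : Measurable f) : Measurable (Mb α b f) := by
  refine Measurable.iSup fun k => ?_
  refine Measurable.mul ?_ ?_
  · simp_rw [volume_cell]; exact measurable_const
  · have : ∀ x, ∫⁻ y in cell α k x, ENNReal.ofReal |b x - b y| * f y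
        = ∫⁻ y, ({p : (Fin d → ℝ) × (Fin d → ℝ) | cidx α k p.2 = cidx α k p.1}).indicator
          (fun p => ENNReal.ofReal |b p.1 - b p.2| * f p.2) (x, y) := by
      intro x
      rw [← lintegral_indicator (measurableSet_cell _ _ _)]
      rfl
    simp_rw [this]
    refine Measurable.lintegral_prod_right' ?_
    refine Measurable.indicator ?_ ?_
    · exact ((by fun_prop : Measurable fun p : (Fin d → ℝ) × (Fin d → ℝ) =>
        ENNReal.ofReal |b p.1 - b p.2|)).mul (hf.comp measurable_snd)
    · exact measurableSet_eq_fun ((measurable_cidx α k).comp measurable_snd)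
        ((measurable_cidx α k).comp measurable_fst)

lemma abs_le_exp (ε : ℝ) (hε : 0 < ε) (u v : ℝ) :
    ENNReal.ofReal |u - v| ≤ ENNReal.ofReal ε⁻¹ * (ENNReal.ofReal (Real.exp (ε * u)) * ENNReal.ofReal (Real.exp (-ε * v))
      + ENNReal.ofReal (Real.exp (-ε * u)) * ENNReal.ofReal (Real.exp (ε * v))) := by
  rw [← ENNReal.ofReal_mul (Real.exp_nonneg _), ← ENNReal.ofReal_mul (Real.exp_nonneg _),
    ← ENNReal.ofReal_add (by positivity) (by positivity), ← ENNReal.ofReal_mul (by positivity),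
    ← Real.exp_add, ← Real.exp_add]
  apply ENNReal.ofReal_le_ofReal
  rw [inv_mul_eq_div, le_div_iff₀ hε]
  have h1 := Real.add_one_le_exp (ε * u + -ε * v)
  have h2 := Real.add_one_le_exp (-ε * u + ε * v)
  have p1 := Real.exp_pos (ε * u + -ε * v)
  have p2 := Real.exp_pos (-ε * u + ε * v)
  rcases abs_cases (u - v) with ⟨h, _⟩ | ⟨h, _⟩ <;> rw [h] <;> nlinarith

lemma Mb_le {d : ℕ} (α : Fin d → ℝ) {b : (Fin d → ℝ) → ℝ} (hb : Measurable b)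
    {f : (Fin d → ℝ) → ℝ≥0∞} (hf : Measurable f) {ε : ℝ} (hε : 0 < ε) (x) :
    Mb α b f x ≤ ENNReal.ofReal ε⁻¹ * (ex b ε x * Mx α volume (fun y => ex b (-ε) y * f y) x +
      ex b (-ε) x * Mx α volume (fun y => ex b ε y * f y) x) := by
  refine iSup_le fun k => ?_
  have m1 : Measurable (fun y => ex b (-ε) y * f y) := (ex_meas hb _).mul hf
  have m2 : Measurable (fun y => ex b ε y * f y) := (ex_meas hb _).mul hf
  have m1' : Measurable (fun y => ex b ε x * (ex b (-ε) y * f y)) := measurable_const.mul m1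
  have m3 : Measurable (fun y => ex b ε x * (ex b (-ε) y * f y) + ex b (-ε) x * (ex b ε y * f y)) :=
    m1'.add (measurable_const.mul m2)
  calc _ ≤ Ek α volume k (fun y => ENNReal.ofReal ε⁻¹ *
        (ex b ε x * (ex b (-ε) y * f y) + ex b (-ε) x * (ex b ε y * f y))) x := by
        unfold Ek
        gcongr with y
        refine (mul_le_mul_left (abs_le_exp ε hε (b x) (b y)) _).trans (le_of_eq ?_)
        unfold ex
        ring
    _ = ENNReal.ofReal ε⁻¹ * (ex b ε x * Ek α volume k (fun y => ex b (-ε) y * f y) x +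
      ex b (-ε) x * Ek α volume k (fun y => ex b ε y * f y) x) := by
        rw [Ek_const_mul α volume k m3, Ek_add m1', Ek_const_mul α volume k m1, Ek_const_mul α volume k m2]
    _ ≤ _ := by
        gcongr <;> exact Ek_le_Mx _ _ _ _ _

lemma WB_Mx {d : ℕ} {α : Fin d → ℝ} (hα : Adm α) :
    WB α 2 {P | Measurable P.2 ∧ P.1 = Mx α volume P.2} := by
  intro θ h0 h1 K
  obtain ⟨C, hC⟩ := muckU (s := 2) (a := θ) (c := θ * (2 - 1)) (by norm_num) h0.le h1.le
    (by linarith) (by linarith) K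
  refine ⟨C, ?_⟩
  rintro P ⟨hm, hP⟩ U1 U2 hU1 hU2
  rw [hP]
  exact hC d α hα U1 U2 hU1 hU2 _ hm

lemma WB_Mb {d : ℕ} {α : Fin d → ℝ} (hα : Adm α) {K : ℝ} {b : (Fin d → ℝ) → ℝ} (hb : BMOd α K b) :
    WB α 2 {P | Measurable P.2 ∧ P.1 = Mb α b P.2} := by
  intro θ h0 h1 L
  obtain ⟨C, hC⟩ := conj_bound h0 h1 L
  obtain ⟨s, hs⟩ := JNs_exists d hb.pos
  set ε := s * (1 - θ) / 2 with hε
  have hε0 : 0 < ε := by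
    have := hs.1
    have : 0 < 1 - θ := by linarith
    rw [hε]; positivity
  refine ⟨Real.toNNReal ε⁻¹ ^ (2:ℝ) * (2 * (C + C)), ?_⟩
  rintro P ⟨hm, hP⟩ U1 U2 hU1 hU2
  have k1 := hC d α hα K s b hb hs s (abs_of_pos hs.1) U1 U2 hU1 hU2 _ hm
  have k2 := hC d α hα K s b hb hs (-s) (by rw [abs_neg, abs_of_pos hs.1]) U1 U2 hU1 hU2 _ hm
  rw [← hε] at k1
  rw [show -s * (1 - θ) / 2 = -ε by rw [hε]; ring, neg_neg] at k2
  rw [hP]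
  have hw : Measurable fun x => U2 x ^ θ * U1 x ^ (-θ) := mpw hU2.meas (hU1.meas.pow_const _) _
  have hg1 : Measurable fun x => ex b ε x * Mx α volume (fun y => ex b (-ε) y * P.2 y) x :=
    (ex_meas hb.meas _).mul (measurable_Mx _ _ _)
  have e : -(θ * (2 - 1)) = -θ := by ring
  simp only [e]
  set g1 := fun x => ex b ε x * Mx α volume (fun y => ex b (-ε) y * P.2 y) x with hgd1
  set g2 := fun x => ex b (-ε) x * Mx α volume (fun y => ex b ε y * P.2 y) x with hgd2
  have hg2 : Measurable g2 := (ex_meas hb.meas _).mul (measurable_Mx _ _ _)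
  set w := fun x => U2 x ^ θ * U1 x ^ (-θ) with hwd
  calc ∫⁻ x, Mb α b P.2 x ^ (2:ℝ) * w x
      ≤ ∫⁻ x, (ENNReal.ofReal ε⁻¹ ^ (2:ℝ) * 2) * (g1 x ^ (2:ℝ) * w x + g2 x ^ (2:ℝ) * w x) := by
        refine lintegral_mono fun x => ?_
        calc _ ≤ (ENNReal.ofReal ε⁻¹ * (g1 x + g2 x)) ^ (2:ℝ) * w x := by
              gcongr; exact Mb_le α hb.meas hm hε0 x
          _ ≤ ENNReal.ofReal ε⁻¹ ^ (2:ℝ) * (2 * (g1 x ^ (2:ℝ) + g2 x ^ (2:ℝ))) * w x := by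
              rw [ENNReal.mul_rpow_of_nonneg _ _ (by norm_num)]
              gcongr
              have := ENNReal.rpow_add_le_mul_rpow_add_rpow (g1 x) (g2 x) (p := 2) (by norm_num)
              norm_num at this ⊢
              exact this
          _ = _ := by ring
    _ = (ENNReal.ofReal ε⁻¹ ^ (2:ℝ) * 2) * ((∫⁻ x, g1 x ^ (2:ℝ) * w x) + ∫⁻ x, g2 x ^ (2:ℝ) * w x) := by
        have m12 : Measurable fun x => g1 x ^ (2:ℝ) * w x + g2 x ^ (2:ℝ) * w x :=
          (mpw hg1 hw 2).add (mpw hg2 hw 2)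
        rw [lintegral_const_mul _ m12, lintegral_add_left (mpw hg1 hw 2)]
    _ ≤ (ENNReal.ofReal ε⁻¹ ^ (2:ℝ) * 2) * (C * (∫⁻ x, P.2 x ^ (2:ℝ) * w x) + C * ∫⁻ x, P.2 x ^ (2:ℝ) * w x) := by
        gcongr
    _ = _ := by
        push_cast
        rw [ENNReal.coe_rpow_of_nonneg _ (by norm_num)]
        simp only [ENNReal.ofReal]
        ring

/-- mixed norm bounds -/
lemma Mx_mixed {d : ℕ} {α : Fin d → ℝ} (hα : Adm α) {q : Fin d → ℝ} (hq : ∀ j, 1 < q j) :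
    ∃ C : NNReal, ∀ f, Measurable f → mixedLnorm d q (Mx α volume f) ≤ C * mixedLnorm d q f := by
  obtain ⟨C, hC⟩ := chain d α hα q hq 2 (by norm_num) {P | Measurable P.2 ∧ P.1 = Mx α volume P.2}
    (by rintro P ⟨h1, h2⟩; rw [h2]; exact ⟨measurable_Mx _ _ _, h1⟩) (WB_Mx hα)
  exact ⟨C, fun f hf => hC (Mx α volume f, f) ⟨hf, rfl⟩⟩

lemma Mb_mixed {d : ℕ} {α : Fin d → ℝ} (hα : Adm α) {q : Fin d → ℝ} (hq : ∀ j, 1 < q j)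
    {K : ℝ} {b : (Fin d → ℝ) → ℝ} (hb : BMOd α K b) :
    ∃ C : NNReal, ∀ f, Measurable f → mixedLnorm d q (Mb α b f) ≤ C * mixedLnorm d q f := by
  obtain ⟨C, hC⟩ := chain d α hα q hq 2 (by norm_num) {P | Measurable P.2 ∧ P.1 = Mb α b P.2}
    (by rintro P ⟨h1, h2⟩; rw [h2]; exact ⟨measurable_Mb _ hb.meas h1, h1⟩) (WB_Mb hα hb)
  exact ⟨C, fun f hf => hC (Mb α b f, f) ⟨hf, rfl⟩⟩

end MB

namespace MB

lemma eudist_eq {n : ℕ} (x y : Fin n → ℝ) : eudist n x y = dist (WithLp.toLp 2 x) (WithLp.toLp 2 y) := by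
  rw [EuclideanSpace.dist_eq]
  unfold eudist
  simp [Real.dist_eq]

lemma eudist_tri {n : ℕ} (x y z : Fin n → ℝ) : eudist n x z ≤ eudist n x y + eudist n y z := by
  simp only [eudist_eq]; exact dist_triangle _ _ _

lemma eudist_comm {n : ℕ} (x y : Fin n → ℝ) : eudist n x y = eudist n y x := by
  simp only [eudist_eq]; exact dist_comm _ _

lemma eudist_self {n : ℕ} (x : Fin n → ℝ) : eudist n x x = 0 := by
  simp [eudist_eq]

lemma mem_eball {n : ℕ} {x y : Fin n → ℝ} {r : ℝ} : y ∈ eball n x r ↔ eudist n x y < r := Iff.rfl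

lemma measurableSet_eball (n : ℕ) (x : Fin n → ℝ) (r : ℝ) : MeasurableSet (eball n x r) := by
  have : Measurable fun y => eudist n x y := by
    unfold eudist; fun_prop
  exact measurableSet_lt this measurable_const

lemma eball_mono {n : ℕ} {x : Fin n → ℝ} {r s : ℝ} (h : r ≤ s) : eball n x r ⊆ eball n x s :=
  fun _ hy => lt_of_lt_of_le hy h

lemma eball_sub {n : ℕ} {x x0 : Fin n → ℝ} {r t u : ℝ} (hx : x ∈ eball n x0 r) (h : r + t ≤ u) :
    eball n x t ⊆ eball n x0 u := fun y hy => by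
  have := eudist_tri x0 x y
  rw [mem_eball] at *
  linarith

lemma eball_sub_box {n : ℕ} (x : Fin n → ℝ) (r : ℝ) :
    eball n x r ⊆ Set.pi univ fun i => Ioo (x i - r) (x i + r) := by
  intro y hy i _
  have h1 : |x i - y i| ≤ eudist n x y := by
    unfold eudist
    apply Real.abs_le_sqrt
    exact Finset.single_le_sum (f := fun i => (x i - y i) ^ 2) (fun j _ => sq_nonneg _) (Finset.mem_univ i)
  have h2 := lt_of_le_of_lt h1 hy
  rw [abs_lt] at h2
  exact ⟨by linarith, by linarith⟩

lemma box_sub_eball {n : ℕ} (hn : 0 < n) (x : Fin n → ℝ) {r : ℝ} (hr : 0 < r) :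
    (Set.pi univ fun i => Ioo (x i - r / n) (x i + r / n)) ⊆ eball n x r := by
  intro y hy
  have hn' : (1:ℝ) ≤ n := by exact_mod_cast hn
  rw [mem_eball]
  unfold eudist
  rw [Real.sqrt_lt' hr]
  have : Nonempty (Fin n) := ⟨⟨0, hn⟩⟩
  calc ∑ i, (x i - y i) ^ 2 < ∑ _i : Fin n, (r / n) ^ 2 := by
        apply Finset.sum_lt_sum_of_nonempty Finset.univ_nonempty
        intro i _
        have := hy i (mem_univ _)
        simp only [mem_Ioo] at this
        apply sq_lt_sq' <;> linarith
    _ = r ^ 2 / n := by simp; field_simp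
    _ ≤ r ^ 2 := div_le_self (by positivity) hn'

lemma vol_box {n : ℕ} (x : Fin n → ℝ) {r : ℝ} (hr : 0 < r) :
    volume (Set.pi univ fun i => Ioo (x i - r) (x i + r)) = ENNReal.ofReal ((2 * r) ^ n) := by
  rw [volume_pi_pi, ENNReal.ofReal_pow (by positivity)]
  have : ∀ i : Fin n, volume (Ioo (x i - r) (x i + r)) = ENNReal.ofReal (2 * r) := by
    intro i; rw [Real.volume_Ioo]; congr 1; ring
  rw [Finset.prod_congr rfl fun i _ => this i]
  simp

lemma vol_eball_le {n : ℕ} (x : Fin n → ℝ) {r : ℝ} (hr : 0 < r) :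
    volume (eball n x r) ≤ ENNReal.ofReal ((2 * r) ^ n) := by
  rw [← vol_box x hr]; exact measure_mono (eball_sub_box x r)

lemma vol_eball_ge {n : ℕ} (hn : 0 < n) (x : Fin n → ℝ) {r : ℝ} (hr : 0 < r) :
    ENNReal.ofReal ((2 * (r / n)) ^ n) ≤ volume (eball n x r) := by
  have : (0:ℝ) < n := by exact_mod_cast hn
  rw [← vol_box x (by positivity)]; exact measure_mono (box_sub_eball hn x hr)

lemma vol_eball_ne_top {n : ℕ} (x : Fin n → ℝ) {r : ℝ} (hr : 0 < r) : volume (eball n x r) ≠ ⊤ :=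
  ((vol_eball_le x hr).trans_lt ENNReal.ofReal_lt_top).ne

lemma vol_eball_ne_zero {n : ℕ} (hn : 0 < n) (x : Fin n → ℝ) {r : ℝ} (hr : 0 < r) :
    volume (eball n x r) ≠ 0 := by
  have : (0:ℝ) < n := by exact_mod_cast hn
  refine ((ENNReal.ofReal_pos.2 (by positivity)).trans_le (vol_eball_ge hn x hr)).ne.symm

/-- `(vol B_r)⁻¹ ≤ c r^{-n}` -/
lemma vol_eball_inv {n : ℕ} (hn : 0 < n) (x : Fin n → ℝ) {r : ℝ} (hr : 0 < r) :
    (volume (eball n x r))⁻¹ ≤ ENNReal.ofReal ((n:ℝ) ^ n) * ENNReal.ofReal ((r ^ n)⁻¹) := by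
  have hn' : (0:ℝ) < n := by exact_mod_cast hn
  refine (ENNReal.inv_le_inv.2 (vol_eball_ge hn x hr)).trans ?_
  rw [← ENNReal.ofReal_inv_of_pos (by positivity), ← ENNReal.ofReal_mul (by positivity)]
  apply ENNReal.ofReal_le_ofReal
  rw [mul_pow, div_pow, mul_inv, inv_div, div_eq_mul_inv]
  have h2 : ((2:ℝ) ^ n)⁻¹ ≤ 1 := inv_le_one_of_one_le₀ (one_le_pow₀ (by norm_num))
  have : 0 ≤ (n:ℝ) ^ n * (r ^ n)⁻¹ := by positivity
  nlinarith

lemma eball_bdd {n : ℕ} (x : Fin n → ℝ) (r : ℝ) : eball n x r ⊆ Metric.closedBall x r := by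
  intro y hy
  have hr : 0 ≤ r := by
    have h : eudist n x y < r := hy
    have : 0 ≤ eudist n x y := Real.sqrt_nonneg _
    linarith
  rw [Metric.mem_closedBall, dist_pi_le_iff hr]
  intro i
  have := eball_sub_box x r hy i (mem_univ _)
  simp only [mem_Ioo] at this
  rw [Real.dist_eq, abs_le]
  constructor <;> linarith

/-- shifts -/
def sh {n : ℕ} (e : Fin n → Bool) : Fin n → ℝ := fun i => if e i then 1 / 3 else 0

lemma sh_adm {n : ℕ} (e : Fin n → Bool) : Adm (sh e) := by
  intro i
  unfold sh
  split_ifs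
  · exact ⟨1, by norm_num⟩
  · exact ⟨0, by norm_num⟩

lemma third (k : ℤ) (u δ : ℝ) (hδ0 : 0 < δ) (hδ : (2:ℝ) ^ k * δ ≤ 1 / 6) :
    ∃ e : Bool, ∀ v, |v - u| < δ → idx k (if e then 1 / 3 else 0) v = idx k (if e then 1 / 3 else 0) u := by
  have h2 : (0:ℝ) < 2 ^ k := by positivity
  set w := (2:ℝ) ^ k * u with hw
  set η := (2:ℝ) ^ k * δ with hη
  have hη0 : 0 < η := by positivity
  have hv : ∀ v, |v - u| < δ → w - η < 2 ^ k * v ∧ 2 ^ k * v < w + η := by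
    intro v hv
    rw [abs_lt] at hv
    constructor <;> rw [hw, hη] <;> nlinarith
  have hgen : ∀ a : ℝ, ∀ z : ℤ, z + η ≤ w - a → w - a ≤ z + 1 - η → ∀ y, w - η < y → y < w + η →
      ⌊y - a⌋ = z := by
    intro a z h1 h2 y h3 h4
    rw [Int.floor_eq_iff]
    constructor <;> linarith
  have fin : ∀ (e : Bool) (z : ℤ), z + η ≤ w - (-1) ^ k * (if e then 1 / 3 else 0) →
      w - (-1) ^ k * (if e then 1 / 3 else 0) ≤ z + 1 - η →
      ∃ e : Bool, ∀ v, |v - u| < δ → idx k (if e then 1 / 3 else 0) v = idx k (if e then 1 / 3 else 0) u := by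
    intro e z h1 h2
    refine ⟨e, fun v hvu => ?_⟩
    unfold idx
    rw [hgen _ z h1 h2 _ (hv v hvu).1 (hv v hvu).2,
      hgen _ z h1 h2 _ (hv u (by simpa using hδ0)).1 (hv u (by simpa using hδ0)).2]
  have hf1 := Int.floor_le w
  have hf2 := Int.lt_floor_add_one w
  by_cases c1 : ⌊w⌋ + η ≤ w
  · by_cases c2 : w ≤ ⌊w⌋ + 1 - η
    · exact fin false ⌊w⌋ (by simpa using c1) (by simpa using c2)
    · push Not at c2
      rcases Int.even_or_odd k with hk | hk
      · refine fin true ⌊w⌋ ?_ ?_ <;> rw [hk.neg_one_zpow] <;> simp only [if_true] <;> linarith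
      · refine fin true (⌊w⌋ + 1) ?_ ?_ <;> rw [hk.neg_one_zpow] <;> simp only [if_true] <;> push_cast <;> linarith
  · push Not at c1
    rcases Int.even_or_odd k with hk | hk
    · refine fin true (⌊w⌋ - 1) ?_ ?_ <;> rw [hk.neg_one_zpow] <;> simp only [if_true] <;> push_cast <;> linarith
    · refine fin true ⌊w⌋ ?_ ?_ <;> rw [hk.neg_one_zpow] <;> simp only [if_true] <;> linarith

lemma eball_cell {n : ℕ} (x : Fin n → ℝ) {t : ℝ} (ht : 0 < t) : ∃ (e : Fin n → Bool) (k : ℤ),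
    (2:ℝ) ^ (-k) ≤ 12 * t ∧ eball n x t ⊆ cell (sh e) k x := by
  obtain ⟨m, hm1, hm2⟩ := exists_mem_Ioc_zpow (x := 12 * t) (y := (2:ℝ)) (by positivity) (by norm_num)
  have hk : (2:ℝ) ^ (-m) * t ≤ 1 / 6 := by
    have : (2:ℝ) ^ (m + 1) = 2 * 2 ^ m := by rw [zpow_add₀ (by norm_num)]; ring
    rw [this] at hm2
    rw [zpow_neg]
    have hp : (0:ℝ) < 2 ^ m := by positivity
    rw [inv_mul_le_iff₀ hp]
    linarith
  choose e he using fun i => third (-m) (x i) t ht hk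
  refine ⟨e, -m, by rw [neg_neg]; exact hm1.le, fun y hy => ?_⟩
  rw [mem_cell]
  ext i
  unfold cidx sh
  apply he i
  have := eball_sub_box x t hy i (mem_univ _)
  simp only [mem_Ioo] at this
  rw [abs_lt]; constructor <;> linarith

/-- a ball average is dominated by a cell average -/
lemma ball_le_cell {n : ℕ} (x0 : Fin n → ℝ) {t : ℝ} (ht : 0 < t) : ∃ (e : Fin n → Bool) (k : ℤ),
    ∀ x ∈ eball n x0 t, ∀ F : (Fin n → ℝ) → ℝ≥0∞,
    ENNReal.ofReal ((t ^ n)⁻¹) * ∫⁻ y in eball n x0 t, F y ≤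
      ENNReal.ofReal (12 ^ n) * ((volume (cell (sh e) k x))⁻¹ * ∫⁻ y in cell (sh e) k x, F y) := by
  obtain ⟨e, k, hk, hs⟩ := eball_cell x0 ht
  refine ⟨e, k, fun x hx F => ?_⟩
  rw [cell_eq (hs hx), ← mul_assoc]
  gcongr
  rw [volume_cell, ← ENNReal.ofReal_pow (by positivity), ← ENNReal.ofReal_inv_of_pos (by positivity),
    ← ENNReal.ofReal_mul (by positivity)]
  apply ENNReal.ofReal_le_ofReal
  have : ((12 * t) ^ n)⁻¹ ≤ (((2:ℝ) ^ (-k)) ^ n)⁻¹ := by gcongr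
  rw [mul_pow, mul_inv] at this
  have h12 : (0:ℝ) < 12 ^ n := by positivity
  rw [← inv_mul_le_iff₀ h12]
  exact this

/-- sums over all shifted grids -/
def T {n : ℕ} (F : (Fin n → ℝ) → ℝ≥0∞) (x : Fin n → ℝ) : ℝ≥0∞ := ∑ e : Fin n → Bool, Mx (sh e) volume F x

/-- sums of commutators over all shifted grids -/
def Tb {n : ℕ} (b : (Fin n → ℝ) → ℝ) (F : (Fin n → ℝ) → ℝ≥0∞) (x : Fin n → ℝ) : ℝ≥0∞ :=
  ∑ e : Fin n → Bool, Mb (sh e) b F x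

lemma ball_le_T {n : ℕ} {x0 : Fin n → ℝ} {t : ℝ} (ht : 0 < t) {x} (hx : x ∈ eball n x0 t)
    (F : (Fin n → ℝ) → ℝ≥0∞) :
    ENNReal.ofReal ((t ^ n)⁻¹) * ∫⁻ y in eball n x0 t, F y ≤ ENNReal.ofReal (12 ^ n) * T F x := by
  obtain ⟨e, k, h⟩ := ball_le_cell x0 ht
  refine (h x hx F).trans ?_
  gcongr
  refine (Ek_le_Mx (sh e) volume k F x).trans ?_
  exact Finset.single_le_sum (f := fun e => Mx (sh e) volume F x) (fun _ _ => zero_le) (Finset.mem_univ e)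

lemma ball_le_Tb {n : ℕ} {x0 : Fin n → ℝ} {t : ℝ} (ht : 0 < t) {x} (hx : x ∈ eball n x0 t)
    (b : (Fin n → ℝ) → ℝ) (F : (Fin n → ℝ) → ℝ≥0∞) :
    ENNReal.ofReal ((t ^ n)⁻¹) * ∫⁻ y in eball n x0 t, ENNReal.ofReal |b x - b y| * F y
      ≤ ENNReal.ofReal (12 ^ n) * Tb b F x := by
  obtain ⟨e, k, h⟩ := ball_le_cell x0 ht
  refine (h x hx _).trans ?_
  gcongr
  refine (le_iSup (fun k => (volume (cell (sh e) k x))⁻¹ *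
    ∫⁻ y in cell (sh e) k x, ENNReal.ofReal |b x - b y| * F y) k).trans ?_
  exact Finset.single_le_sum (f := fun e => Mb (sh e) b F x) (fun _ _ => zero_le) (Finset.mem_univ e)

lemma measurable_T {n : ℕ} (F : (Fin n → ℝ) → ℝ≥0∞) : Measurable (T F) :=
  Finset.measurable_fun_sum _ fun _ _ => measurable_Mx _ _ _

lemma measurable_Tb {n : ℕ} {b : (Fin n → ℝ) → ℝ} (hb : Measurable b) {F : (Fin n → ℝ) → ℝ≥0∞}
    (hF : Measurable F) : Measurable (Tb b F) :=
  Finset.measurable_fun_sum _ fun _ _ => measurable_Mb _ hb hF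

lemma T_mixed {n : ℕ} {q : Fin n → ℝ} (hq : ∀ j, 1 < q j) :
    ∃ C : NNReal, ∀ f, Measurable f → mixedLnorm n q (T f) ≤ C * mixedLnorm n q f := by
  obtain ⟨D, hD⟩ := mixedLnorm_sum n q (fun j => by linarith [hq j]) (Finset.univ : Finset (Fin n → Bool))
  choose C hC using fun e : Fin n → Bool => Mx_mixed (sh_adm e) hq
  refine ⟨D * ∑ e, C e, fun f hf => ?_⟩
  refine (hD (fun e => Mx (sh e) volume f) fun e => measurable_Mx _ _ _).trans ?_
  push_cast
  rw [mul_assoc, Finset.sum_mul]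
  gcongr
  exact hC _ f hf

lemma Tb_mixed {n : ℕ} {q : Fin n → ℝ} (hq : ∀ j, 1 < q j) {K : ℝ} {b : (Fin n → ℝ) → ℝ}
    (hb : ∀ e, BMOd (sh e) K b) :
    ∃ C : NNReal, ∀ f, Measurable f → mixedLnorm n q (Tb b f) ≤ C * mixedLnorm n q f := by
  obtain ⟨D, hD⟩ := mixedLnorm_sum n q (fun j => by linarith [hq j]) (Finset.univ : Finset (Fin n → Bool))
  choose C hC using fun e : Fin n → Bool => Mb_mixed (sh_adm e) hq (hb e)
  refine ⟨D * ∑ e, C e, fun f hf => ?_⟩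
  refine (hD (fun e => Mb (sh e) b f) fun e => measurable_Mb _ (hb e).meas hf).trans ?_
  push_cast
  rw [mul_assoc, Finset.sum_mul]
  gcongr
  exact hC _ f hf

end MB

namespace MB

lemma avg_sub_le {n : ℕ} {S : Set (Fin n → ℝ)} {b : (Fin n → ℝ) → ℝ} (hi : IntegrableOn b S)
    (h0 : volume S ≠ 0) (ht : volume S ≠ ⊤) (c : ℝ) :
    ENNReal.ofReal |(⨍ y in S, b y) - c| * volume S ≤ ∫⁻ y in S, ENNReal.ofReal |b y - c| := by
  have hr : 0 < (volume S).toReal := ENNReal.toReal_pos h0 ht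
  have hc : IntegrableOn (fun _ => c) S := integrableOn_const ht
  have hic : IntegrableOn (fun y => b y - c) S := hi.sub hc
  have e1 : ∫ y in S, (b y - c) = (volume S).toReal * ((⨍ y in S, b y) - c) := by
    rw [integral_sub hi hc, setIntegral_const]
    rw [setAverage_eq, smul_eq_mul, smul_eq_mul, Measure.real]
    field_simp
  have e2 : ENNReal.ofReal (∫ y in S, |b y - c|) = ∫⁻ y in S, ENNReal.ofReal |b y - c| :=
    ofReal_integral_eq_lintegral_ofReal hic.abs (Filter.Eventually.of_forall fun y => abs_nonneg _)
  rw [← e2]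
  conv_lhs => rw [← ENNReal.ofReal_toReal ht]
  rw [← ENNReal.ofReal_mul (abs_nonneg _)]
  apply ENNReal.ofReal_le_ofReal
  calc |(⨍ y in S, b y) - c| * (volume S).toReal
      = |∫ y in S, (b y - c)| := by rw [e1, abs_mul, abs_of_pos hr, mul_comm]
    _ ≤ _ := abs_integral_le_integral_abs

/-- ball averages -/
def βv {n : ℕ} (b : (Fin n → ℝ) → ℝ) (x : Fin n → ℝ) (t : ℝ) : ℝ := ⨍ y in eball n x t, b y

/-- `BMO` in ball form -/
structure BMOb {n : ℕ} (K : ℝ) (b : (Fin n → ℝ) → ℝ) : Prop where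
  meas : Measurable b
  loc : LocallyIntegrable b
  nonneg : 0 ≤ K
  le : ∀ x t, 0 < t → ∫⁻ y in eball n x t, ENNReal.ofReal |b y - βv b x t| ≤
    ENNReal.ofReal K * volume (eball n x t)

lemma intOn_eball {n : ℕ} {b : (Fin n → ℝ) → ℝ} (hb : LocallyIntegrable b) (x t) :
    IntegrableOn b (eball n x t) :=
  (hb.integrableOn_isCompact (isCompact_closedBall _ _)).mono_set (eball_bdd x t)

lemma BMOb_of {n : ℕ} (hn : 0 < n) {b : (Fin n → ℝ) → ℝ} (hb : LocallyIntegrable b) (h : bmoNorm n b ≠ ⊤) :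
    ∃ (K : ℝ) (b' : (Fin n → ℝ) → ℝ), BMOb K b' ∧ b =ᵐ[volume] b' := by
  have hm := hb.aestronglyMeasurable
  set b' := hm.mk b with hb'
  have hae : b =ᵐ[volume] b' := hm.ae_eq_mk
  have hloc : LocallyIntegrable b' := hb.congr hae
  refine ⟨(bmoNorm n b).toReal, b', ⟨hm.stronglyMeasurable_mk.measurable, hloc, ENNReal.toReal_nonneg, ?_⟩, hae⟩
  intro x t ht
  have h0 := vol_eball_ne_zero hn x ht
  have htop := vol_eball_ne_top x ht
  have hr : 0 < (volume (eball n x t)).toReal := ENNReal.toReal_pos h0 htop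
  rw [ENNReal.ofReal_toReal h]
  have h1 : ENNReal.ofReal ((volume (eball n x t)).toReal⁻¹
      * ∫ y in eball n x t, |b y - ⨍ z in eball n x t, b z|) ≤ bmoNorm n b :=
    le_iSup_of_le x (le_iSup_of_le t (le_iSup_of_le ht le_rfl))
  have e0 : (⨍ z in eball n x t, b z) = βv b' x t := by
    unfold βv
    rw [setAverage_eq, setAverage_eq, integral_congr_ae (ae_restrict_of_ae hae)]
  have e1 : ∫ y in eball n x t, |b y - ⨍ z in eball n x t, b z| = ∫ y in eball n x t, |b' y - βv b' x t| := by
    rw [e0]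
    refine integral_congr_ae (ae_restrict_of_ae ?_)
    filter_upwards [hae] with y hy
    rw [hy]
  have hi := (intOn_eball hloc x t).sub (integrableOn_const (C := βv b' x t) htop)
  have e2 : ENNReal.ofReal (∫ y in eball n x t, |b' y - βv b' x t|) =
      ∫⁻ y in eball n x t, ENNReal.ofReal |b' y - βv b' x t| :=
    ofReal_integral_eq_lintegral_ofReal hi.abs (Filter.Eventually.of_forall fun y => abs_nonneg _)
  rw [e1, ENNReal.ofReal_mul (by positivity), e2, ENNReal.ofReal_inv_of_pos hr, ENNReal.ofReal_toReal htop] at h1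
  rw [mul_comm, ← ENNReal.inv_mul_le_iff h0 htop]
  exact h1

lemma BMOb.cells {n : ℕ} (hn : 0 < n) {K : ℝ} {b : (Fin n → ℝ) → ℝ} (h : BMOb K b) (α : Fin n → ℝ) :
    BMOd α (2 * (K * (2 * n) ^ n) + 1) b := by
  have hK := h.nonneg
  have hn' : (1:ℝ) ≤ n := by exact_mod_cast hn
  refine ⟨h.meas, h.loc, by positivity, fun x k => ?_⟩
  set L := (2:ℝ) ^ (-k) with hL
  have hL0 : 0 < L := by positivity
  set c := ctr α k x
  set R := n * L with hR
  have hR0 : 0 < R := by positivity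
  have hsub : cell α k x ⊆ eball n c R := by
    refine subset_trans ?_ (box_sub_eball hn c hR0)
    intro y hy i _
    rw [cell_eq_pi] at hy
    have := hy i (mem_univ _)
    simp only [mem_Ico] at this
    have e : R / n = L := by rw [hR]; field_simp
    rw [e]
    simp only [c, ctr, mem_Ioo]
    rw [← hL] at *
    constructor <;> linarith [this.1, this.2]
  set V := volume (cell α k x)
  set β := βv b c R
  have h1 : ∫⁻ y in cell α k x, ENNReal.ofReal |b y - β| ≤ ENNReal.ofReal (K * (2 * n) ^ n) * V := by
    calc _ ≤ ∫⁻ y in eball n c R, ENNReal.ofReal |b y - β| := lintegral_mono_set hsub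
      _ ≤ ENNReal.ofReal K * volume (eball n c R) := h.le c R hR0
      _ ≤ ENNReal.ofReal K * ENNReal.ofReal ((2 * R) ^ n) := by gcongr; exact vol_eball_le c hR0
      _ = _ := by
        simp only [V]
        rw [volume_cell, ← hL, ← ENNReal.ofReal_pow hL0.le, ← ENNReal.ofReal_mul hK,
          ← ENNReal.ofReal_mul (by positivity), hR]
        congr 1
        rw [show 2 * ((n:ℝ) * L) = 2 * n * L by ring, mul_pow _ L]; ring
  have h2 := avg_sub_le (intOn_cell (α := α) h.loc k x) (volume_cell_ne_zero _ _ _) (volume_cell_ne_top _ _ _) β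
  calc ∫⁻ y in cell α k x, ENNReal.ofReal |b y - Bv α b k x|
      ≤ ∫⁻ y in cell α k x, (ENNReal.ofReal |b y - β| + ENNReal.ofReal |Bv α b k x - β|) := by
        refine lintegral_mono fun y => ?_
        rw [← ENNReal.ofReal_add (abs_nonneg _) (abs_nonneg _)]
        apply ENNReal.ofReal_le_ofReal
        have := abs_sub_le (b y) β (Bv α b k x)
        rwa [abs_sub_comm β] at this
    _ = (∫⁻ y in cell α k x, ENNReal.ofReal |b y - β|) + ENNReal.ofReal |Bv α b k x - β| * V := by
        rw [lintegral_add_right _ measurable_const, setLIntegral_const]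
    _ ≤ ENNReal.ofReal (K * (2 * n) ^ n) * V + ENNReal.ofReal (K * (2 * n) ^ n) * V :=
        add_le_add h1 (h2.trans h1)
    _ ≤ _ := by
        rw [← add_mul, ← ENNReal.ofReal_add (by positivity) (by positivity)]
        exact mul_le_mul_left (ENNReal.ofReal_le_ofReal (by linarith)) _

lemma BMOb.double {n : ℕ} (hn : 0 < n) {K : ℝ} {b : (Fin n → ℝ) → ℝ} (h : BMOb K b) (x) {t : ℝ} (ht : 0 < t) :
    |βv b x t - βv b x (2 * t)| ≤ K * (2 * n) ^ n := by
  have hK := h.nonneg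
  have hn' : (1:ℝ) ≤ n := by exact_mod_cast hn
  have h0 := vol_eball_ne_zero hn x ht
  have htop := vol_eball_ne_top x ht
  refine ofReal_mul_cancel (by positivity) h0 htop ?_
  refine (avg_sub_le (intOn_eball h.loc x t) h0 htop _).trans ?_
  calc _ ≤ ∫⁻ y in eball n x (2 * t), ENNReal.ofReal |b y - βv b x (2 * t)| :=
        lintegral_mono_set (eball_mono (by linarith))
    _ ≤ _ := h.le x (2 * t) (by linarith)
    _ ≤ ENNReal.ofReal K * ENNReal.ofReal ((2 * (2 * t)) ^ n) := by gcongr; exact vol_eball_le x (by linarith)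
    _ = ENNReal.ofReal (K * (2 * n) ^ n) * ENNReal.ofReal ((2 * (t / n)) ^ n) := by
        rw [← ENNReal.ofReal_mul hK, ← ENNReal.ofReal_mul (by positivity), mul_assoc K, ← mul_pow]
        congr 3
        field_simp
    _ ≤ _ := by gcongr; exact vol_eball_ge hn x ht

lemma BMOb.log {n : ℕ} (hn : 0 < n) {K : ℝ} {b : (Fin n → ℝ) → ℝ} (h : BMOb K b) (x) {r : ℝ} (hr : 0 < r) (j : ℕ) :
    |βv b x r - βv b x (2 ^ j * r)| ≤ j * (K * (2 * n) ^ n) := by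
  induction j with
  | zero => simp
  | succ j ih =>
    have h1 := h.double hn x (t := 2 ^ j * r) (by positivity)
    rw [← mul_assoc, ← pow_succ'] at h1
    have := abs_sub_le (βv b x r) (βv b x (2 ^ j * r)) (βv b x (2 ^ (j + 1) * r))
    push_cast
    linarith

lemma dev_le {n : ℕ} (hn : 0 < n) {b : (Fin n → ℝ) → ℝ} (h : LocallyIntegrable b) (x0) {t : ℝ} (ht : 0 < t) (x) :
    ENNReal.ofReal |b x - βv b x0 t| ≤ ENNReal.ofReal ((n:ℝ) ^ n) * (ENNReal.ofReal ((t ^ n)⁻¹) *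
      ∫⁻ y in eball n x0 t, ENNReal.ofReal |b x - b y|) := by
  have h0 := vol_eball_ne_zero hn x0 ht
  have htop := vol_eball_ne_top x0 ht
  have h1 := avg_sub_le (intOn_eball h x0 t) h0 htop (b x)
  rw [abs_sub_comm]
  have h2 : ENNReal.ofReal |βv b x0 t - b x| ≤
      (volume (eball n x0 t))⁻¹ * ∫⁻ y in eball n x0 t, ENNReal.ofReal |b y - b x| := by
    calc _ = (volume (eball n x0 t))⁻¹ * (ENNReal.ofReal |βv b x0 t - b x| * volume (eball n x0 t)) := by
          rw [mul_comm (ENNReal.ofReal _), ← mul_assoc, ENNReal.inv_mul_cancel h0 htop, one_mul]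
      _ ≤ _ := by gcongr; exact h1
  refine h2.trans ?_
  rw [← mul_assoc]
  simp_rw [abs_sub_comm (b x)]
  gcongr
  exact vol_eball_inv hn x0 ht

end MB

namespace MB

/-- `r ^ (∑ 1/q_j)` -/
def wt {n : ℕ} (q : Fin n → ℝ) (r : ℝ) : ℝ≥0∞ := ENNReal.ofReal r ^ (∑ j, 1 / q j)

lemma wt_ne_zero {n : ℕ} (q : Fin n → ℝ) {r : ℝ} (hr : 0 < r) : wt q r ≠ 0 :=
  (ENNReal.rpow_pos (ENNReal.ofReal_pos.2 hr) ENNReal.ofReal_ne_top).ne'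

lemma wt_ne_top {n : ℕ} (q : Fin n → ℝ) {r : ℝ} (hr : 0 < r) : wt q r ≠ ⊤ :=
  ENNReal.rpow_ne_top_of_ne_zero (ENNReal.ofReal_pos.2 hr).ne' ENNReal.ofReal_ne_top

lemma sig_nonneg {n : ℕ} {q : Fin n → ℝ} (hq : ∀ j, 0 < q j) : 0 ≤ ∑ j, 1 / q j :=
  Finset.sum_nonneg fun j _ => by have := hq j; positivity

lemma wt_mul {n : ℕ} {q : Fin n → ℝ} (hq : ∀ j, 0 < q j) {c : ℝ} (hc : 0 ≤ c) (r : ℝ) :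
    wt q (c * r) = wt q c * wt q r := by
  unfold wt
  rw [ENNReal.ofReal_mul hc, ENNReal.mul_rpow_of_nonneg _ _ (sig_nonneg hq)]

lemma wt_mono {n : ℕ} {q : Fin n → ℝ} (hq : ∀ j, 0 < q j) {r s : ℝ} (h : r ≤ s) : wt q r ≤ wt q s :=
  ENNReal.rpow_le_rpow (ENNReal.ofReal_le_ofReal h) (sig_nonneg hq)

/-- norm of the indicator of a ball -/
def Wb {n : ℕ} (q : Fin n → ℝ) (x : Fin n → ℝ) (r : ℝ) : ℝ≥0∞ :=
  mixedLnorm n q ((eball n x r).indicator fun _ => 1)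

lemma Wb_eq {n : ℕ} (q : Fin n → ℝ) (x : Fin n → ℝ) (r : ℝ) :
    mixedNorm n q ((eball n x r).indicator fun _ => (1 : ℝ)) = Wb q x r := by
  unfold mixedNorm Wb
  congr 1
  ext y
  by_cases h : y ∈ eball n x r <;> simp [h]

lemma Wb_le {n : ℕ} {q : Fin n → ℝ} (hq : ∀ j, 0 < q j) (x r) : Wb q x r ≤ wt q 2 * wt q r := by
  rw [← wt_mul hq (by norm_num), wt, ← mixedLnorm_box n q hq x r]
  exact mixedLnorm_mono hq fun y => indicator_le_indicator_of_subset (eball_sub_box x r) (fun _ => _root_.zero_le) y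

lemma wt_le {n : ℕ} (hn : 0 < n) {q : Fin n → ℝ} (hq : ∀ j, 0 < q j) (x) {r : ℝ} (hr : 0 < r) :
    wt q r ≤ wt q (n / 2) * Wb q x r := by
  have hn' : (0:ℝ) < n := by exact_mod_cast hn
  have h : wt q (2 * (r / n)) ≤ Wb q x r := by
    rw [wt, ← mixedLnorm_box n q hq x (r / n)]
    exact mixedLnorm_mono hq fun y => indicator_le_indicator_of_subset (box_sub_eball hn x hr) (fun _ => _root_.zero_le) y
  calc wt q r = wt q (n / 2 * (2 * (r / n))) := by congr 1; field_simp
    _ = wt q (n / 2) * wt q (2 * (r / n)) := wt_mul hq (by positivity) _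
    _ ≤ _ := by gcongr

lemma mul_mixed_le {n : ℕ} {q : Fin n → ℝ} (hq : ∀ j, 0 < q j) (c : ℝ≥0∞) (g : (Fin n → ℝ) → ℝ≥0∞) :
    c * mixedLnorm n q g ≤ mixedLnorm n q (fun x => c * g x) := by
  by_cases hc : c = ⊤
  · subst hc
    rw [← ENNReal.iSup_natCast, ENNReal.iSup_mul]
    refine iSup_le fun N => ?_
    rw [← mixedLnorm_const_mul n q hq _ (ENNReal.natCast_ne_top N)]
    refine mixedLnorm_mono hq fun x => ?_
    rw [ENNReal.iSup_natCast]
    gcongr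
    exact le_top
  · rw [mixedLnorm_const_mul n q hq c hc]

/-- normalized integral over a ball -/
def av {n : ℕ} (x : Fin n → ℝ) (t : ℝ) (F : (Fin n → ℝ) → ℝ≥0∞) : ℝ≥0∞ :=
  ENNReal.ofReal ((t ^ n)⁻¹) * ∫⁻ y in eball n x t, F y

lemma av_ind {n : ℕ} (x : Fin n → ℝ) (t : ℝ) (F : (Fin n → ℝ) → ℝ≥0∞) :
    av x t ((eball n x t).indicator F) = av x t F := by
  unfold av
  rw [lintegral_indicator (measurableSet_eball n x t), Measure.restrict_restrict (measurableSet_eball n x t), inter_self]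

lemma avg_le {n : ℕ} (hn : 0 < n) {q : Fin n → ℝ} (hq : ∀ j, 1 < q j) :
    ∃ C : NNReal, ∀ F, Measurable F → ∀ (x : Fin n → ℝ) (t : ℝ), 0 < t →
      av x t F * wt q t ≤ C * mixedLnorm n q ((eball n x t).indicator F) := by
  have hq0 : ∀ j, 0 < q j := fun j => by linarith [hq j]
  obtain ⟨C, hC⟩ := T_mixed hq
  have hn2 : (0:ℝ) < n / 2 := by have : (0:ℝ) < n := by exact_mod_cast hn
                                 positivity
  refine ⟨(wt q (n / 2)).toNNReal * (12 ^ n * C), fun F hF x t ht => ?_⟩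
  have hm : Measurable ((eball n x t).indicator F) := hF.indicator (measurableSet_eball n x t)
  have h1 : av x t F * Wb q x t ≤ 12 ^ n * C * mixedLnorm n q ((eball n x t).indicator F) := by
    calc av x t F * Wb q x t ≤ mixedLnorm n q (fun y => av x t F * (eball n x t).indicator (fun _ => 1) y) :=
          mul_mixed_le hq0 _ _
      _ ≤ mixedLnorm n q (fun y => ENNReal.ofReal (12 ^ n) * T ((eball n x t).indicator F) y) := by
          refine mixedLnorm_mono hq0 fun y => ?_
          by_cases hy : y ∈ eball n x t
          · simp only [hy, indicator_of_mem, mul_one]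
            rw [← av_ind]
            exact ball_le_T ht hy _
          · simp [hy]
      _ = ENNReal.ofReal (12 ^ n) * mixedLnorm n q (T ((eball n x t).indicator F)) :=
          mixedLnorm_const_mul n q hq0 _ ENNReal.ofReal_ne_top _
      _ ≤ ENNReal.ofReal (12 ^ n) * (C * mixedLnorm n q ((eball n x t).indicator F)) := by
          gcongr; exact hC _ hm
      _ = _ := by
          rw [ENNReal.ofReal_pow (by norm_num)]
          norm_num [mul_assoc]
  calc av x t F * wt q t ≤ av x t F * (wt q (n / 2) * Wb q x t) := by gcongr; exact wt_le hn hq0 x ht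
    _ = wt q (n / 2) * (av x t F * Wb q x t) := by ring
    _ ≤ wt q (n / 2) * (12 ^ n * C * mixedLnorm n q ((eball n x t).indicator F)) := by gcongr
    _ = _ := by
        push_cast
        rw [ENNReal.coe_toNNReal (wt_ne_top q hn2)]
        ring

lemma avgb_le {n : ℕ} (hn : 0 < n) {q : Fin n → ℝ} (hq : ∀ j, 1 < q j) {K : ℝ} {b : (Fin n → ℝ) → ℝ} (h : BMOb K b) :
    ∃ C : NNReal, ∀ F, Measurable F → ∀ (x : Fin n → ℝ) (t : ℝ), 0 < t →
      av x t (fun y => ENNReal.ofReal |b y - βv b x t| * F y) * wt q t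
        ≤ C * mixedLnorm n q ((eball n x t).indicator F) := by
  have hq0 : ∀ j, 0 < q j := fun j => by linarith [hq j]
  obtain ⟨C, hC⟩ := avg_le hn hq
  obtain ⟨D, hD⟩ := Tb_mixed hq (fun e => h.cells hn (sh e))
  refine ⟨Real.toNNReal ((n:ℝ) ^ n) * (Real.toNNReal (12 ^ n) * (C * D)), fun F hF x t ht => ?_⟩
  set B := eball n x t with hB
  have mB : MeasurableSet B := measurableSet_eball n x t
  have hm : Measurable (B.indicator F) := hF.indicator mB
  set a := ENNReal.ofReal ((t ^ n)⁻¹) with ha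
  have hb := h.meas
  have m2 : Measurable fun p : (Fin n → ℝ) × (Fin n → ℝ) => ENNReal.ofReal |b p.1 - b p.2| * F p.1 := by fun_prop
  have m1 : ∀ y, Measurable fun z => ENNReal.ofReal |b y - b z| := fun y => by fun_prop
  have mT := measurable_Tb hb hm
  have h1 : av x t (fun y => ENNReal.ofReal |b y - βv b x t| * F y) ≤
      ENNReal.ofReal ((n:ℝ) ^ n) * (ENNReal.ofReal (12 ^ n) * av x t (Tb b (B.indicator F))) := by
    calc av x t (fun y => ENNReal.ofReal |b y - βv b x t| * F y)
        ≤ a * ∫⁻ y in B, ENNReal.ofReal ((n:ℝ) ^ n) * (a * ∫⁻ z in B, ENNReal.ofReal |b y - b z| * F y) := by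
          unfold av
          gcongr with y
          rw [lintegral_mul_const _ (m1 y)]
          refine (mul_le_mul_left (dev_le hn h.loc x ht y) _).trans_eq ?_
          rw [← hB, ← ha]
          ring
      _ = a * (ENNReal.ofReal ((n:ℝ) ^ n) * (a * ∫⁻ y in B, ∫⁻ z in B, ENNReal.ofReal |b y - b z| * F y)) := by
          rw [lintegral_const_mul' _ _ ENNReal.ofReal_ne_top, lintegral_const_mul' _ _ ENNReal.ofReal_ne_top]
      _ = a * (ENNReal.ofReal ((n:ℝ) ^ n) * (a * ∫⁻ z in B, ∫⁻ y in B, ENNReal.ofReal |b y - b z| * F y)) := by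
          rw [lintegral_lintegral_swap]
          exact m2.aemeasurable
      _ = a * (ENNReal.ofReal ((n:ℝ) ^ n) * (∫⁻ z in B, a * ∫⁻ y in B, ENNReal.ofReal |b z - b y| * F y)) := by
          rw [lintegral_const_mul' _ _ ENNReal.ofReal_ne_top]
          congr 3
          exact lintegral_congr fun z => lintegral_congr fun y => by rw [abs_sub_comm]
      _ ≤ a * (ENNReal.ofReal ((n:ℝ) ^ n) * (∫⁻ z in B, ENNReal.ofReal (12 ^ n) * Tb b (B.indicator F) z)) := by
          gcongr a * (ENNReal.ofReal ((n:ℝ) ^ n) * ?_)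
          refine setLIntegral_mono' mB fun z hz => ?_
          refine le_trans (le_of_eq ?_) (ball_le_Tb ht hz b (B.indicator F))
          congr 1
          refine setLIntegral_congr_fun mB fun y hy => ?_
          simp only [hy, indicator_of_mem]
      _ = _ := by
          rw [lintegral_const_mul' _ _ ENNReal.ofReal_ne_top]
          unfold av
          ring
  calc _ ≤ ENNReal.ofReal ((n:ℝ) ^ n) * (ENNReal.ofReal (12 ^ n) * av x t (Tb b (B.indicator F))) * wt q t := by gcongr
    _ = ENNReal.ofReal ((n:ℝ) ^ n) * (ENNReal.ofReal (12 ^ n) * (av x t (Tb b (B.indicator F)) * wt q t)) := by ring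
    _ ≤ ENNReal.ofReal ((n:ℝ) ^ n) * (ENNReal.ofReal (12 ^ n) * (C * (D * mixedLnorm n q (B.indicator F)))) := by
        refine mul_le_mul_right (mul_le_mul_right ?_ _) _
        refine (hC _ mT x t ht).trans ?_
        gcongr
        refine le_trans (mixedLnorm_mono hq0 fun y => ?_) (hD _ hm)
        exact indicator_le_self _ _ _
    _ = _ := by
        push_cast
        simp only [ENNReal.ofReal]
        ring

lemma osc_le {n : ℕ} (hn : 0 < n) {q : Fin n → ℝ} (hq : ∀ j, 1 < q j) {K : ℝ} {b : (Fin n → ℝ) → ℝ} (h : BMOb K b) :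
    ∃ C : NNReal, ∀ (x : Fin n → ℝ) (t : ℝ), 0 < t →
      mixedLnorm n q ((eball n x t).indicator fun y => ENNReal.ofReal |b y - βv b x t|) ≤ C * wt q t := by
  have hq0 : ∀ j, 0 < q j := fun j => by linarith [hq j]
  obtain ⟨D, hD⟩ := Tb_mixed hq (fun e => h.cells hn (sh e))
  refine ⟨Real.toNNReal ((n:ℝ) ^ n) * (Real.toNNReal (12 ^ n) * (D * (wt q 2).toNNReal)), fun x t ht => ?_⟩
  set B := eball n x t with hB
  have mB : MeasurableSet B := measurableSet_eball n x t
  calc mixedLnorm n q (B.indicator fun y => ENNReal.ofReal |b y - βv b x t|)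
      ≤ mixedLnorm n q (fun y => ENNReal.ofReal ((n:ℝ) ^ n) * (ENNReal.ofReal (12 ^ n) * Tb b (B.indicator fun _ => 1) y)) := by
        refine mixedLnorm_mono hq0 fun y => ?_
        by_cases hy : y ∈ B
        · simp only [hy, indicator_of_mem]
          refine (dev_le hn h.loc x ht y).trans ?_
          refine mul_le_mul_right ?_ _
          refine le_trans (le_of_eq ?_) (ball_le_Tb ht hy b (B.indicator fun _ => 1))
          congr 1
          refine setLIntegral_congr_fun mB fun z hz => ?_
          have : B.indicator (fun _ => (1:ℝ≥0∞)) z = 1 := indicator_of_mem hz _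
          simp only [this, mul_one]
        · simp [hy]
    _ = ENNReal.ofReal ((n:ℝ) ^ n) * (ENNReal.ofReal (12 ^ n) * mixedLnorm n q (Tb b (B.indicator fun _ => 1))) := by
        rw [mixedLnorm_const_mul n q hq0 _ ENNReal.ofReal_ne_top, mixedLnorm_const_mul n q hq0 _ ENNReal.ofReal_ne_top]
    _ ≤ ENNReal.ofReal ((n:ℝ) ^ n) * (ENNReal.ofReal (12 ^ n) * (D * (wt q 2 * wt q t))) := by
        gcongr
        refine (hD _ (measurable_const.indicator mB)).trans ?_
        gcongr
        exact Wb_le hq0 x t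
    _ = _ := by
        push_cast
        rw [ENNReal.coe_toNNReal (wt_ne_top q (by norm_num))]
        simp only [ENNReal.ofReal]
        ring

end MB

namespace MB

lemma morrey_bd {n : ℕ} (hn : 0 < n) {q : Fin n → ℝ} (hq : ∀ j, 0 < q j) (φ : (Fin n → ℝ) → ℝ → ℝ)
    (F : (Fin n → ℝ) → ℝ≥0∞) (x : Fin n → ℝ) {r : ℝ} (hr : 0 < r) (hφ : 0 < φ x r) :
    mixedLnorm n q ((eball n x r).indicator F) ≤
      morreyLnorm n q φ F * ENNReal.ofReal (φ x r) * (wt q 2 * wt q r) := by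
  have h : (ENNReal.ofReal (φ x r))⁻¹ * (Wb q x r)⁻¹ * mixedLnorm n q ((eball n x r).indicator F)
      ≤ morreyLnorm n q φ F := by
    rw [← Wb_eq]
    exact le_iSup_of_le x (le_iSup_of_le r (le_iSup_of_le hr le_rfl))
  have hw2 := wt_ne_top q (r := 2) (by norm_num)
  have hw0 : Wb q x r ≠ 0 := fun h0 => by
    have := wt_le hn hq x hr
    rw [h0, mul_zero] at this
    exact wt_ne_zero q hr (le_antisymm this (_root_.zero_le))
  have hwt : Wb q x r ≠ ⊤ := ne_top_of_le_ne_top (ENNReal.mul_ne_top hw2 (wt_ne_top q hr)) (Wb_le hq x r)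
  have ha0 : ENNReal.ofReal (φ x r) ≠ 0 := (ENNReal.ofReal_pos.2 hφ).ne'
  calc _ = ((ENNReal.ofReal (φ x r))⁻¹ * (Wb q x r)⁻¹ * mixedLnorm n q ((eball n x r).indicator F)) *
        ENNReal.ofReal (φ x r) * Wb q x r := by
        rw [show ∀ a b c d e : ℝ≥0∞, a * b * c * d * e = (a * d) * (b * e) * c from fun a b c d e => by ring,
          ENNReal.inv_mul_cancel ha0 ENNReal.ofReal_ne_top, ENNReal.inv_mul_cancel hw0 hwt, one_mul, one_mul]
    _ ≤ _ := by gcongr; exact Wb_le hq x r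

lemma disc {n : ℕ} (hn : 0 < n) {q : Fin n → ℝ} (hq : ∀ j, 0 < q j) {φ : (Fin n → ℝ) → ℝ → ℝ}
    (hφ : ∀ x r, 0 < r → 0 < φ x r) {F : (Fin n → ℝ) → ℝ≥0∞} (hM : morreyLnorm n q φ F ≠ ⊤)
    (x : Fin n → ℝ) {r : ℝ} (hr : 0 < r) (j : ℕ) {u : ℝ → ℝ} {c : ℝ} (hc : 0 ≤ c)
    (hu : ∀ τ, 2 ^ j * r < τ → c ≤ u τ) :
    ENNReal.ofReal c * mixedLnorm n q ((eball n x (2 ^ j * r)).indicator F) ≤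
      2 * wt q 2 * wt q 2 * wt q (2 ^ j * r) *
        (morreyLnorm n q φ F * ∫⁻ τ in Ioi r, ENNReal.ofReal (u τ * φ x τ / τ)) := by
  set s := 2 ^ j * r with hs
  have hs0 : 0 < s := by positivity
  have hrs : r ≤ s := by rw [hs]; exact le_mul_of_one_le_left hr.le (one_le_pow₀ (by norm_num))
  set M := morreyLnorm n q φ F
  set N := mixedLnorm n q ((eball n x s).indicator F)
  set W := wt q 2
  have hWt : W ≠ ⊤ := wt_ne_top q (by norm_num)
  have hpt : ∀ τ ∈ Ioc s (2 * s), ENNReal.ofReal c * N * ENNReal.ofReal (1 / (2 * s)) ≤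
      (W * (W * wt q s) * M) * ENNReal.ofReal (u τ * φ x τ / τ) := by
    intro τ hτ
    have hτ0 : 0 < τ := hs0.trans hτ.1
    have hp := hφ x τ hτ0
    have h1 : N ≤ M * ENNReal.ofReal (φ x τ) * (W * (W * wt q s)) := by
      calc N ≤ mixedLnorm n q ((eball n x τ).indicator F) :=
            mixedLnorm_mono hq fun y => indicator_le_indicator_of_subset (eball_mono hτ.1.le) (fun _ => _root_.zero_le) y
        _ ≤ M * ENNReal.ofReal (φ x τ) * (W * wt q τ) := morrey_bd hn hq φ F x hτ0 hp
        _ ≤ M * ENNReal.ofReal (φ x τ) * (W * wt q (2 * s)) := by gcongr; exact wt_mono hq hτ.2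
        _ = _ := by rw [wt_mul hq (by norm_num)]
    calc _ ≤ ENNReal.ofReal c * (M * ENNReal.ofReal (φ x τ) * (W * (W * wt q s))) * ENNReal.ofReal (1 / (2 * s)) := by gcongr
      _ = (W * (W * wt q s) * M) * (ENNReal.ofReal c * ENNReal.ofReal (φ x τ) * ENNReal.ofReal (1 / (2 * s))) := by ring
      _ ≤ _ := by
        gcongr
        rw [← ENNReal.ofReal_mul hc, ← ENNReal.ofReal_mul (by positivity)]
        apply ENNReal.ofReal_le_ofReal
        rw [div_eq_mul_one_div (u τ * φ x τ)]
        have := hu τ hτ.1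
        have h0 : 0 ≤ u τ := hc.trans this
        have : 1 / (2 * s) ≤ 1 / τ := one_div_le_one_div_of_le hτ0 hτ.2
        gcongr
  have hK : W * (W * wt q s) * M ≠ ⊤ :=
    ENNReal.mul_ne_top (ENNReal.mul_ne_top hWt (ENNReal.mul_ne_top hWt (wt_ne_top q hs0))) hM
  have h2 : ENNReal.ofReal c * N * ENNReal.ofReal (1 / (2 * s)) * ENNReal.ofReal s ≤
      (W * (W * wt q s) * M) * ∫⁻ τ in Ioi r, ENNReal.ofReal (u τ * φ x τ / τ) := by
    calc _ = ∫⁻ τ in Ioc s (2 * s), ENNReal.ofReal c * N * ENNReal.ofReal (1 / (2 * s)) := by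
          rw [setLIntegral_const, Real.volume_Ioc]; congr 2; ring
      _ ≤ ∫⁻ τ in Ioc s (2 * s), (W * (W * wt q s) * M) * ENNReal.ofReal (u τ * φ x τ / τ) :=
          setLIntegral_mono' measurableSet_Ioc hpt
      _ ≤ ∫⁻ τ in Ioi r, (W * (W * wt q s) * M) * ENNReal.ofReal (u τ * φ x τ / τ) :=
          lintegral_mono_set fun τ hτ => hrs.trans_lt hτ.1
      _ = _ := lintegral_const_mul' _ _ hK
  have e2 : ENNReal.ofReal (1 / (2 * s)) * ENNReal.ofReal s * 2 = 1 := by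
    rw [← ENNReal.ofReal_mul (by positivity), ← ENNReal.ofReal_ofNat 2, ← ENNReal.ofReal_mul (by positivity),
      ← ENNReal.ofReal_one]
    congr 1; field_simp
  calc ENNReal.ofReal c * N = ENNReal.ofReal c * N * ENNReal.ofReal (1 / (2 * s)) * ENNReal.ofReal s * 2 := by
        rw [mul_assoc (ENNReal.ofReal c * N), mul_assoc (ENNReal.ofReal c * N), e2, mul_one]
    _ ≤ (W * (W * wt q s) * M) * (∫⁻ τ in Ioi r, ENNReal.ofReal (u τ * φ x τ / τ)) * 2 := by gcongr
    _ = _ := by ring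

/-- from averages times weights to averages -/
lemma cancel_wt {n : ℕ} {q : Fin n → ℝ} {s : ℝ} (hs : 0 < s) {a C : ℝ≥0∞} (h : a * wt q s ≤ C * wt q s) : a ≤ C :=
  (ENNReal.mul_le_mul_iff_left (wt_ne_zero q hs) (wt_ne_top q hs)).1 h

/-- geometric dichotomy for balls -/
lemma ball_dich {n : ℕ} {x0 x : Fin n → ℝ} {r t : ℝ} (hr : 0 < r) (hx : x ∈ eball n x0 r) (ht : 0 < t)
    (H : (Fin n → ℝ) → ℝ≥0∞) :
    (eball n x t ⊆ eball n x0 (2 ^ 1 * r)) ∨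
    ∃ j : ℕ, av x t H ≤ 4 ^ n * av x0 (2 ^ j * r) H := by
  by_cases htr : t ≤ r
  · left; exact eball_sub hx (by linarith)
  · right
    push Not at htr
    obtain ⟨j, h1, h2⟩ := exists_nat_pow_near (x := t / r) (y := 2) (by rw [le_div_iff₀ hr]; linarith) (by norm_num)
    rw [le_div_iff₀ hr] at h1
    rw [div_lt_iff₀ hr] at h2
    refine ⟨j + 2, ?_⟩
    have hsub : eball n x t ⊆ eball n x0 (2 ^ (j + 2) * r) := by
      refine eball_sub hx ?_
      have : 2 ^ (j + 2) * r = 2 * (2 ^ (j + 1) * r) := by ring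
      linarith
    have hle : 2 ^ (j + 2) * r ≤ 4 * t := by
      have : 2 ^ (j + 2) * r = 4 * (2 ^ j * r) := by ring
      linarith
    unfold av
    rw [← mul_assoc]
    refine mul_le_mul' ?_ (lintegral_mono_set hsub)
    rw [← ENNReal.ofReal_ofNat 4, ← ENNReal.ofReal_pow (by norm_num), ← ENNReal.ofReal_mul (by positivity)]
    apply ENNReal.ofReal_le_ofReal
    have h3 : (2 ^ (j + 2) * r) ^ n ≤ (4 * t) ^ n := by gcongr
    rw [← div_eq_mul_inv, le_div_iff₀ (by positivity), inv_mul_le_iff₀ (by positivity), mul_comm, ← mul_pow, mul_comm r, mul_comm t]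
    exact h3

end MB

namespace MB

lemma finish {n : ℕ} {q : Fin n → ℝ} {g : (Fin n → ℝ) → ℝ≥0∞} {C P : ℝ≥0∞} {r : ℝ} (hr : 0 < r)
    (h : P ≠ ⊤ → ∃ G, Measurable G ∧ (∀ᵐ x, g x ≤ G x) ∧ mixedLnorm n q G ≤ C * wt q r * P) :
    ∃ G, Measurable G ∧ (∀ᵐ x, g x ≤ G x) ∧ mixedLnorm n q G ≤ (C + 1) * wt q r * P := by
  by_cases hP : P = ⊤
  · refine ⟨fun _ => ⊤, measurable_const, Filter.Eventually.of_forall fun _ => le_top, ?_⟩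
    rw [hP, ENNReal.mul_top]
    · exact le_top
    · exact mul_ne_zero (by simp) (wt_ne_zero q hr)
  · obtain ⟨G, h1, h2, h3⟩ := h hP
    refine ⟨G, h1, h2, h3.trans ?_⟩
    gcongr
    exact le_self_add

lemma inv_vol_le {n : ℕ} (hn : 0 < n) (x : Fin n → ℝ) {t : ℝ} (ht : 0 < t) (H : (Fin n → ℝ) → ℝ≥0∞) :
    (volume (eball n x t))⁻¹ * ∫⁻ y in eball n x t, H y ≤ ENNReal.ofReal ((n:ℝ) ^ n) * av x t H := by
  unfold av
  rw [← mul_assoc]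
  gcongr
  exact vol_eball_inv hn x ht

lemma av_congr_sub {n : ℕ} {x : Fin n → ℝ} {t : ℝ} {S : Set (Fin n → ℝ)} (h : eball n x t ⊆ S)
    (g F : (Fin n → ℝ) → ℝ≥0∞) : av x t (fun y => g y * F y) = av x t (fun y => g y * S.indicator F y) := by
  unfold av
  congr 1
  refine setLIntegral_congr_fun (measurableSet_eball n x t) fun y hy => ?_
  have : S.indicator F y = F y := indicator_of_mem (h hy) _
  simp only [this]

lemma self_mem_eball {n : ℕ} (x : Fin n → ℝ) {t : ℝ} (ht : 0 < t) : x ∈ eball n x t := by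
  rw [mem_eball, eudist_self]; exact ht

lemma key_hl {n : ℕ} (hn : 0 < n) {q : Fin n → ℝ} (hq : ∀ j, 1 < q j) :
    ∃ C : ℝ≥0∞, C ≠ ⊤ ∧ ∀ (φ : (Fin n → ℝ) → ℝ → ℝ), (∀ x r, 0 < r → 0 < φ x r) →
      ∀ f : (Fin n → ℝ) → ℝ, Measurable f → morreyNorm n q φ f ≠ ⊤ → ∀ x0 r, 0 < r →
      ∃ G, Measurable G ∧ (∀ᵐ x, (eball n x0 r).indicator (hlMax n f) x ≤ G x) ∧
        mixedLnorm n q G ≤ C * wt q r * (morreyNorm n q φ f * ∫⁻ t in Ioi r, ENNReal.ofReal (φ x0 t / t)) := by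
  have hq0 : ∀ j, 0 < q j := fun j => by linarith [hq j]
  obtain ⟨Ca, hCa⟩ := avg_le hn hq
  obtain ⟨Ct, hCt⟩ := T_mixed hq
  obtain ⟨Cs, hCs⟩ := mixedLnorm_add n q hq0
  set W := wt q 2 with hW
  have hWt : W ≠ ⊤ := wt_ne_top q (by norm_num)
  set D := 2 * W * W with hD
  have hDt : D ≠ ⊤ := by simp only [hD]; finiteness
  set c1 := ENNReal.ofReal ((n:ℝ) ^ n) * ENNReal.ofReal (12 ^ n) with hc1
  have hc1t : c1 ≠ ⊤ := by simp only [hc1]; finiteness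
  set c2 := ENNReal.ofReal ((n:ℝ) ^ n) * 4 ^ n * Ca * D with hc2
  have hc2t : c2 ≠ ⊤ := by simp only [hc2]; finiteness
  refine ⟨Cs * (c1 * Ct * D * W + c2 * W) + 1, by finiteness, ?_⟩
  intro φ hφ f hf hM x0 r hr
  apply finish hr
  intro hP
  set F : (Fin n → ℝ) → ℝ≥0∞ := fun x => ENNReal.ofReal |f x| with hFd
  have hF : Measurable F := by fun_prop
  set P := morreyNorm n q φ f * ∫⁻ t in Ioi r, ENNReal.ofReal (φ x0 t / t) with hPd
  have hN : ∀ j : ℕ, mixedLnorm n q ((eball n x0 (2 ^ j * r)).indicator F) ≤ D * wt q (2 ^ j * r) * P := by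
    intro j
    have := disc hn hq0 hφ hM x0 hr j (u := fun _ => 1) (c := 1) (by norm_num) (fun _ _ => le_rfl)
    simp only [ENNReal.ofReal_one, one_mul] at this
    exact this
  have ha : ∀ j : ℕ, av x0 (2 ^ j * r) F ≤ Ca * D * P := by
    intro j
    have hs : 0 < 2 ^ j * r := by positivity
    refine cancel_wt (q := q) hs ((hCa F hF x0 _ hs).trans ?_)
    calc _ ≤ Ca * (D * wt q (2 ^ j * r) * P) := by gcongr; exact hN j
      _ = _ := by ring
  set B1 := eball n x0 (2 ^ 1 * r) with hB1
  have mF1 : Measurable (B1.indicator F) := hF.indicator (measurableSet_eball n x0 _)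
  have mT := measurable_T (B1.indicator F)
  have mI : Measurable ((eball n x0 r).indicator fun _ => (1:ℝ≥0∞)) := measurable_const.indicator (measurableSet_eball n x0 _)
  refine ⟨fun x => c1 * T (B1.indicator F) x + c2 * P * (eball n x0 r).indicator (fun _ => 1) x,
    (mT.const_mul _).add (mI.const_mul _), Filter.Eventually.of_forall fun x => ?_, ?_⟩
  · by_cases hx : x ∈ eball n x0 r
    · simp only [hx, indicator_of_mem, mul_one]
      unfold hlMax
      refine iSup_le fun t => iSup_le fun ht => ?_
      refine (inv_vol_le hn x ht _).trans ?_
      rcases ball_dich hr hx ht F with h | ⟨j, h⟩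
      · refine le_trans ?_ le_self_add
        rw [hc1, mul_assoc]
        gcongr ENNReal.ofReal ((n:ℝ) ^ n) * ?_
        have e := av_congr_sub h (fun _ => 1) F
        simp only [one_mul] at e
        refine e.trans_le ?_
        exact ball_le_T ht (self_mem_eball x ht) _
      · refine le_trans ?_ le_add_self
        calc _ ≤ ENNReal.ofReal ((n:ℝ) ^ n) * (4 ^ n * (Ca * D * P)) := by
              gcongr
              exact h.trans (by gcongr; exact ha j)
          _ = _ := by rw [hc2]; ring
    · simp [hx]
  · refine (hCs _ _ (mT.const_mul _) (mI.const_mul _)).trans ?_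
    rw [mixedLnorm_const_mul n q hq0 _ hc1t, mixedLnorm_const_mul n q hq0 _ (by finiteness)]
    have hN1 := hN 1
    rw [wt_mul hq0 (by norm_num), pow_one, ← hW] at hN1
    calc _ ≤ Cs * (c1 * (Ct * (D * (W * wt q r) * P)) + c2 * P * (W * wt q r)) := by
          gcongr
          · refine (hCt _ mF1).trans ?_
            gcongr
            rw [hB1, pow_one]; exact hN1
          · exact Wb_le hq0 x0 r
      _ = _ := by ring

lemma key_comm0 {n : ℕ} (hn : 0 < n) {q : Fin n → ℝ} (hq : ∀ j, 1 < q j) {K : ℝ} {b : (Fin n → ℝ) → ℝ} (hb : BMOb K b) :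
    ∃ C : ℝ≥0∞, C ≠ ⊤ ∧ ∀ (φ : (Fin n → ℝ) → ℝ → ℝ), (∀ x r, 0 < r → 0 < φ x r) →
      ∀ f : (Fin n → ℝ) → ℝ, Measurable f → morreyNorm n q φ f ≠ ⊤ → ∀ x0 r, 0 < r →
      ∃ G, Measurable G ∧ (∀ᵐ x, (eball n x0 r).indicator (maxComm n b f) x ≤ G x) ∧
        mixedLnorm n q G ≤ C * wt q r * (morreyNorm n q φ f *
          ∫⁻ t in Ioi r, ENNReal.ofReal ((1 + Real.log (t / r)) * φ x0 t / t)) := by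
  have hq0 : ∀ j, 0 < q j := fun j => by linarith [hq j]
  have hbm := hb.meas
  obtain ⟨Ca, hCa⟩ := avg_le hn hq
  obtain ⟨Cb, hCb⟩ := avgb_le hn hq hb
  obtain ⟨Co, hCo⟩ := osc_le hn hq hb
  obtain ⟨Ct, hCt⟩ := Tb_mixed hq (fun e => hb.cells hn (sh e))
  obtain ⟨Cs, hCs⟩ := mixedLnorm_add n q hq0
  set W := wt q 2 with hW
  have hWt : W ≠ ⊤ := wt_ne_top q (by norm_num)
  set D := 2 * W * W with hD
  have hDt : D ≠ ⊤ := by simp only [hD]; finiteness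
  set c1 := ENNReal.ofReal ((n:ℝ) ^ n) * ENNReal.ofReal (12 ^ n) with hc1
  have hc1t : c1 ≠ ⊤ := by simp only [hc1]; finiteness
  set E : ℝ≥0∞ := ((Ca:ℝ≥0∞) + Cb) * (2 * D) with hE
  have hEt : E ≠ ⊤ := by simp only [hE]; finiteness
  set c2 := ENNReal.ofReal ((n:ℝ) ^ n) * 4 ^ n * E with hc2
  have hc2t : c2 ≠ ⊤ := by simp only [hc2]; finiteness
  set K' := K * (2 * n) ^ n with hK'
  have hK0 : 0 ≤ K' := by have := hb.nonneg; positivity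
  set L := ENNReal.ofReal K' + 1 with hL
  have hLt : L ≠ ⊤ := by simp only [hL]; finiteness
  refine ⟨Cs * (c1 * Ct * D * W + c2 * (Cs * (Co + L * W))) + 1, by finiteness, ?_⟩
  intro φ hφ f hf hM x0 r hr
  apply finish hr
  intro hP
  set F : (Fin n → ℝ) → ℝ≥0∞ := fun x => ENNReal.ofReal |f x| with hFd
  have hF : Measurable F := by fun_prop
  set P := morreyNorm n q φ f * ∫⁻ t in Ioi r, ENNReal.ofReal ((1 + Real.log (t / r)) * φ x0 t / t) with hPd
  have hN : ∀ j : ℕ, ENNReal.ofReal ((1 + j) / 2) * mixedLnorm n q ((eball n x0 (2 ^ j * r)).indicator F)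
      ≤ D * wt q (2 ^ j * r) * P := by
    intro j
    refine disc hn hq0 hφ hM x0 hr j (u := fun t => 1 + Real.log (t / r)) (c := (1 + j) / 2) (by positivity) ?_
    intro τ hτ
    have h1 : (2:ℝ) ^ j ≤ τ / r := by rw [le_div_iff₀ hr]; exact hτ.le
    have h2 := Real.log_le_log (by positivity) h1
    rw [Real.log_pow] at h2
    have h3 := Real.log_two_gt_d9
    have h4 : (j:ℝ) * (1 / 2) ≤ j * Real.log 2 := by gcongr; linarith
    linarith
  have hgen : ∀ (j : ℕ) (a : ℝ≥0∞) (C : NNReal), a * wt q (2 ^ j * r) ≤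
      C * mixedLnorm n q ((eball n x0 (2 ^ j * r)).indicator F) → ENNReal.ofReal (1 + j) * a ≤ C * (2 * D) * P := by
    intro j a C h
    have hs : 0 < 2 ^ j * r := by positivity
    refine cancel_wt (q := q) hs ?_
    have e : ENNReal.ofReal (1 + j) = 2 * ENNReal.ofReal ((1 + j) / 2) := by
      rw [← ENNReal.ofReal_ofNat 2, ← ENNReal.ofReal_mul (by positivity)]; congr 1; ring
    calc ENNReal.ofReal (1 + j) * a * wt q (2 ^ j * r) = ENNReal.ofReal (1 + j) * (a * wt q (2 ^ j * r)) := by ring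
      _ ≤ ENNReal.ofReal (1 + j) * (C * mixedLnorm n q ((eball n x0 (2 ^ j * r)).indicator F)) := by gcongr
      _ = C * 2 * (ENNReal.ofReal ((1 + j) / 2) * mixedLnorm n q ((eball n x0 (2 ^ j * r)).indicator F)) := by
          rw [e]; ring
      _ ≤ C * 2 * (D * wt q (2 ^ j * r) * P) := mul_le_mul_right (hN j) _
      _ = _ := by ring
  have ha : ∀ j : ℕ, ENNReal.ofReal (1 + j) * av x0 (2 ^ j * r) F ≤ Ca * (2 * D) * P := fun j =>
    hgen j _ _ (hCa F hF x0 _ (by positivity))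
  have hA : ∀ j : ℕ, ENNReal.ofReal (1 + j) *
      av x0 (2 ^ j * r) (fun y => ENNReal.ofReal |b y - βv b x0 (2 ^ j * r)| * F y) ≤ Cb * (2 * D) * P := fun j =>
    hgen j _ _ (hCb F hF x0 _ (by positivity))
  set β := βv b x0 r with hβ
  have hfar : ∀ (x) (j : ℕ), av x0 (2 ^ j * r) (fun y => ENNReal.ofReal |b x - b y| * F y) ≤
      E * P * (ENNReal.ofReal |b x - β| + L) := by
    intro x j
    set s := 2 ^ j * r with hs
    set γ := βv b x0 s with hγ
    have hlog : |β - γ| ≤ j * K' := hb.log hn x0 hr j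
    have one_le : (1:ℝ≥0∞) ≤ ENNReal.ofReal (1 + j) := by
      rw [← ENNReal.ofReal_one]; exact ENNReal.ofReal_le_ofReal (by simp)
    have mA : Measurable fun y => ENNReal.ofReal |b y - γ| * F y := by fun_prop
    have h1 : av x0 s (fun y => ENNReal.ofReal |b x - b y| * F y) ≤
        (ENNReal.ofReal |b x - β| + ENNReal.ofReal (j * K')) * av x0 s F
          + av x0 s (fun y => ENNReal.ofReal |b y - γ| * F y) := by
      unfold av
      calc _ ≤ ENNReal.ofReal ((s ^ n)⁻¹) * ∫⁻ y in eball n x0 s,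
            ((ENNReal.ofReal |b x - β| + ENNReal.ofReal (j * K')) * F y + ENNReal.ofReal |b y - γ| * F y) := by
            refine mul_le_mul_right (lintegral_mono fun y => ?_) _
            rw [← add_mul]
            refine mul_le_mul_left ?_ _
            rw [← ENNReal.ofReal_add (abs_nonneg _) (by positivity), ← ENNReal.ofReal_add (by positivity) (abs_nonneg _)]
            apply ENNReal.ofReal_le_ofReal
            have t1 := abs_sub_le (b x) β (b y)
            have t2 := abs_sub_le β γ (b y)
            rw [abs_sub_comm γ] at t2
            linarith
        _ = _ := by
            rw [lintegral_add_right _ mA, lintegral_const_mul _ hF]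
            ring
    have a1 : av x0 s F ≤ Ca * (2 * D) * P :=
      (le_mul_of_one_le_left _root_.zero_le one_le).trans (ha j)
    have a2 : av x0 s (fun y => ENNReal.ofReal |b y - γ| * F y) ≤ Cb * (2 * D) * P :=
      (le_mul_of_one_le_left _root_.zero_le one_le).trans (hA j)
    have a3 : ENNReal.ofReal (j * K') * av x0 s F ≤ ENNReal.ofReal K' * (Ca * (2 * D) * P) := by
      calc _ = ENNReal.ofReal K' * (ENNReal.ofReal j * av x0 s F) := by
            rw [ENNReal.ofReal_mul (by positivity)]; ring
        _ ≤ ENNReal.ofReal K' * (ENNReal.ofReal (1 + j) * av x0 s F) := by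
            gcongr; linarith
        _ ≤ _ := mul_le_mul_right (ha j) _
    have hCaE : Ca * (2 * D) * P ≤ E * P := by rw [hE]; gcongr; exact le_self_add
    have hCbE : Cb * (2 * D) * P ≤ E * P := by rw [hE]; gcongr; exact le_add_self
    calc _ ≤ _ := h1
      _ = ENNReal.ofReal |b x - β| * av x0 s F + ENNReal.ofReal (j * K') * av x0 s F
          + av x0 s (fun y => ENNReal.ofReal |b y - γ| * F y) := by rw [add_mul]
      _ ≤ ENNReal.ofReal |b x - β| * (E * P) + ENNReal.ofReal K' * (E * P) + E * P := by
          refine add_le_add (add_le_add ?_ ?_) (a2.trans hCbE)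
          · exact mul_le_mul_right (a1.trans hCaE) _
          · exact a3.trans (mul_le_mul_right hCaE _)
      _ = _ := by rw [hL]; ring
  set B1 := eball n x0 (2 ^ 1 * r) with hB1
  set B0 := eball n x0 r with hB0
  have mB0 : MeasurableSet B0 := measurableSet_eball n x0 _
  have mF1 : Measurable (B1.indicator F) := hF.indicator (measurableSet_eball n x0 _)
  have mT := measurable_Tb hbm mF1
  have mI : Measurable (B0.indicator fun _ => (1:ℝ≥0∞)) := measurable_const.indicator mB0
  have mO0 : Measurable fun y => ENNReal.ofReal |b y - β| := by fun_prop
  have mO : Measurable (B0.indicator fun y => ENNReal.ofReal |b y - β|) := mO0.indicator mB0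
  refine ⟨fun x => c1 * Tb b (B1.indicator F) x + c2 * P * (B0.indicator (fun y => ENNReal.ofReal |b y - β|) x +
    L * B0.indicator (fun _ => 1) x),
    (mT.const_mul _).add ((mO.add (mI.const_mul _)).const_mul _), Filter.Eventually.of_forall fun x => ?_, ?_⟩
  · by_cases hx : x ∈ B0
    · simp only [hx, indicator_of_mem, mul_one]
      unfold maxComm
      refine iSup_le fun t => iSup_le fun ht => ?_
      simp only [ENNReal.ofReal_mul (abs_nonneg _)]
      refine (inv_vol_le hn x ht _).trans ?_
      rcases ball_dich hr hx ht (fun y => ENNReal.ofReal |b x - b y| * F y) with h | ⟨j, h⟩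
      · refine le_trans ?_ le_self_add
        rw [hc1, mul_assoc]
        gcongr ENNReal.ofReal ((n:ℝ) ^ n) * ?_
        refine (av_congr_sub h (fun y => ENNReal.ofReal |b x - b y|) F).trans_le ?_
        exact ball_le_Tb ht (self_mem_eball x ht) b _
      · refine le_trans ?_ le_add_self
        calc _ ≤ ENNReal.ofReal ((n:ℝ) ^ n) * (4 ^ n * (E * P * (ENNReal.ofReal |b x - β| + L))) :=
              mul_le_mul_right (h.trans (mul_le_mul_right (hfar x j) _)) _
          _ = _ := by rw [hc2]; ring
    · simp [hx]
  · refine (hCs _ _ (mT.const_mul _) ((mO.add (mI.const_mul _)).const_mul _)).trans ?_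
    rw [mixedLnorm_const_mul n q hq0 _ hc1t, mixedLnorm_const_mul n q hq0 _ (by finiteness)]
    have hN1 := hN 1
    rw [wt_mul hq0 (by norm_num), pow_one, ← hW] at hN1
    norm_num at hN1
    calc _ ≤ Cs * (c1 * (Ct * (D * (W * wt q r) * P)) + c2 * P * (Cs * (Co * wt q r + L * (W * wt q r)))) := by
          refine mul_le_mul_right (add_le_add (mul_le_mul_right ?_ _) (mul_le_mul_right ?_ _)) _
          · refine (hCt _ mF1).trans ?_
            gcongr
            rw [hB1, pow_one]; exact hN1
          · refine (hCs _ _ mO (mI.const_mul _)).trans ?_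
            rw [mixedLnorm_const_mul n q hq0 _ hLt]
            gcongr
            · exact hCo x0 r hr
            · exact Wb_le hq0 x0 r
      _ = _ := by ring

lemma key_comm {n : ℕ} (hn : 0 < n) {q : Fin n → ℝ} (hq : ∀ j, 1 < q j) {b : (Fin n → ℝ) → ℝ}
    (hbl : LocallyIntegrable b) (hb : bmoNorm n b ≠ ⊤) :
    ∃ C : ℝ≥0∞, C ≠ ⊤ ∧ ∀ (φ : (Fin n → ℝ) → ℝ → ℝ), (∀ x r, 0 < r → 0 < φ x r) →
      ∀ f : (Fin n → ℝ) → ℝ, Measurable f → morreyNorm n q φ f ≠ ⊤ → ∀ x0 r, 0 < r →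
      ∃ G, Measurable G ∧ (∀ᵐ x, (eball n x0 r).indicator (maxComm n b f) x ≤ G x) ∧
        mixedLnorm n q G ≤ C * wt q r * (morreyNorm n q φ f *
          ∫⁻ t in Ioi r, ENNReal.ofReal ((1 + Real.log (t / r)) * φ x0 t / t)) := by
  obtain ⟨K, b', hb', hae⟩ := BMOb_of hn hbl hb
  obtain ⟨C, hC, h⟩ := key_comm0 hn hq hb'
  refine ⟨C, hC, fun φ hφ f hf hM x0 r hr => ?_⟩
  obtain ⟨G, h1, h2, h3⟩ := h φ hφ f hf hM x0 r hr
  refine ⟨G, h1, ?_, h3⟩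
  filter_upwards [h2, hae] with x hx hbx
  refine le_trans (le_of_eq ?_) hx
  have : maxComm n b f x = maxComm n b' f x := by
    unfold maxComm
    refine iSup_congr fun t => iSup_congr fun ht => ?_
    congr 1
    refine lintegral_congr_ae (ae_restrict_of_ae ?_)
    filter_upwards [hae] with y hy
    rw [hy, hbx]
  simp only [indicator, this]

end MB

namespace MB

lemma prod_rpow {ι : Type} (s : Finset ι) (a : ι → ℝ) {x : ℝ≥0∞} (h0 : x ≠ 0) (ht : x ≠ ⊤) :
    ∏ k ∈ s, x ^ a k = x ^ ∑ k ∈ s, a k := by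
  classical
  induction s using Finset.induction_on with
  | empty => simp
  | insert k s hk ih => rw [Finset.prod_insert hk, Finset.sum_insert hk, ih, ENNReal.rpow_add _ _ h0 ht]

lemma prod_wt {n m : ℕ} {Q : Fin m → Fin n → ℝ} {q : Fin n → ℝ} (hq : ∀ j, 1 / q j = ∑ k, 1 / Q k j)
    {r : ℝ} (hr : 0 < r) : ∏ k, wt (Q k) r = wt q r := by
  unfold wt
  rw [prod_rpow _ _ (ENNReal.ofReal_pos.2 hr).ne' ENNReal.ofReal_ne_top]
  congr 1
  rw [Finset.sum_comm]
  exact Finset.sum_congr rfl fun j _ => (hq j).symm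

lemma ne_top_prod {ι : Type} (s : Finset ι) {a : ι → ℝ≥0∞} (h : ∀ i, a i ≠ ⊤) : ∏ i ∈ s, a i ≠ ⊤ :=
  ENNReal.prod_ne_top fun i _ => h i

lemma comm_le {n m : ℕ} (b : Fin m → ((Fin n → ℝ) → ℝ)) (i : Fin m)
    (f : Fin m → ((Fin n → ℝ) → ℝ)) (x : Fin n → ℝ) :
    multiMaxComm n m b i f x ≤ maxComm n (b i) (f i) x * ∏ k ∈ Finset.univ.erase i, hlMax n (f k) x := by
  unfold multiMaxComm
  refine mul_le_mul' le_rfl ?_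
  refine iSup_le fun r => iSup_le fun hr => ?_
  refine Finset.prod_le_prod' fun k _ => ?_
  exact le_iSup_of_le r (le_iSup_of_le hr le_rfl)

lemma maj {n m : ℕ} (hn : 0 < n)
    {Q : Fin m → Fin n → ℝ} (hQ : ∀ k j, 1 < Q k j)
    {q : Fin n → ℝ} (hq0 : ∀ j, 0 < q j) (hq : ∀ j, 1 / q j = ∑ k, 1 / Q k j)
    {φ : (Fin n → ℝ) → ℝ → ℝ} {Φ : Fin m → (Fin n → ℝ) → ℝ → ℝ}
    (hΦpos : ∀ k x r, 0 < r → 0 < Φ k x r)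
    {C₀ : ℝ} (hC₀ : 0 < C₀) (i : Fin m)
    (hcond : ∀ (x : Fin n → ℝ) (r : ℝ), 0 < r →
      (∫⁻ t in Set.Ioi r, ENNReal.ofReal ((1 + Real.log (t / r)) * Φ i x t / t))
          * ∏ k ∈ Finset.univ.erase i,
              ∫⁻ t in Set.Ioi r, ENNReal.ofReal (Φ k x t / t)
        ≤ ENNReal.ofReal (C₀ * φ x r))
    (b : Fin m → ((Fin n → ℝ) → ℝ))
    (hbloc : ∀ k, LocallyIntegrable (b k)) (hb : ∀ k, bmoNorm n (b k) ≠ ⊤) :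
    ∃ C : ℝ≥0∞, C ≠ ⊤ ∧ ∀ f : Fin m → ((Fin n → ℝ) → ℝ),
      (∀ k, Measurable (f k)) → (∀ k, morreyNorm n (Q k) (Φ k) (f k) ≠ ⊤) → ∀ x0 r, 0 < r →
      ∃ H, Measurable H ∧ (∀ᵐ x, (eball n x0 r).indicator (multiMaxComm n m b i f) x ≤ H x) ∧
        mixedLnorm n q H ≤ C * wt q r * ((∏ k, morreyNorm n (Q k) (Φ k) (f k)) * ENNReal.ofReal (φ x0 r)) := by
  classical
  choose A hA hA' using fun k => key_hl hn (hQ k)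
  choose B hB hB' using fun k => key_comm hn (hQ k) (hbloc k) (hb k)
  set C : Fin m → ℝ≥0∞ := fun k => if k = i then B k else A k with hCd
  have hC : ∀ k, C k ≠ ⊤ := fun k => by simp only [hCd]; split_ifs; exacts [hB k, hA k]
  refine ⟨(∏ k, C k) * ENNReal.ofReal C₀, ENNReal.mul_ne_top (ne_top_prod _ hC) ENNReal.ofReal_ne_top,
    fun f hf hM x0 r hr => ?_⟩
  set I : Fin m → ℝ≥0∞ := fun k => if k = i then
    ∫⁻ t in Set.Ioi r, ENNReal.ofReal ((1 + Real.log (t / r)) * Φ k x0 t / t) else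
      ∫⁻ t in Set.Ioi r, ENNReal.ofReal (Φ k x0 t / t) with hI
  set S : Fin m → (Fin n → ℝ) → ℝ≥0∞ := fun k => if k = i then maxComm n (b k) (f k) else hlMax n (f k) with hS
  have hG : ∀ k, ∃ G, Measurable G ∧ (∀ᵐ x, (eball n x0 r).indicator (S k) x ≤ G x) ∧
      mixedLnorm n (Q k) G ≤ C k * wt (Q k) r * (morreyNorm n (Q k) (Φ k) (f k) * I k) := by
    intro k
    by_cases hk : k = i
    · simp only [hCd, hI, hS, hk, if_true]
      exact hB' i (Φ i) (hΦpos i) (f i) (hf i) (hM i) x0 r hr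
    · simp only [hCd, hI, hS, hk, if_false]
      exact hA' k (Φ k) (hΦpos k) (f k) (hf k) (hM k) x0 r hr
  choose G hG1 hG2 hG3 using hG
  have hprod : ∀ (u : Fin m → ℝ≥0∞), ∏ k, u k = u i * ∏ k ∈ Finset.univ.erase i, u k := fun u =>
    (Finset.mul_prod_erase _ _ (Finset.mem_univ i)).symm
  refine ⟨fun x => ∏ k, G k x, Finset.measurable_fun_prod _ fun k _ => hG1 k, ?_, ?_⟩
  · filter_upwards [ae_all_iff.2 hG2] with x hx
    by_cases hxB : x ∈ eball n x0 r
    · simp only [hxB, indicator_of_mem] at hx ⊢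
      refine (comm_le b i f x).trans ?_
      calc _ = ∏ k, S k x := by
            rw [hprod]
            congr 1
            · simp [hS]
            · refine Finset.prod_congr rfl fun k hk => ?_
              simp [hS, Finset.ne_of_mem_erase hk]
        _ ≤ _ := Finset.prod_le_prod' fun k _ => hx k
    · simp [hxB]
  · refine (mixedLnorm_holder n Finset.univ q Q hq0 (fun k j => by linarith [hQ k j]) hq G hG1).trans ?_
    have hIc : ∏ k, I k ≤ ENNReal.ofReal C₀ * ENNReal.ofReal (φ x0 r) := by
      rw [← ENNReal.ofReal_mul hC₀.le]
      refine le_trans (le_of_eq ?_) (hcond x0 r hr)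
      rw [hprod]
      congr 1
      · simp [hI]
      · refine Finset.prod_congr rfl fun k hk => ?_
        simp [hI, Finset.ne_of_mem_erase hk]
    calc _ ≤ ∏ k, (C k * wt (Q k) r * (morreyNorm n (Q k) (Φ k) (f k) * I k)) :=
          Finset.prod_le_prod' fun k _ => hG3 k
      _ = (∏ k, C k) * wt q r * ((∏ k, morreyNorm n (Q k) (Φ k) (f k)) * ∏ k, I k) := by
          rw [Finset.prod_mul_distrib, Finset.prod_mul_distrib, Finset.prod_mul_distrib, prod_wt hq hr]
      _ ≤ (∏ k, C k) * wt q r * ((∏ k, morreyNorm n (Q k) (Φ k) (f k)) *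
          (ENNReal.ofReal C₀ * ENNReal.ofReal (φ x0 r))) := mul_le_mul_right (mul_le_mul_right hIc _) _
      _ = _ := by ring

lemma morrey_of {n : ℕ} (hn : 0 < n) {q : Fin n → ℝ} (hq0 : ∀ j, 0 < q j) {φ : (Fin n → ℝ) → ℝ → ℝ}
    {g : (Fin n → ℝ) → ℝ≥0∞} {C P : ℝ≥0∞}
    (h : ∀ x0 r, 0 < r → mixedLnorm n q ((eball n x0 r).indicator g) ≤ C * wt q r * (P * ENNReal.ofReal (φ x0 r))) :
    morreyLnorm n q φ g ≤ C * wt q (n / 2) * P := by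
  unfold morreyLnorm
  refine iSup_le fun x => iSup_le fun r => iSup_le fun hr => ?_
  rw [Wb_eq]
  calc _ ≤ (ENNReal.ofReal (φ x r))⁻¹ * (Wb q x r)⁻¹ *
        (C * (wt q (n / 2) * Wb q x r) * (P * ENNReal.ofReal (φ x r))) := by
        refine mul_le_mul_right ((h x r hr).trans ?_) _
        gcongr
        exact wt_le hn hq0 x hr
    _ = ((ENNReal.ofReal (φ x r))⁻¹ * ENNReal.ofReal (φ x r)) * ((Wb q x r)⁻¹ * Wb q x r) *
        (C * wt q (n / 2) * P) := by ring
    _ ≤ 1 * 1 * (C * wt q (n / 2) * P) := by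
        gcongr <;> exact ENNReal.inv_mul_le_one _
    _ = _ := by ring

end MB

theorem stmt17 (n m : ℕ) (hn : 0 < n) (hm : 2 ≤ m)
    (Q : Fin m → Fin n → ℝ) (hQ : ∀ k j, 1 < Q k j)
    (q : Fin n → ℝ) (hq : ∀ j, 1 / q j = ∑ k, 1 / Q k j)
    (φ : (Fin n → ℝ) → ℝ → ℝ) (Φ : Fin m → (Fin n → ℝ) → ℝ → ℝ)
    (hφmeas : Measurable fun p : (Fin n → ℝ) × ℝ => φ p.1 p.2)
    (hΦmeas : ∀ k, Measurable fun p : (Fin n → ℝ) × ℝ => Φ k p.1 p.2)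
    (hφpos : ∀ x r, 0 < r → 0 < φ x r)
    (hΦpos : ∀ k x r, 0 < r → 0 < Φ k x r)
    (C₀ : ℝ) (hC₀ : 0 < C₀)
    (hcond : ∀ (i : Fin m) (x : Fin n → ℝ) (r : ℝ), 0 < r →
      (∫⁻ t in Set.Ioi r, ENNReal.ofReal ((1 + Real.log (t / r)) * Φ i x t / t))
          * ∏ k ∈ Finset.univ.erase i,
              ∫⁻ t in Set.Ioi r, ENNReal.ofReal (Φ k x t / t)
        ≤ ENNReal.ofReal (C₀ * φ x r))
    (b : Fin m → ((Fin n → ℝ) → ℝ))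
    (hbloc : ∀ k, LocallyIntegrable (b k)) (hb : ∀ k, bmoNorm n (b k) ≠ ⊤) :
    ∃ C : ℝ, 0 < C ∧ ∀ f : Fin m → ((Fin n → ℝ) → ℝ),
      (∀ k, Measurable (f k)) → (∀ k, morreyNorm n (Q k) (Φ k) (f k) ≠ ⊤) →
      (∀ i : Fin m,
        morreyLnorm n q φ (multiMaxComm n m b i f)
          ≤ ENNReal.ofReal C * ∏ k, morreyNorm n (Q k) (Φ k) (f k)) ∧
      morreyLnorm n q φ (fun x => ∑ i, multiMaxComm n m b i f x)
        ≤ ENNReal.ofReal C * ∏ k, morreyNorm n (Q k) (Φ k) (f k) := by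
  classical
  have hn' : (0:ℝ) < n := by exact_mod_cast hn
  have hq0 : ∀ j, 0 < q j := by
    intro j
    have hne : (Finset.univ : Finset (Fin m)).Nonempty := ⟨⟨0, by omega⟩, Finset.mem_univ _⟩
    have h1 : 0 < ∑ k, 1 / Q k j := Finset.sum_pos (fun k _ => by have := hQ k j; positivity) hne
    rw [← hq j] at h1
    exact one_div_pos.1 h1
  choose C hC h using fun i => MB.maj hn hQ hq0 hq hΦpos hC₀ i (hcond i) b hbloc hb
  obtain ⟨D, hD⟩ := MB.mixedLnorm_sum n q hq0 (Finset.univ : Finset (Fin m))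
  set S : ℝ≥0∞ := ∑ i, C i with hS
  have hSt : S ≠ ⊤ := ENNReal.sum_ne_top.2 fun i _ => hC i
  have hw : MB.wt q (n / 2) ≠ ⊤ := MB.wt_ne_top q (by positivity)
  set E : ℝ≥0∞ := (D + 1) * S * MB.wt q (n / 2) + 1 with hE
  have hEt : E ≠ ⊤ := by simp only [hE]; finiteness
  have hE0 : E ≠ 0 := by simp [hE]
  refine ⟨E.toReal, ENNReal.toReal_pos hE0 hEt, fun f hf hM => ?_⟩
  rw [ENNReal.ofReal_toReal hEt]
  set P := ∏ k, morreyNorm n (Q k) (Φ k) (f k) with hP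
  have hfin : ∀ g, (∀ x0 r, 0 < r → mixedLnorm n q ((eball n x0 r).indicator g) ≤
      ((D + 1) * S) * MB.wt q r * (P * ENNReal.ofReal (φ x0 r))) → morreyLnorm n q φ g ≤ E * P := by
    intro g hg
    refine (MB.morrey_of hn hq0 hg).trans ?_
    gcongr
    exact le_self_add
  constructor
  · intro i
    refine hfin _ fun x0 r hr => ?_
    obtain ⟨H, _, h2, h3⟩ := h i f hf hM x0 r hr
    refine (MB.mixedLnorm_mono_ae n q hq0 h2).trans (h3.trans ?_)
    gcongr
    calc C i ≤ S := Finset.single_le_sum (f := C) (fun _ _ => _root_.zero_le) (Finset.mem_univ i)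
      _ = 1 * S := (one_mul _).symm
      _ ≤ _ := by gcongr; exact le_add_self
  · refine hfin _ fun x0 r hr => ?_
    choose H h1 h2 h3 using fun i => h i f hf hM x0 r hr
    have hle : ∀ᵐ x, (eball n x0 r).indicator (fun x => ∑ i, multiMaxComm n m b i f x) x ≤ ∑ i, H i x := by
      filter_upwards [ae_all_iff.2 h2] with x hx
      by_cases hxB : x ∈ eball n x0 r
      · simp only [hxB, indicator_of_mem] at hx ⊢
        exact Finset.sum_le_sum fun i _ => hx i
      · simp [hxB]
    refine (MB.mixedLnorm_mono_ae n q hq0 hle).trans ((hD H h1).trans ?_)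
    calc _ ≤ D * ∑ i, (C i * MB.wt q r * (P * ENNReal.ofReal (φ x0 r))) :=
          mul_le_mul_right (Finset.sum_le_sum fun i _ => h3 i) _
      _ = D * S * MB.wt q r * (P * ENNReal.ofReal (φ x0 r)) := by
          rw [← Finset.sum_mul, ← Finset.sum_mul]; ring
      _ ≤ _ := by gcongr; exact le_self_add
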